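/- Fix real numbers 0 < R₁ < R₂. For a V₄-quartic field K with Δ_K even, exactly one of the discriminants of the three quadratic subfields of K has strictly smaller 2-adic valuation than the other two; call it Δ₃, and let Δ₁, Δ₂ denote the other two labeled so that |Δ₁| ≤ |Δ₂|. Then, as X → ∞, the number of V₄-quartic subfields K of ℂ with Δ_K < X, with Δ_K even, and with R₁²·|Δ₃| ≤ |Δ₁| and |Δ₂| < R₂²·|Δ₃| equals (5/96)·P·X^{1/2}·(log R₂ − log R₁)² + o(X^{1/2}). -/

import Mathlib

noncomputable section

/-- The (absolute) discriminant of a subfield of `ℂ`, defined to be `0` when the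
field is not finite-dimensional over `ℚ`. -/
def quartDisc (K : IntermediateField ℚ ℂ) : ℤ := by
  classical
  exact if h : FiniteDimensional ℚ K then
    haveI : CharZero K := charZero_of_injective_algebraMap (algebraMap ℚ K).injective
    haveI : NumberField K := ⟨⟩
    NumberField.discr K
  else 0

/-- A `V₄`-quartic field: a subfield of `ℂ` of degree 4 over `ℚ`, Galois over `ℚ`, with
Galois group isomorphic to the Klein four-group. -/
def IsV4Quartic (K : IntermediateField ℚ ℂ) : Prop :=
  Module.finrank ℚ K = 4 ∧ IsGalois ℚ K ∧
    Nonempty ((K ≃ₐ[ℚ] K) ≃* Multiplicative (ZMod 2 × ZMod 2))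

/-- `F` is a quadratic subfield of `K`. -/
def IsQuadSubfield (K F : IntermediateField ℚ ℂ) : Prop :=
  F ≤ K ∧ Module.finrank ℚ F = 2

open Module

lemma int_of_sqfree_mul_sq {a : ℤ} (ha : Squarefree a) (t : ℚ) (n : ℤ)
    (h : (a : ℚ) * t ^ 2 = n) : ∃ k : ℤ, t = k := by
  have h1 : a * t.num ^ 2 = n * (t.den : ℤ) ^ 2 := by
    have hd : (t.den : ℚ) ≠ 0 := by exact_mod_cast t.den_nz
    have : (a : ℚ) * (t.num : ℚ) ^ 2 = n * (t.den : ℚ) ^ 2 := by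
      rw [← h, ← Rat.num_div_den t]
      simp only [Rat.num_div_den]
      nth_rw 2 [← Rat.num_div_den t]
      field_simp
    exact_mod_cast this
  have hc : IsCoprime ((t.den : ℤ) ^ 2) (t.num ^ 2) := by
    apply IsCoprime.pow
    rw [Int.isCoprime_iff_gcd_eq_one]
    have := t.reduced
    rw [Int.gcd_comm]
    simpa [Int.gcd, Nat.Coprime] using this
  have h2 : (t.den : ℤ) ^ 2 ∣ a := hc.dvd_of_dvd_mul_right ⟨n, by rw [h1]; ring⟩
  have h3 := ha t.den (by rw [← sq]; exact h2)
  have h4 : t.den = 1 := by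
    have := Int.isUnit_iff.mp h3
    omega
  exact ⟨t.num, by conv_lhs => rw [← Rat.num_div_den t, h4]; simp⟩

lemma isIntegral_rat {K : Type*} [Field K] [CharZero K] (q : ℚ) (h : IsIntegral ℤ (q : K)) :
    ∃ n : ℤ, q = n := by
  have : IsIntegral ℤ q := by
    have hi : Function.Injective (Rat.castHom K) := Rat.cast_injective
    exact (isIntegral_algHom_iff (Rat.castHom K).toIntAlgHom hi).mp h
  obtain ⟨y, hy⟩ := IsIntegrallyClosed.isIntegral_iff.mp this
  exact ⟨y, by simpa using hy.symm⟩

lemma quad_integral {K : Type*} [Field K] [CharZero K] (A : K) (a : ℤ) (ha : Squarefree a)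
    (hA : A ^ 2 = a) (σ : K ≃+* K) (hσ : σ A = -A) (u v : ℚ)
    (h : IsIntegral ℤ ((u : K) + v * A)) :
    ∃ U V : ℤ, (U : ℚ) = 2 * u ∧ (V : ℚ) = 2 * v ∧ (4 : ℤ) ∣ U ^ 2 - a * V ^ 2 := by
  have h' : IsIntegral ℤ ((u : K) - v * A) := by
    have := map_isIntegral_int (σ : K →+* K) h
    simpa [hσ, sub_eq_add_neg] using this
  obtain ⟨U, hU⟩ := isIntegral_rat (K := K) (2 * u) (by
    have e1 : ((2 * u : ℚ) : K) = ((u : K) + v * A) + (u - v * A) := by push_cast; ring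
    rw [e1]
    exact h.add h')
  obtain ⟨N, hN⟩ := isIntegral_rat (K := K) (u ^ 2 - a * v ^ 2) (by
    have e1 : ((u ^ 2 - a * v ^ 2 : ℚ) : K) = ((u : K) + v * A) * (u - v * A) := by
      push_cast; rw [← hA]; ring
    rw [e1]
    exact h.mul h')
  have h1 : (a : ℚ) * (2 * v) ^ 2 = ((U ^ 2 - 4 * N : ℤ) : ℚ) := by
    push_cast; rw [← hU, ← hN]; ring
  obtain ⟨V, hV⟩ := int_of_sqfree_mul_sq ha _ _ h1
  refine ⟨U, V, hU.symm, hV.symm, N, ?_⟩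
  rw [hV] at h1
  have : a * V ^ 2 = U ^ 2 - 4 * N := by exact_mod_cast h1
  linarith

lemma discr_of_span {K : Type*} [Field K] [NumberField K] {ι : Type*} [Fintype ι] [DecidableEq ι]
    (e : ι → K) (hc : Fintype.card ι = finrank ℚ K) (he : ∀ i, IsIntegral ℤ (e i))
    (h : ∀ α : K, IsIntegral ℤ α → ∃ n : ι → ℤ, α = ∑ i, (n i : K) * e i) :
    (NumberField.discr K : ℚ) = Algebra.discr ℚ e := by
  have hsp : ⊤ ≤ Submodule.span ℚ (Set.range e) := by
    rw [← (NumberField.integralBasis K).span_eq, Submodule.span_le]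
    rintro _ ⟨j, rfl⟩
    obtain ⟨n, hn⟩ := h (NumberField.integralBasis K j) (by
      rw [NumberField.integralBasis_apply]
      exact (NumberField.RingOfIntegers.basis K j).isIntegral_coe)
    rw [hn]
    refine Submodule.sum_mem _ fun i _ => ?_
    have : (n i : K) * e i = (n i : ℚ) • e i := by simp [Algebra.smul_def]
    rw [this]
    exact Submodule.smul_mem _ _ (Submodule.subset_span ⟨i, rfl⟩)
  have hli : LinearIndependent ℚ e := linearIndependent_of_top_le_span_of_card_eq_finrank hsp hc
  let E : Basis ι ℚ K := Basis.mk hli hsp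
  have hE : (E : ι → K) = e := Basis.coe_mk _ _
  rw [NumberField.coe_discr, ← hE]
  symm
  apply Algebra.discr_eq_discr_of_toMatrix_coeff_isIntegral
  · intro i j
    rw [Basis.toMatrix_apply]
    obtain ⟨n, hn⟩ := h (NumberField.integralBasis K j) (by
      rw [NumberField.integralBasis_apply]
      exact (NumberField.RingOfIntegers.basis K j).isIntegral_coe)
    have : NumberField.integralBasis K j = ∑ i, (n i : ℚ) • E i := by
      rw [hn]
      apply Finset.sum_congr rfl
      intro i _
      simp [hE, Algebra.smul_def]
    rw [this, E.repr_sum_self]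
    exact isIntegral_algebraMap (R := ℤ) (A := ℚ) (x := n i)
  · intro i j
    rw [Basis.toMatrix_apply, hE]
    have : e j = algebraMap (NumberField.RingOfIntegers K) K (⟨e j, (mem_integralClosure_iff ℤ K).mpr (he j)⟩ : integralClosure ℤ K) := rfl
    rw [this]
    erw [NumberField.integralBasis_repr_apply]
    exact isIntegral_algebraMap

open Module

/-- The discriminant of the quadratic field attached to a squarefree integer. -/
def Dq (m : ℤ) : ℤ := if m % 4 = 1 then m else 4 * m

lemma trace_zero_of_neg {K : Type*} [Field K] [NumberField K] (A : K) (σ : K ≃+* K)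
    (h : σ A = -A) : Algebra.trace ℚ K A = 0 := by
  have h1 := Algebra.trace_eq_of_algEquiv (AlgEquiv.ofRingEquiv (f := σ) (R := ℚ) (fun r => by simp)) A
  have h2 : (AlgEquiv.ofRingEquiv (f := σ) (R := ℚ) (fun r => by simp)) A = -A := h
  rw [h2, map_neg] at h1
  linarith

lemma trace_rat {K : Type*} [Field K] [NumberField K] (q : ℚ) :
    Algebra.trace ℚ K (q : K) = finrank ℚ K * q := by
  have := Algebra.trace_algebraMap (S := K) q
  simpa using this

lemma rep_quad {K : Type*} [Field K] [NumberField K] (hf : finrank ℚ K = 2) (A : K)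
    (hA : A ≠ 0) (σ : K ≃+* K) (hσ : σ A = -A) (α : K) : ∃ u v : ℚ, α = u + v * A := by
  have hli : LinearIndependent ℚ ![1, A] := by
    rw [LinearIndependent.pair_iff]
    intro s t h
    simp only [Algebra.smul_def, eq_ratCast, mul_one] at h
    have h2 := congrArg σ h
    simp only [map_add, map_mul, map_ratCast, hσ, map_zero] at h2
    have h3 : (s : K) = 0 := by linear_combination (h + h2) / 2
    have h4 : (t : K) * A = 0 := by linear_combination (h - h2) / 2
    simp only [Rat.cast_eq_zero, mul_eq_zero, hA, or_false] at h3 h4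
    exact ⟨h3, h4⟩
  have hsp := hli.span_eq_top_of_card_eq_finrank (by simp [hf])
  have : α ∈ Submodule.span ℚ (Set.range ![1, A]) := by rw [hsp]; trivial
  rw [Matrix.range_cons, Matrix.range_cons, Matrix.range_empty, Set.union_empty,
    Set.singleton_union, Submodule.mem_span_pair] at this
  obtain ⟨u, v, h⟩ := this
  exact ⟨u, v, by rw [← h]; simp [Algebra.smul_def]⟩

lemma emod4_cases (a : ℤ) (ha : Squarefree a) : a % 4 = 1 ∨ a % 4 = 2 ∨ a % 4 = 3 := by
  have : a % 4 ≠ 0 := by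
    intro h
    have h1 : (2 : ℤ) * 2 ∣ a := by omega
    have := Int.isUnit_iff.mp (ha 2 h1)
    omega
  omega

lemma sq_emod4 (U : ℤ) : (U % 2 = 0 ∧ U ^ 2 % 4 = 0) ∨ (U % 2 = 1 ∧ U ^ 2 % 4 = 1) := by
  rcases Int.even_or_odd' U with ⟨k, rfl | rfl⟩
  · left; constructor
    · omega
    · ring_nf; omega
  · right; constructor
    · omega
    · ring_nf; omega

lemma half_integral {K : Type*} [Field K] [CharZero K] (A : K) (a : ℤ) (hA : A ^ 2 = a)
    (h1 : a % 4 = 1) : IsIntegral ℤ ((1 + A) / 2) := by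
  obtain ⟨k, hk⟩ : ∃ k, a = 4 * k + 1 := ⟨a / 4, by omega⟩
  refine ⟨Polynomial.X ^ 2 - Polynomial.X - Polynomial.C k, by monicity!, ?_⟩
  simp only [Polynomial.eval₂_sub, Polynomial.eval₂_pow, Polynomial.eval₂_X, Polynomial.eval₂_C,
    Int.coe_castRingHom, algebraMap_int_eq]
  have : A ^ 2 = 4 * k + 1 := by rw [hA, hk]; push_cast; ring
  linear_combination this / 4

lemma discr_quad {K : Type*} [Field K] [NumberField K] (hf : finrank ℚ K = 2) (A : K) (a : ℤ)
    (ha : Squarefree a) (hA : A ^ 2 = a) (σ : K ≃+* K) (hσ : σ A = -A) :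
    NumberField.discr K = Dq a := by
  have ha0 : (a : K) ≠ 0 := by exact_mod_cast ha.ne_zero
  have hA0 : A ≠ 0 := by rintro rfl; simp at hA; exact ha0 hA.symm
  have hAi : IsIntegral ℤ A := by
    apply IsIntegral.of_pow (n := 2) (by norm_num)
    rw [hA]; exact isIntegral_algebraMap (R := ℤ) (x := a)
  have hd : Algebra.discr ℚ ![1, A] = 4 * a := by
    have t1 : Algebra.trace ℚ K 1 = 2 := by
      have := trace_rat (K := K) 1; rw [hf] at this; simpa using this
    have t2 := trace_zero_of_neg A σ hσ
    have t3 : Algebra.trace ℚ K (A * A) = 2 * a := by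
      have := trace_rat (K := K) a; rw [hf] at this
      rw [← sq, hA]; simpa using this
    rw [Algebra.discr_def, Matrix.det_fin_two]
    simp [Algebra.traceMatrix_apply, Algebra.traceForm_apply, t1, t2, t3]
    ring
  have key : ∀ α : K, IsIntegral ℤ α → ∃ U V : ℤ, α = (U + V * A) / 2 ∧ (4 : ℤ) ∣ U ^ 2 - a * V ^ 2 := by
    intro α hα
    obtain ⟨u, v, rfl⟩ := rep_quad hf A hA0 σ hσ α
    obtain ⟨U, V, hU, hV, h4⟩ := quad_integral A a ha hA σ hσ u v hα
    refine ⟨U, V, ?_, h4⟩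
    have hU' : (U : K) = 2 * u := by exact_mod_cast congrArg (Rat.cast (K := K)) hU
    have hV' : (V : K) = 2 * v := by exact_mod_cast congrArg (Rat.cast (K := K)) hV
    rw [hU', hV']; ring
  have : (NumberField.discr K : ℚ) = (Dq a : ℚ) := by
    unfold Dq
    by_cases h1 : a % 4 = 1
    · rw [if_pos h1]
      have e1 : ![1, (1 + A) / 2] =
          ((!![1, 0; 1/2, 1/2] : Matrix (Fin 2) (Fin 2) ℚ).map (algebraMap ℚ K)).mulVec ![1, A] := by
        ext i; fin_cases i
        · simp [Matrix.mulVec, dotProduct, Fin.sum_univ_two]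
        · simp [Matrix.mulVec, dotProduct, Fin.sum_univ_two]; ring
      rw [discr_of_span ![1, (1 + A) / 2] (by simp [hf])]
      · rw [e1, Algebra.discr_of_matrix_mulVec, hd, Matrix.det_fin_two_of]
        ring
      · intro i; fin_cases i
        · exact isIntegral_one
        · show IsIntegral ℤ ((1 + A) / 2)
          exact half_integral A a hA h1
      · intro α hα
        obtain ⟨U, V, rfl, h4⟩ := key α hα
        obtain ⟨k, hk⟩ : ∃ k, U = V + 2 * k := by
          have : (U ^ 2 - a * V ^ 2) % 4 = 0 := by omega
          have h5 : (U^2 - V^2) % 4 = 0 := by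
            obtain ⟨k, hk⟩ : ∃ k, a = 4 * k + 1 := ⟨a / 4, by omega⟩
            rw [hk] at this
            ring_nf at this ⊢
            omega
          refine ⟨(U - V) / 2, ?_⟩
          rcases sq_emod4 U with h | h <;> rcases sq_emod4 V with h' | h' <;> omega
        refine ⟨![k, V], ?_⟩
        simp [hk]; ring
    · rw [if_neg h1]
      rw [discr_of_span ![1, A] (by simp [hf])]
      · rw [hd]; push_cast; ring
      · intro i; fin_cases i
        · exact isIntegral_one
        · exact hAi
      · intro α hα
        obtain ⟨U, V, rfl, h4⟩ := key α hα
        have h6 : U % 2 = 0 ∧ V % 2 = 0 := by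
          rcases emod4_cases a ha with h | h | h
          · omega
          · obtain ⟨k, hk⟩ : ∃ k, a = 4 * k + 2 := ⟨a / 4, by omega⟩
            have : U ^ 2 - a * V ^ 2 = U ^ 2 - 2 * V ^ 2 - 4 * (k * V^2) := by rw [hk]; ring
            rcases sq_emod4 U with h | h <;> rcases sq_emod4 V with h' | h' <;> omega
          · obtain ⟨k, hk⟩ : ∃ k, a = 4 * k + 3 := ⟨a / 4, by omega⟩
            have : U ^ 2 - a * V ^ 2 = U ^ 2 - 3 * V ^ 2 - 4 * (k * V^2) := by rw [hk]; ring
            rcases sq_emod4 U with h | h <;> rcases sq_emod4 V with h' | h' <;> omega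
        obtain ⟨p, hp⟩ : ∃ p, U = 2 * p := ⟨U / 2, by omega⟩
        obtain ⟨q, hq⟩ : ∃ q, V = 2 * q := ⟨V / 2, by omega⟩
        refine ⟨![p, q], ?_⟩
        simp [hp, hq]; ring
  exact_mod_cast this

open Module

lemma isInt_congr {K : Type*} [Field K] {a b : K} (h : IsIntegral ℤ a) (e : b = a) :
    IsIntegral ℤ b := e ▸ h

lemma even_of_four_dvd (a U V : ℤ) (ha : Squarefree a) (h1 : a % 4 ≠ 1)
    (h4 : 4 ∣ U ^ 2 - a * V ^ 2) : U % 2 = 0 ∧ V % 2 = 0 := by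
  rcases emod4_cases a ha with h | h | h
  · omega
  · obtain ⟨k, hk⟩ : ∃ k, a = 4 * k + 2 := ⟨a / 4, by omega⟩
    have : U ^ 2 - a * V ^ 2 = U ^ 2 - 2 * V ^ 2 - 4 * (k * V^2) := by rw [hk]; ring
    rcases sq_emod4 U with h | h <;> rcases sq_emod4 V with h' | h' <;> omega
  · obtain ⟨k, hk⟩ : ∃ k, a = 4 * k + 3 := ⟨a / 4, by omega⟩
    have : U ^ 2 - a * V ^ 2 = U ^ 2 - 3 * V ^ 2 - 4 * (k * V^2) := by rw [hk]; ring
    rcases sq_emod4 U with h | h <;> rcases sq_emod4 V with h' | h' <;> omega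

structure Biquad (K : Type*) [Field K] [NumberField K] (x y z : ℤ) (A B C : K)
    (σ τ : K ≃+* K) : Prop where
  hf : finrank ℚ K = 4
  ha : Squarefree (y * z)
  hb : Squarefree (x * z)
  hc : Squarefree (x * y)
  hA : A ^ 2 = y * z
  hB : B ^ 2 = x * z
  hC : C ^ 2 = x * y
  hAB : A * B = z * C
  hAC : A * C = y * B
  hBC : B * C = x * A
  σA : σ A = A
  σB : σ B = -B
  σC : σ C = -C
  τA : τ A = -A
  τB : τ B = B
  τC : τ C = -C

namespace Biquad
lemma isInt_int {K : Type*} [Field K] (n : ℤ) : IsIntegral ℤ (n : K) :=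
  isIntegral_algebraMap (R := ℤ) (x := n)

variable {K : Type*} [Field K] [NumberField K] {x y z : ℤ} {A B C : K} {σ τ : K ≃+* K}

lemma rep (H : Biquad K x y z A B C σ τ) (α : K) :
    ∃ p q r s : ℚ, α = p + q * A + r * B + s * C := by
  have hA0 : A ≠ 0 := by
    rintro rfl
    have := H.hA; have h2 := H.ha.ne_zero
    have : ((y * z : ℤ) : K) = 0 := by push_cast; rw [← this]; ring
    exact h2 (by exact_mod_cast this)
  have hB0 : B ≠ 0 := by
    rintro rfl
    have := H.hB; have h2 := H.hb.ne_zero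
    have : ((x * z : ℤ) : K) = 0 := by push_cast; rw [← this]; ring
    exact h2 (by exact_mod_cast this)
  have hC0 : C ≠ 0 := by
    rintro rfl
    have := H.hC; have h2 := H.hc.ne_zero
    have : ((x * y : ℤ) : K) = 0 := by push_cast; rw [← this]; ring
    exact h2 (by exact_mod_cast this)
  have hli : LinearIndependent ℚ ![1, A, B, C] := by
    rw [Fintype.linearIndependent_iff]
    intro g h
    simp only [Algebra.smul_def, eq_ratCast, Fin.sum_univ_four, Matrix.cons_val_zero,
      Matrix.cons_val_one, Matrix.cons_val, mul_one] at h
    have h2 := congrArg σ h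
    have h3 := congrArg τ h
    have h4 := congrArg τ h2
    simp only [map_add, map_mul, map_ratCast, map_neg, H.σA, H.σB, H.σC, H.τA, H.τB, H.τC, map_zero] at h2 h3 h4
    have k0 : (g 0 : K) = 0 := by linear_combination (h + h2 + h3 + h4) / 4
    have k1 : (g 1 : K) * A = 0 := by linear_combination (h + h2 - h3 - h4) / 4
    have k2 : (g 2 : K) * B = 0 := by linear_combination (h - h2 + h3 - h4) / 4
    have k3 : (g 3 : K) * C = 0 := by linear_combination (h - h2 - h3 + h4) / 4
    simp only [Rat.cast_eq_zero, mul_eq_zero, hA0, hB0, hC0, or_false] at k0 k1 k2 k3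
    intro i; fin_cases i <;> assumption
  have hsp := hli.span_eq_top_of_card_eq_finrank (by simp [H.hf])
  have : α ∈ Submodule.span ℚ (Set.range ![1, A, B, C]) := by rw [hsp]; trivial
  rw [Submodule.mem_span_range_iff_exists_fun] at this
  obtain ⟨c, h⟩ := this
  refine ⟨c 0, c 1, c 2, c 3, ?_⟩
  rw [← h]; simp [Fin.sum_univ_four, Algebra.smul_def]

lemma discr0 (H : Biquad K x y z A B C σ τ) :
    Algebra.discr ℚ ![1, A, B, C] = 256 * (x * y * z : ℚ) ^ 2 := by
  have tn : ∀ n : ℤ, Algebra.trace ℚ K (n : K) = 4 * n := by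
    intro n
    have := trace_rat (K := K) n; rw [H.hf] at this; simpa using this
  have t1 : Algebra.trace ℚ K 1 = 4 := by simpa using tn 1
  have tA := trace_zero_of_neg A τ H.τA
  have tB := trace_zero_of_neg B σ H.σB
  have tC := trace_zero_of_neg C σ H.σC
  have smulz : ∀ (n : ℤ) (E : K), Algebra.trace ℚ K E = 0 → Algebra.trace ℚ K (n * E) = 0 := by
    intro n E hE
    have : (n : K) * E = n • E := by simp
    rw [this, map_zsmul, hE, smul_zero]
  have tAB := smulz z C tC
  have tAC := smulz y B tB
  have tBC := smulz x A tA
  have tAA : Algebra.trace ℚ K (A * A) = 4 * (y * z) := by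
    rw [← sq, H.hA]; have := tn (y * z); push_cast at this; exact this
  have tBB : Algebra.trace ℚ K (B * B) = 4 * (x * z) := by
    rw [← sq, H.hB]; have := tn (x * z); push_cast at this; exact this
  have tCC : Algebra.trace ℚ K (C * C) = 4 * (x * y) := by
    rw [← sq, H.hC]; have := tn (x * y); push_cast at this; exact this
  have : Algebra.traceMatrix ℚ ![1, A, B, C] = Matrix.diagonal ![(4 : ℚ), 4 * (y * z), 4 * (x * z), 4 * (x * y)] := by
    ext i j
    fin_cases i <;> fin_cases j <;>
      simp [Algebra.traceMatrix_apply, Algebra.traceForm_apply, t1, tA, tB, tC, tAA, tBB, tCC,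
        H.hAB, H.hAC, H.hBC, tAB, tAC, tBC, mul_comm B A, mul_comm C A, mul_comm C B]
  rw [Algebra.discr_def, this, Matrix.det_diagonal, Fin.prod_univ_four]
  simp; ring

lemma key (H : Biquad K x y z A B C σ τ) (hb1 : (x * z) % 4 ≠ 1) (hc1 : (x * y) % 4 ≠ 1)
    (ha1 : (y * z) % 2 = 1) (α : K) (hα : IsIntegral ℤ α) :
    ∃ P Q R S : ℤ, α = (P + Q * A + R * B + S * C) / 2 ∧
      (∃ U : ℤ, 2 * U = P ^ 2 + (y * z) * Q ^ 2 - (x * z) * R ^ 2 - (x * y) * S ^ 2 ∧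
        4 ∣ U ^ 2 - (y * z) * (P * Q - x * R * S) ^ 2) ∧
      (∃ U : ℤ, 2 * U = P ^ 2 + (x * z) * R ^ 2 - (y * z) * Q ^ 2 - (x * y) * S ^ 2 ∧
        4 ∣ U ^ 2 - (x * z) * (P * R - y * Q * S) ^ 2) := by
  obtain ⟨p, q, r, s, rfl⟩ := H.rep α
  have hA' : A ^ 2 = ((y * z : ℤ) : K) := by push_cast; exact H.hA
  have hB' : B ^ 2 = ((x * z : ℤ) : K) := by push_cast; exact H.hB
  have hC' : C ^ 2 = ((x * y : ℤ) : K) := by push_cast; exact H.hC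
  have iσ := map_isIntegral_int (σ : K →+* K) hα
  have iτ := map_isIntegral_int (τ : K →+* K) hα
  have iρ := map_isIntegral_int (σ : K →+* K) iτ
  simp only [RingHom.coe_coe, map_add, map_mul, map_ratCast, map_neg, H.σA, H.σB, H.σC, H.τA, H.τB, H.τC] at iσ iτ iρ
  obtain ⟨P, Q, hP, hQ, h1⟩ := quad_integral A (y * z) H.ha hA' τ H.τA (2 * p) (2 * q) (by
    have e : (((2 * p : ℚ) : K) + ((2 * q : ℚ) : K) * A) = (p + q * A + r * B + s * C) + (p + q * A + r * -B + s * -C) := by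
      push_cast; ring
    rw [e]; exact hα.add iσ)
  obtain ⟨P2, R, hP2, hR, h2⟩ := quad_integral B (x * z) H.hb hB' σ H.σB (2 * p) (2 * r) (by
    have e : (((2 * p : ℚ) : K) + ((2 * r : ℚ) : K) * B) = (p + q * A + r * B + s * C) + (p + q * -A + r * B + s * -C) := by
      push_cast; ring
    rw [e]; exact hα.add iτ)
  obtain ⟨P3, S, hP3, hS, h3⟩ := quad_integral C (x * y) H.hc hC' σ H.σC (2 * p) (2 * s) (by
    have e : (((2 * p : ℚ) : K) + ((2 * s : ℚ) : K) * C) = (p + q * A + r * B + s * C) + (p + q * -A + r * -B + s * - -C) := by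
      push_cast; ring
    rw [e]; exact hα.add iρ)
  have eP2 : P2 = P := by exact_mod_cast hP2.trans hP.symm
  have eP3 : P3 = P := by exact_mod_cast hP3.trans hP.symm
  subst eP2; subst eP3
  obtain ⟨hPe, hRe⟩ := even_of_four_dvd _ _ _ H.hb hb1 h2
  obtain ⟨-, hSe⟩ := even_of_four_dvd _ _ _ H.hc hc1 h3
  have hQe : Q % 2 = 0 := by
    obtain ⟨k, hk⟩ : ∃ k, y * z = 2 * k + 1 := ⟨y * z / 2, by omega⟩
    obtain ⟨l, hl⟩ : ∃ l, P3 = 2 * l := ⟨P3 / 2, by omega⟩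
    rw [hk, hl] at h1
    have : (2 * l) ^ 2 - (2 * k + 1) * Q ^ 2 = 2 * (2 * l ^ 2 - k * Q ^ 2) - Q ^ 2 := by ring
    rcases sq_emod4 Q with h | h <;> omega
  obtain ⟨P', rfl⟩ : ∃ l, P3 = 2 * l := ⟨P3 / 2, by omega⟩
  obtain ⟨Q', rfl⟩ : ∃ l, Q = 2 * l := ⟨Q / 2, by omega⟩
  obtain ⟨R', rfl⟩ : ∃ l, R = 2 * l := ⟨R / 2, by omega⟩
  obtain ⟨S', rfl⟩ : ∃ l, S = 2 * l := ⟨S / 2, by omega⟩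
  have ep : p = P' / 2 := by push_cast at hP; linarith
  have eq : q = Q' / 2 := by push_cast at hQ; linarith
  have er : r = R' / 2 := by push_cast at hR; linarith
  have es : s = S' / 2 := by push_cast at hS; linarith
  refine ⟨P', Q', R', S', by rw [ep, eq, er, es]; push_cast; ring, ?_, ?_⟩
  · obtain ⟨U, V, hU, hV, h⟩ := quad_integral A (y * z) H.ha hA' τ H.τA
      ((P' ^ 2 + (y * z) * Q' ^ 2 - (x * z) * R' ^ 2 - (x * y) * S' ^ 2) / 4)
      ((P' * Q' - x * R' * S') / 2) (by
        refine isInt_congr (hα.mul iσ) ?_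
        rw [ep, eq, er, es]
        push_cast
        rw [← H.hA, ← H.hB, ← H.hC]
        linear_combination (R' * S' / 2 : K) * H.hBC)
    have hV' : V = P' * Q' - x * R' * S' := by
      have : (V : ℚ) = ((P' * Q' - x * R' * S' : ℤ) : ℚ) := by rw [hV]; push_cast; ring
      exact_mod_cast this
    refine ⟨U, ?_, hV' ▸ h⟩
    have : ((2 * U : ℤ) : ℚ) = ((P' ^ 2 + (y * z) * Q' ^ 2 - (x * z) * R' ^ 2 - (x * y) * S' ^ 2 : ℤ) : ℚ) := by
      push_cast; rw [hU]; ring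
    exact_mod_cast this
  · obtain ⟨U, V, hU, hV, h⟩ := quad_integral B (x * z) H.hb hB' σ H.σB
      ((P' ^ 2 + (x * z) * R' ^ 2 - (y * z) * Q' ^ 2 - (x * y) * S' ^ 2) / 4)
      ((P' * R' - y * Q' * S') / 2) (by
        refine isInt_congr (hα.mul iτ) ?_
        rw [ep, eq, er, es]
        push_cast
        rw [← H.hA, ← H.hB, ← H.hC]
        linear_combination (Q' * S' / 2 : K) * H.hAC)
    have hV' : V = P' * R' - y * Q' * S' := by
      have : (V : ℚ) = ((P' * R' - y * Q' * S' : ℤ) : ℚ) := by rw [hV]; push_cast; ring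
      exact_mod_cast this
    refine ⟨U, ?_, hV' ▸ h⟩
    have : ((2 * U : ℤ) : ℚ) = ((P' ^ 2 + (x * z) * R' ^ 2 - (y * z) * Q' ^ 2 - (x * y) * S' ^ 2 : ℤ) : ℚ) := by
      push_cast; rw [hU]; ring
    exact_mod_cast this


lemma odd_yz (ha1 : (y * z) % 2 = 1) : y % 2 = 1 ∧ z % 2 = 1 := by
  have : Odd (y * z) := Int.odd_iff.mpr ha1
  rw [Int.odd_mul] at this
  exact ⟨Int.odd_iff.mp this.1, Int.odd_iff.mp this.2⟩

lemma isInt_A (H : Biquad K x y z A B C σ τ) : IsIntegral ℤ A := by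
  apply IsIntegral.of_pow (n := 2) (by norm_num)
  rw [H.hA]; exact (isInt_int y).mul (isInt_int z)

lemma isInt_B (H : Biquad K x y z A B C σ τ) : IsIntegral ℤ B := by
  apply IsIntegral.of_pow (n := 2) (by norm_num)
  rw [H.hB]; exact (isInt_int x).mul (isInt_int z)

lemma discr_type1 (H : Biquad K x y z A B C σ τ) (hb1 : (x * z) % 4 ≠ 1) (hc1 : (x * y) % 4 ≠ 1)
    (ha1 : (y * z) % 4 = 1) : NumberField.discr K = 16 * (x * y * z) ^ 2 := by
  have ha2 : (y * z) % 2 = 1 := by omega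
  obtain ⟨hy, hz⟩ := odd_yz ha2
  have hA' : A ^ 2 = ((y * z : ℤ) : K) := by push_cast; exact H.hA
  have e1 : ![1, (1 + A) / 2, B, (B + C) / 2] =
      ((!![1, 0, 0, 0; 1/2, 1/2, 0, 0; 0, 0, 1, 0; 0, 0, 1/2, 1/2] : Matrix (Fin 4) (Fin 4) ℚ).map
        (algebraMap ℚ K)).mulVec ![1, A, B, C] := by
    ext i; fin_cases i
    · simp [Matrix.mulVec, dotProduct, Fin.sum_univ_four]
    · simp [Matrix.mulVec, dotProduct, Fin.sum_univ_four]; ring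
    · simp [Matrix.mulVec, dotProduct, Fin.sum_univ_four]
    · simp [Matrix.mulVec, dotProduct, Fin.sum_univ_four]; ring
  have : (NumberField.discr K : ℚ) = ((16 * (x * y * z) ^ 2 : ℤ) : ℚ) := by
    rw [discr_of_span ![1, (1 + A) / 2, B, (B + C) / 2] (by simp [H.hf])]
    · rw [e1, Algebra.discr_of_matrix_mulVec, H.discr0]
      have : (!![1, 0, 0, 0; 1/2, 1/2, 0, 0; 0, 0, 1, 0; 0, 0, 1/2, 1/2] : Matrix (Fin 4) (Fin 4) ℚ).det = 1 / 4 := by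
        simp [Matrix.det_succ_row_zero, Fin.sum_univ_succ, Fin.succAbove]; norm_num
      rw [this]; push_cast; ring
    · have i1 := half_integral A (y * z) hA' ha1
      intro i; fin_cases i
      · exact isIntegral_one
      · exact i1
      · exact H.isInt_B
      · show IsIntegral ℤ ((B + C) / 2)
        apply IsIntegral.of_pow (n := 2) (by norm_num)
        obtain ⟨k, hk⟩ : ∃ k, y + z = 4 * k + 2 := by
          have : (y + z) % 4 = 2 := by
            have h4 : (y % 4 = 1 ∨ y % 4 = 3) := by omega
            have h5 : (z % 4 = 1 ∨ z % 4 = 3) := by omega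
            rw [Int.mul_emod] at ha1
            rcases h4 with h4 | h4 <;> rcases h5 with h5 | h5 <;> rw [h4, h5] at ha1 <;> omega
          exact ⟨(y + z) / 4, by omega⟩
        refine isInt_congr ((isInt_int x).mul ((isInt_int k).add i1)) ?_
        have hk' : (y + z : K) = 4 * k + 2 := by exact_mod_cast congrArg (Int.cast (R := K)) hk
        linear_combination H.hB / 4 + H.hC / 4 + H.hBC / 2 + (x : K) / 4 * hk'
    · intro α hα
      obtain ⟨P, Q, R, S, rfl, -, ⟨U, hU, h4⟩⟩ := H.key hb1 hc1 ha2 α hα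
      obtain ⟨hU2, hV2⟩ := even_of_four_dvd _ _ _ H.hb hb1 h4
      have hpar2 : (Even P ∨ Even R) ↔ (Even Q ∨ Even S) := by
        have h5 : Even (P * R - y * Q * S) := Int.even_iff.mpr hV2
        have hy' : ¬ Even y := by rw [Int.not_even_iff]; exact hy
        rw [Int.even_sub, Int.even_mul, Int.even_mul, Int.even_mul] at h5
        tauto
      have hres : P % 2 = Q % 2 ∧ R % 2 = S % 2 := by
        simp only [Int.even_iff] at hpar2
        obtain ⟨k, hk⟩ : ∃ k, y * z = 4 * k + 1 := ⟨y * z / 4, by omega⟩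
        have hcase : ((x * z) % 4 = 2 ∧ (x * y) % 4 = 2) ∨ ((x * z) % 4 = 3 ∧ (x * y) % 4 = 3) := by
          have h6 := emod4_cases _ H.hb
          have h7 := emod4_cases _ H.hc
          have h8 : (x * z) % 2 = (x * y) % 2 := by
            rw [Int.mul_emod, hz, Int.mul_emod x y, hy]
          omega
        rcases hcase with ⟨hb, hc⟩ | ⟨hb, hc⟩
        · obtain ⟨l, hl⟩ : ∃ l, x * z = 4 * l + 2 := ⟨x * z / 4, by omega⟩
          obtain ⟨m, hm⟩ : ∃ m, x * y = 4 * m + 2 := ⟨x * y / 4, by omega⟩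
          have e : P ^ 2 + (x * z) * R ^ 2 - (y * z) * Q ^ 2 - (x * y) * S ^ 2 =
            P ^ 2 + 2 * R ^ 2 - Q ^ 2 - 2 * S ^ 2 + 4 * (l * R ^ 2 - k * Q ^ 2 - m * S ^ 2) := by
            rw [hl, hm, hk]; ring
          rw [e] at hU
          rcases sq_emod4 P with h | h <;> rcases sq_emod4 Q with h' | h' <;>
          rcases sq_emod4 R with h1 | h1 <;> rcases sq_emod4 S with h2 | h2 <;> omega
        · obtain ⟨l, hl⟩ : ∃ l, x * z = 4 * l + 3 := ⟨x * z / 4, by omega⟩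
          obtain ⟨m, hm⟩ : ∃ m, x * y = 4 * m + 3 := ⟨x * y / 4, by omega⟩
          have e : P ^ 2 + (x * z) * R ^ 2 - (y * z) * Q ^ 2 - (x * y) * S ^ 2 =
            P ^ 2 + 3 * R ^ 2 - Q ^ 2 - 3 * S ^ 2 + 4 * (l * R ^ 2 - k * Q ^ 2 - m * S ^ 2) := by
            rw [hl, hm, hk]; ring
          rw [e] at hU
          rcases sq_emod4 P with h | h <;> rcases sq_emod4 Q with h' | h' <;>
          rcases sq_emod4 R with h1 | h1 <;> rcases sq_emod4 S with h2 | h2 <;> omega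
      obtain ⟨k, hk⟩ : ∃ k, P = Q + 2 * k := ⟨(P - Q) / 2, by omega⟩
      obtain ⟨l, hl⟩ : ∃ l, R = S + 2 * l := ⟨(R - S) / 2, by omega⟩
      refine ⟨![k, Q, l, S], ?_⟩
      simp [Fin.sum_univ_four, hk, hl]; ring
  exact_mod_cast this

lemma discr_type3 (H : Biquad K x y z A B C σ τ) (hx : x % 2 = 0)
    (ha1 : (y * z) % 4 = 3) : NumberField.discr K = 64 * (x * y * z) ^ 2 := by
  have ha2 : (y * z) % 2 = 1 := by omega
  obtain ⟨hy, hz⟩ := odd_yz ha2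
  obtain ⟨x', hx'⟩ : ∃ x', x = 2 * x' := ⟨x / 2, by omega⟩
  have hb1 : (x * z) % 4 ≠ 1 := by
    rw [hx', mul_assoc]; omega
  have hc1 : (x * y) % 4 ≠ 1 := by
    rw [hx', mul_assoc]; omega
  have e1 : ![1, A, B, (B + C) / 2] =
      ((!![1, 0, 0, 0; 0, 1, 0, 0; 0, 0, 1, 0; 0, 0, 1/2, 1/2] : Matrix (Fin 4) (Fin 4) ℚ).map
        (algebraMap ℚ K)).mulVec ![1, A, B, C] := by
    ext i; fin_cases i
    · simp [Matrix.mulVec, dotProduct, Fin.sum_univ_four]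
    · simp [Matrix.mulVec, dotProduct, Fin.sum_univ_four]
    · simp [Matrix.mulVec, dotProduct, Fin.sum_univ_four]
    · simp [Matrix.mulVec, dotProduct, Fin.sum_univ_four]; ring
  have : (NumberField.discr K : ℚ) = ((64 * (x * y * z) ^ 2 : ℤ) : ℚ) := by
    rw [discr_of_span ![1, A, B, (B + C) / 2] (by simp [H.hf])]
    · rw [e1, Algebra.discr_of_matrix_mulVec, H.discr0]
      have : (!![1, 0, 0, 0; 0, 1, 0, 0; 0, 0, 1, 0; 0, 0, 1/2, 1/2] : Matrix (Fin 4) (Fin 4) ℚ).det = 1 / 2 := by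
        simp [Matrix.det_succ_row_zero, Fin.sum_univ_succ, Fin.succAbove]
      rw [this]; push_cast; ring
    · intro i; fin_cases i
      · exact isIntegral_one
      · exact H.isInt_A
      · exact H.isInt_B
      · show IsIntegral ℤ ((B + C) / 2)
        apply IsIntegral.of_pow (n := 2) (by norm_num)
        obtain ⟨k, hk⟩ : ∃ k, y + z = 4 * k := by
          have : (y + z) % 4 = 0 := by
            have h4 : (y % 4 = 1 ∨ y % 4 = 3) := by omega
            have h5 : (z % 4 = 1 ∨ z % 4 = 3) := by omega
            rw [Int.mul_emod] at ha1
            rcases h4 with h4 | h4 <;> rcases h5 with h5 | h5 <;> rw [h4, h5] at ha1 <;> omega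
          exact ⟨(y + z) / 4, by omega⟩
        refine isInt_congr ((isInt_int x').mul ((isInt_int (2 * k)).add H.isInt_A)) ?_
        have hk' : (y + z : K) = 4 * k := by exact_mod_cast congrArg (Int.cast (R := K)) hk
        have hx2 : (x : K) = 2 * x' := by exact_mod_cast congrArg (Int.cast (R := K)) hx'
        push_cast
        linear_combination H.hB / 4 + H.hC / 4 + H.hBC / 2 + (x : K) / 4 * hk' + (k + A / 2) * hx2
    · intro α hα
      obtain ⟨P, Q, R, S, rfl, ⟨U, hU, h4⟩, -⟩ := H.key hb1 hc1 ha2 α hα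
      obtain ⟨hU2, hV2⟩ := even_of_four_dvd _ _ _ H.ha (by omega) h4
      have hpar2 : (Even P ∨ Even Q) := by
        have h5 : Even (P * Q - x * R * S) := Int.even_iff.mpr hV2
        have hy' : Even x := by rw [Int.even_iff]; exact hx
        rw [Int.even_sub, Int.even_mul, Int.even_mul, Int.even_mul] at h5
        tauto
      have hres : P % 2 = 0 ∧ Q % 2 = 0 ∧ R % 2 = S % 2 := by
        simp only [Int.even_iff] at hpar2
        obtain ⟨k, hk⟩ : ∃ k, y * z = 4 * k + 3 := ⟨y * z / 4, by omega⟩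
        have hb : (x * z) % 4 = 2 := by
          have h6 := emod4_cases _ H.hb
          have : x * z = 2 * (x' * z) := by rw [hx']; ring
          omega
        have hc : (x * y) % 4 = 2 := by
          have h6 := emod4_cases _ H.hc
          have : x * y = 2 * (x' * y) := by rw [hx']; ring
          omega
        obtain ⟨l, hl⟩ : ∃ l, x * z = 4 * l + 2 := ⟨x * z / 4, by omega⟩
        obtain ⟨m, hm⟩ : ∃ m, x * y = 4 * m + 2 := ⟨x * y / 4, by omega⟩
        have e : P ^ 2 + (y * z) * Q ^ 2 - (x * z) * R ^ 2 - (x * y) * S ^ 2 =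
            P ^ 2 + 3 * Q ^ 2 - 2 * R ^ 2 - 2 * S ^ 2 + 4 * (k * Q ^ 2 - l * R ^ 2 - m * S ^ 2) := by
          rw [hl, hm, hk]; ring
        rw [e] at hU
        rcases sq_emod4 P with h | h <;> rcases sq_emod4 Q with h' | h' <;>
        rcases sq_emod4 R with h1 | h1 <;> rcases sq_emod4 S with h2 | h2 <;> omega
      obtain ⟨k, hk⟩ : ∃ k, P = 2 * k := ⟨P / 2, by omega⟩
      obtain ⟨j, hj⟩ : ∃ j, Q = 2 * j := ⟨Q / 2, by omega⟩
      obtain ⟨l, hl⟩ : ∃ l, R = S + 2 * l := ⟨(R - S) / 2, by omega⟩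
      refine ⟨![k, j, l, S], ?_⟩
      simp [Fin.sum_univ_four, hk, hj, hl]; ring
  exact_mod_cast this

/-- If all three squarefree integers are 1 mod 4, the discriminant is odd. -/
lemma discr_odd (H : Biquad K x y z A B C σ τ) (ha1 : (y * z) % 4 = 1) (hb1 : (x * z) % 4 = 1) :
    ¬ Even (NumberField.discr K) := by
  have hA' : A ^ 2 = ((y * z : ℤ) : K) := by push_cast; exact H.hA
  have hB' : B ^ 2 = ((x * z : ℤ) : K) := by push_cast; exact H.hB
  have i1 := half_integral A (y * z) hA' ha1
  have i2 := half_integral B (x * z) hB' hb1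
  set e : Fin 4 → K := ![1, (1 + A) / 2, (1 + B) / 2, (1 + A) / 2 * ((1 + B) / 2)] with he
  have hei : ∀ i, IsIntegral ℤ (e i) := by
    intro i; fin_cases i
    · exact isIntegral_one
    · exact i1
    · exact i2
    · exact i1.mul i2
  have e1 : e =
      ((!![1, 0, 0, 0; 1/2, 1/2, 0, 0; 1/2, 0, 1/2, 0; 1/4, 1/4, 1/4, (z:ℚ)/4] : Matrix (Fin 4) (Fin 4) ℚ).map
        (algebraMap ℚ K)).mulVec ![1, A, B, C] := by
    ext i; fin_cases i
    · simp [he, Matrix.mulVec, dotProduct, Fin.sum_univ_four]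
    · simp [he, Matrix.mulVec, dotProduct, Fin.sum_univ_four]; ring
    · simp [he, Matrix.mulVec, dotProduct, Fin.sum_univ_four]; ring
    · simp [he, Matrix.mulVec, dotProduct, Fin.sum_univ_four]; linear_combination H.hAB / 4
  have hd : Algebra.discr ℚ e = ((x * y * z * z) ^ 2 : ℤ) := by
    rw [e1, Algebra.discr_of_matrix_mulVec, H.discr0]
    have : (!![1, 0, 0, 0; 1/2, 1/2, 0, 0; 1/2, 0, 1/2, 0; 1/4, 1/4, 1/4, (z:ℚ)/4] : Matrix (Fin 4) (Fin 4) ℚ).det = z / 16 := by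
      simp [Matrix.det_succ_row_zero, Fin.sum_univ_succ, Fin.succAbove]; ring
    rw [this]; push_cast; ring
  -- compare with the integral basis
  have hcard : Fintype.card (Free.ChooseBasisIndex ℤ (NumberField.RingOfIntegers K)) = 4 := by
    rw [← Module.finrank_eq_card_basis (NumberField.integralBasis K), H.hf]
  let w := Fintype.equivFinOfCardEq hcard
  let b := (NumberField.RingOfIntegers.basis K).reindex w
  have hbd : Algebra.discr ℤ b = NumberField.discr K := NumberField.discr_eq_discr K b
  let e' : Fin 4 → NumberField.RingOfIntegers K := fun i => ⟨e i, hei i⟩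
  have h2 : Algebra.discr ℤ e' = (b.toMatrix e').det ^ 2 * Algebra.discr ℤ b := by
    conv_lhs => rw [← Basis.toMatrix_map_vecMul b e']
    rw [Algebra.discr_of_matrix_vecMul]
  have h3 : ((Algebra.discr ℤ e' : ℤ) : ℚ) = Algebra.discr ℚ e := by
    rw [Algebra.discr_def, Algebra.discr_def, ← eq_intCast (Int.castRingHom ℚ), RingHom.map_det]
    congr 1
    ext i j
    simp only [RingHom.mapMatrix_apply, Matrix.map_apply, Algebra.traceMatrix_apply,
      Algebra.traceForm_apply, Int.coe_castRingHom]
    rw [Algebra.coe_trace_int]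
    rfl
  rw [hd] at h3
  have h4 : Algebra.discr ℤ e' = (x * y * z * z) ^ 2 := by exact_mod_cast h3
  rw [h2, hbd] at h4
  intro hev
  have : Even ((x * y * z * z) ^ 2) := by rw [← h4]; exact hev.mul_left _
  rw [Int.even_pow' (by norm_num)] at this
  have h5 : x * y * z * z = (x * z) * (y * z) := by ring
  rw [h5, Int.even_mul, Int.even_iff, Int.even_iff] at this
  omega

end Biquad

open Module IntermediateField

noncomputable def sqC (m : ℤ) : ℂ := (IsAlgClosed.exists_pow_nat_eq (m : ℂ) two_pos).choose
lemma sqC_sq (m : ℤ) : sqC m ^ 2 = m := (IsAlgClosed.exists_pow_nat_eq (m : ℂ) two_pos).choose_spec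

noncomputable def Fq (m : ℤ) : IntermediateField ℚ ℂ := ℚ⟮sqC m⟯

lemma sqC_mem (m : ℤ) : sqC m ∈ Fq m := mem_adjoin_simple_self ℚ _

lemma sqfree_eq {a n : ℤ} (ha : Squarefree a) (hn : Squarefree n) (q : ℚ)
    (h : (a : ℚ) * q ^ 2 = n) : n = a := by
  obtain ⟨k, rfl⟩ := int_of_sqfree_mul_sq ha q n h
  have h1 : a * k ^ 2 = n := by exact_mod_cast h
  have h2 := hn k ⟨a, by rw [← h1]; ring⟩
  rcases Int.isUnit_iff.mp h2 with rfl | rfl <;> linarith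

lemma sqC_irrat {m : ℤ} (hm : Squarefree m) (h1 : m ≠ 1) (q : ℚ) : sqC m ≠ q := by
  intro h
  have h2 := sqC_sq m
  rw [h] at h2
  have h3 : q ^ 2 = m := by exact_mod_cast h2
  exact h1 (sqfree_eq squarefree_one hm q (by rw [← h3]; simp))

lemma finrank_Fq {m : ℤ} (hm : Squarefree m) (h1 : m ≠ 1) : finrank ℚ (Fq m) = 2 := by
  have hr : (Polynomial.X ^ 2 - Polynomial.C (m : ℚ)).Monic := by monicity!
  have he : Polynomial.aeval (sqC m) (Polynomial.X ^ 2 - Polynomial.C (m : ℚ)) = 0 := by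
    simp [sqC_sq]
  have hi : IsIntegral ℚ (sqC m) := ⟨_, hr, he⟩
  unfold Fq
  rw [adjoin.finrank hi]
  apply le_antisymm
  · have := minpoly.min ℚ (sqC m) hr he
    have h3 := Polynomial.natDegree_le_natDegree this
    refine h3.trans ?_
    compute_degree
  · rw [minpoly.two_le_natDegree_iff hi]
    rintro ⟨q, hq⟩
    exact sqC_irrat hm h1 q (by rw [← hq]; simp)

lemma quad_galois {F : IntermediateField ℚ ℂ} (h : finrank ℚ F = 2) : IsGalois ℚ F := by
  have : Algebra.IsQuadraticExtension ℚ F := ⟨h⟩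
  infer_instance

lemma fd_of_finrank {F : IntermediateField ℚ ℂ} {n : ℕ} (h : finrank ℚ F = n) (hn : 0 < n) :
   FiniteDimensional ℚ F := FiniteDimensional.of_finrank_pos (by omega)

lemma quad_conj {F : IntermediateField ℚ ℂ} (h : finrank ℚ F = 2) :
    ∃ σ : F ≃ₐ[ℚ] F, σ ≠ 1 ∧ σ * σ = 1 ∧ ∀ τ : F ≃ₐ[ℚ] F, τ = 1 ∨ τ = σ := by
  have := quad_galois h
  have := fd_of_finrank h two_pos
  have hc : Nat.card (F ≃ₐ[ℚ] F) = 2 := by rw [IsGalois.card_aut_eq_finrank, h]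
  obtain ⟨σ, hσ, hu⟩ := (Nat.card_eq_two_iff' (1 : F ≃ₐ[ℚ] F)).mp hc
  refine ⟨σ, hσ, ?_, fun τ => ?_⟩
  · by_contra h2
    have := hu _ h2
    simp at this
    exact hσ this
  · by_cases ht : τ = 1
    · exact Or.inl ht
    · exact Or.inr (hu _ ht)

lemma quad_neg {F : IntermediateField ℚ ℂ} (h : finrank ℚ F = 2) (t : F) (n : ℤ)
    (ht : t ^ 2 = n) (hir : ∀ q : ℚ, t ≠ q) : ∃ σ : F ≃ₐ[ℚ] F, σ t = -t := by
  have := quad_galois h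
  have := fd_of_finrank h two_pos
  obtain ⟨σ, h1, h2, h3⟩ := quad_conj h
  refine ⟨σ, ?_⟩
  have h4 : (σ t) ^ 2 = t ^ 2 := by rw [← map_pow, ht]; simp
  rcases sq_eq_sq_iff_eq_or_eq_neg.mp h4 with h5 | h5
  · exfalso
    have : t ∈ (⊥ : IntermediateField ℚ F) := by
      rw [IsGalois.mem_bot_iff_fixed]
      intro f
      rcases h3 f with rfl | rfl
      · rfl
      · exact h5
    obtain ⟨q, hq⟩ := mem_bot.mp this
    exact hir q (by rw [← hq]; simp)
  · exact h5

lemma quartDisc_eq (K : IntermediateField ℚ ℂ) [NumberField K] : quartDisc K = NumberField.discr K := by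
  unfold quartDisc
  have : FiniteDimensional ℚ K := NumberField.to_finiteDimensional
  rw [dif_pos this]

lemma quartDisc_Fq {m : ℤ} (hm : Squarefree m) (h1 : m ≠ 1) : quartDisc (Fq m) = Dq m := by
  have h := finrank_Fq hm h1
  have := fd_of_finrank h two_pos
  have : NumberField (Fq m) := ⟨⟩
  rw [quartDisc_eq]
  have h2 : (⟨sqC m, sqC_mem m⟩ : Fq m) ^ 2 = m := by
    apply Subtype.ext
    push_cast
    exact sqC_sq m
  obtain ⟨σ, hσ⟩ := quad_neg h ⟨sqC m, sqC_mem m⟩ m h2 (fun q hq => by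
    apply sqC_irrat hm h1 q
    have := congrArg (fun x : Fq m => (x : ℂ)) hq
    simpa using this)
  exact discr_quad h _ m hm h2 σ.toRingEquiv hσ

lemma sqC_mem_of_sq {F : IntermediateField ℚ ℂ} {t : ℂ} (ht : t ∈ F) {m : ℤ} (h : t ^ 2 = m) :
    sqC m ∈ F := by
  have : (sqC m) ^ 2 = t ^ 2 := by rw [sqC_sq, h]
  rcases sq_eq_sq_iff_eq_or_eq_neg.mp this with h5 | h5
  · rw [h5]; exact ht
  · rw [h5]; exact neg_mem ht

lemma Fq_le {F : IntermediateField ℚ ℂ} {m : ℤ} : Fq m ≤ F ↔ sqC m ∈ F := adjoin_simple_le_iff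

lemma Fq_eq_of_mem {F : IntermediateField ℚ ℂ} (h : finrank ℚ F = 2) {m : ℤ} (hm : Squarefree m)
    (h1 : m ≠ 1) (ht : sqC m ∈ F) : F = Fq m := by
  have := fd_of_finrank h two_pos
  symm
  exact eq_of_le_of_finrank_eq (Fq_le.mpr ht) (by rw [h, finrank_Fq hm h1])

lemma sqfree_part (q : ℚ) (hq : q ≠ 0) : ∃ (m : ℤ) (r : ℚ), Squarefree m ∧ r ≠ 0 ∧ q * r ^ 2 = m := by
  obtain ⟨a, b, hab, ha⟩ := Nat.sq_mul_squarefree (q.num * q.den).natAbs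
  have hn : q.num * q.den ≠ 0 := by
    have := q.den_nz
    have := Rat.num_ne_zero.mpr hq
    positivity
  have hb : b ≠ 0 := by
    rintro rfl
    have h0 : (q.num * q.den).natAbs = 0 := by rw [← hab]; simp
    exact hn (Int.natAbs_eq_zero.mp h0)
  have hs : ∃ m : ℤ, Squarefree m ∧ q.num * q.den = b ^ 2 * m := by
    rcases Int.natAbs_eq (q.num * q.den) with h | h
    · refine ⟨a, by exact_mod_cast Int.squarefree_natCast.mpr ha, ?_⟩
      rw [h, ← hab]; push_cast; ring
    · refine ⟨-a, (Int.squarefree_natAbs).mp (by simpa using ha), ?_⟩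
      rw [h, ← hab]; push_cast; ring
  obtain ⟨m, hm, h⟩ := hs
  have hd : (q.den : ℚ) ≠ 0 := by exact_mod_cast q.den_nz
  have hb' : (b : ℚ) ≠ 0 := by exact_mod_cast hb
  refine ⟨m, q.den / b, hm, by positivity, ?_⟩
  have h' : (q.num : ℚ) * q.den = b ^ 2 * m := by exact_mod_cast h
  have h2 : q * q.den = q.num := Rat.mul_den_eq_num q
  field_simp
  rw [show q * (q.den : ℚ)^2 = (q * q.den) * q.den by ring, h2, h']

lemma quad_exists {F : IntermediateField ℚ ℂ} (h : finrank ℚ F = 2) :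
    ∃ m : ℤ, Squarefree m ∧ m ≠ 1 ∧ F = Fq m := by
  have := quad_galois h
  have := fd_of_finrank h two_pos
  obtain ⟨σ, h1, h2, h3⟩ := quad_conj h
  have : ∃ α, σ α ≠ α := by
    by_contra! hh
    exact h1 (AlgEquiv.ext hh)
  obtain ⟨α, hα⟩ := this
  set t := α - σ α with htd
  have hss : ∀ x, σ (σ x) = x := fun x => by
    have := congrArg (fun f => f x) h2
    simpa using this
  have ht : σ t = -t := by rw [htd, map_sub, hss]; ring
  have ht0 : t ≠ 0 := fun hh => hα (sub_eq_zero.mp hh).symm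
  have : t ^ 2 ∈ (⊥ : IntermediateField ℚ F) := by
    rw [IsGalois.mem_bot_iff_fixed]
    intro f
    rcases h3 f with rfl | rfl
    · rfl
    · rw [map_pow, ht]; ring
  obtain ⟨q, hq⟩ := mem_bot.mp this
  have hq' : t ^ 2 = (q : F) := by rw [← hq]; simp
  have hq0 : q ≠ 0 := by rintro rfl; simp at hq'; exact ht0 hq'
  obtain ⟨m, r, hm, hr, hmr⟩ := sqfree_part q hq0
  have hm1 : m ≠ 1 := by
    rintro rfl
    have : (t * r) ^ 2 = 1 := by rw [mul_pow, hq']; exact_mod_cast hmr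
    have h4 : σ (t * r) = - (t * r) := by rw [map_mul, ht]; simp
    rcases sq_eq_sq_iff_eq_or_eq_neg.mp (this.trans (one_pow 2).symm) with h5 | h5 <;> rw [h5] at h4 <;> simp at h4 <;> norm_num at h4
  refine ⟨m, hm, hm1, Fq_eq_of_mem h hm hm1 (sqC_mem_of_sq (t := ((t * r : F) : ℂ)) (SetLike.coe_mem _) ?_)⟩
  have : (t * r) ^ 2 = m := by rw [mul_pow, hq']; exact_mod_cast hmr
  have := congrArg (fun x : F => (x : ℂ)) this
  simpa using this

open Module IntermediateField

lemma irr_Fq {F : IntermediateField ℚ ℂ} {m : ℤ} (hm : Squarefree m) (h1 : m ≠ 1) (ht : sqC m ∈ F)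
    (q : ℚ) : (⟨sqC m, ht⟩ : F) ≠ q := by
  intro hq
  apply sqC_irrat hm h1 q
  have := congrArg (fun x : F => (x : ℂ)) hq
  simpa using this

lemma sq_sub {F : IntermediateField ℚ ℂ} {m : ℤ} (ht : sqC m ∈ F) : (⟨sqC m, ht⟩ : F) ^ 2 = m := by
  apply Subtype.ext
  push_cast
  exact sqC_sq m

lemma Fq_inj {b c : ℤ} (hb : Squarefree b) (hb1 : b ≠ 1) (hc : Squarefree c) (hc1 : c ≠ 1)
    (h : Fq b = Fq c) : b = c := by
  have hf := finrank_Fq hc hc1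
  have hbm : sqC b ∈ Fq c := h ▸ sqC_mem b
  have := quad_galois hf
  have := fd_of_finrank hf two_pos
  obtain ⟨σ, h1, h2, h3⟩ := quad_conj hf
  obtain ⟨f, hfb⟩ := quad_neg hf _ b (sq_sub hbm) (irr_Fq hb hb1 hbm)
  obtain ⟨g, hgc⟩ := quad_neg hf _ c (sq_sub (sqC_mem c)) (irr_Fq hc hc1 (sqC_mem c))
  have key : ∀ t : Fq c, ∀ f : Fq c ≃ₐ[ℚ] Fq c, t ≠ 0 → f t = - t → σ t = -t := by
    intro t f h0 h5
    rcases h3 f with rfl | rfl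
    · exfalso
      have h6 : t = - t := h5
      exact h0 (self_eq_neg.mp h6)
    · exact h5
  have h0b := irr_Fq hb hb1 hbm 0
  have h0c := irr_Fq hc hc1 (sqC_mem c) 0
  have e1 := key _ f (by simpa using h0b) hfb
  have e2 := key _ g (by simpa using h0c) hgc
  set B : Fq c := ⟨sqC b, hbm⟩ with hB
  set C : Fq c := ⟨sqC c, sqC_mem c⟩ with hC
  have : B * C ∈ (⊥ : IntermediateField ℚ (Fq c)) := by
    rw [IsGalois.mem_bot_iff_fixed]
    intro f
    rcases h3 f with rfl | rfl
    · rfl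
    · rw [map_mul, e1, e2]; ring
  obtain ⟨q, hq⟩ := mem_bot.mp this
  have hq' : B * C = (q : Fq c) := by rw [← hq]; simp
  have h7 : ((b * c : ℚ) : Fq c) = ((q ^ 2 : ℚ) : Fq c) := by
    push_cast
    rw [← hq', mul_pow, hB, hC, sq_sub, sq_sub]
  have h8 : (b * c : ℚ) = q ^ 2 := by exact_mod_cast h7
  have hc0 : (c : ℚ) ≠ 0 := by exact_mod_cast hc.ne_zero
  refine sqfree_eq hc hb (q / c) ?_
  field_simp
  rw [← h8]; ring

noncomputable def Kq (b c : ℤ) : IntermediateField ℚ ℂ := Fq b ⊔ Fq c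

lemma Kq_eq (b c : ℤ) : Kq b c = adjoin ℚ {sqC b, sqC c} := by
  rw [Kq, Fq, Fq, ← adjoin_union]; rfl

lemma Kq_le {F : IntermediateField ℚ ℂ} {b c : ℤ} (hb : sqC b ∈ F) (hc : sqC c ∈ F) : Kq b c ≤ F :=
  sup_le (Fq_le.mpr hb) (Fq_le.mpr hc)

lemma memB (b c : ℤ) : sqC b ∈ Kq b c := Fq_le.mp le_sup_left
lemma memC (b c : ℤ) : sqC c ∈ Kq b c := Fq_le.mp le_sup_right

structure Pair (b c : ℤ) : Prop where
  hb : Squarefree b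
  hb1 : b ≠ 1
  hc : Squarefree c
  hc1 : c ≠ 1
  hne : b ≠ c

lemma Pair.finrank {b c : ℤ} (H : Pair b c) : finrank ℚ (Kq b c) = 4 := by
  have hfb := finrank_Fq H.hb H.hb1
  have hfc := finrank_Fq H.hc H.hc1
  have := fd_of_finrank hfb two_pos
  have := fd_of_finrank hfc two_pos
  have := quad_galois hfb
  have hinf : Fq b ⊓ Fq c = ⊥ := by
    rw [← IntermediateField.finrank_eq_one_iff]
    have h1 := finrank_dvd_of_le_right (inf_le_left : Fq b ⊓ Fq c ≤ Fq b)
    rw [hfb] at h1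
    rcases (Nat.dvd_prime Nat.prime_two).mp h1 with h | h
    · exact h
    · exfalso
      have e1 := eq_of_le_of_finrank_eq (inf_le_left : Fq b ⊓ Fq c ≤ Fq b) (by rw [h, hfb])
      have e2 := eq_of_le_of_finrank_eq (inf_le_right : Fq b ⊓ Fq c ≤ Fq c) (by rw [h, hfc])
      exact H.hne (Fq_inj H.hb H.hb1 H.hc H.hc1 (e1.symm.trans e2))
  have : @IsGalois ℚ _ (Fq b) _ (IntermediateField.algebra' (Fq b)) := quad_galois hfb
  have h5 := IntermediateField.LinearDisjoint.finrank_sup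
    (IntermediateField.LinearDisjoint.of_inf_eq_bot hinf)
  rw [Kq, h5, hfb, hfc]

lemma Pair.galois {b c : ℤ} (H : Pair b c) : IsGalois ℚ (Kq b c) := by
  have hfb := finrank_Fq H.hb H.hb1
  have hfc := finrank_Fq H.hc H.hc1
  have := quad_galois hfb
  have := quad_galois hfc
  have : @Normal ℚ (Fq b) _ _ (IntermediateField.algebra' (Fq b)) := (inferInstance : Normal ℚ (Fq b))
  have : @Normal ℚ (Fq c) _ _ (IntermediateField.algebra' (Fq c)) := (inferInstance : Normal ℚ (Fq c))
  have : Normal ℚ (Kq b c) := IntermediateField.normal_sup ℚ ℂ _ _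
  constructor

lemma aut_pm {F : IntermediateField ℚ ℂ} {m : ℤ} (ht : sqC m ∈ F) (f : F ≃ₐ[ℚ] F) :
    f ⟨sqC m, ht⟩ = ⟨sqC m, ht⟩ ∨ f ⟨sqC m, ht⟩ = - ⟨sqC m, ht⟩ := by
  apply sq_eq_sq_iff_eq_or_eq_neg.mp
  rw [← map_pow, sq_sub]
  simp

lemma aut_ext {b c : ℤ} (f g : Kq b c ≃ₐ[ℚ] Kq b c) (h1 : f ⟨sqC b, memB b c⟩ = g ⟨sqC b, memB b c⟩)
    (h2 : f ⟨sqC c, memC b c⟩ = g ⟨sqC c, memC b c⟩) : f = g := by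
  have := algHom_ext_of_eq_adjoin ℚ (Kq_eq b c) (φ₁ := (f : Kq b c →ₐ[ℚ] Kq b c))
    (φ₂ := (g : Kq b c →ₐ[ℚ] Kq b c)) (by
      rintro x (rfl | rfl)
      · exact h1
      · exact h2)
  ext x
  have := congrArg (fun φ : Kq b c →ₐ[ℚ] Kq b c => ((φ x : Kq b c) : ℂ)) this
  exact this

lemma Pair.auts {b c : ℤ} (H : Pair b c) :
    (∃ σ : Kq b c ≃ₐ[ℚ] Kq b c, σ ⟨sqC b, memB b c⟩ = - ⟨sqC b, memB b c⟩ ∧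
      σ ⟨sqC c, memC b c⟩ = - ⟨sqC c, memC b c⟩) ∧
    (∃ σ : Kq b c ≃ₐ[ℚ] Kq b c, σ ⟨sqC b, memB b c⟩ = ⟨sqC b, memB b c⟩ ∧
      σ ⟨sqC c, memC b c⟩ = - ⟨sqC c, memC b c⟩) := by
  classical
  have := H.galois
  have hf := H.finrank
  have := fd_of_finrank hf (by norm_num)
  have hcard : Nat.card (Kq b c ≃ₐ[ℚ] Kq b c) = 4 := by rw [IsGalois.card_aut_eq_finrank, hf]
  set B : Kq b c := ⟨sqC b, memB b c⟩ with hB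
  set C : Kq b c := ⟨sqC c, memC b c⟩ with hC
  let φ : (Kq b c ≃ₐ[ℚ] Kq b c) → Bool × Bool := fun f => (decide (f B = B), decide (f C = C))
  have hinj : Function.Injective φ := by
    intro f g h
    simp only [φ, Prod.mk.injEq, decide_eq_decide] at h
    obtain ⟨h1, h2⟩ := h
    apply aut_ext
    · rcases aut_pm (memB b c) f with h3 | h3
      · rw [h3]; exact (h1.mp h3).symm
      · rcases aut_pm (memB b c) g with h4 | h4
        · rw [h4]; exact h1.mpr h4
        · rw [h3, h4]
    · rcases aut_pm (memC b c) f with h3 | h3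
      · rw [h3]; exact (h2.mp h3).symm
      · rcases aut_pm (memC b c) g with h4 | h4
        · rw [h4]; exact h2.mpr h4
        · rw [h3, h4]
  have hbij := hinj.bijective_of_nat_card_le (by rw [hcard]; simp)
  constructor
  · obtain ⟨f, hf⟩ := hbij.2 (false, false)
    simp only [φ, Prod.mk.injEq, decide_eq_false_iff_not] at hf
    exact ⟨f, (aut_pm (memB b c) f).resolve_left hf.1, (aut_pm (memC b c) f).resolve_left hf.2⟩
  · obtain ⟨f, hf⟩ := hbij.2 (true, false)
    simp only [φ, Prod.mk.injEq, decide_eq_false_iff_not, decide_eq_true_eq] at hf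
    exact ⟨f, hf.1, (aut_pm (memC b c) f).resolve_left hf.2⟩

lemma Pair.v4 {b c : ℤ} (H : Pair b c) : IsV4Quartic (Kq b c) := by
  have := H.galois
  have hf := H.finrank
  have := fd_of_finrank hf (by norm_num)
  have hcard : Nat.card (Kq b c ≃ₐ[ℚ] Kq b c) = 4 := by rw [IsGalois.card_aut_eq_finrank, hf]
  refine ⟨hf, H.galois, ?_⟩
  have hk : IsKleinFour (Kq b c ≃ₐ[ℚ] Kq b c) := by
    refine ⟨hcard, ?_⟩
    have hd : Monoid.exponent (Kq b c ≃ₐ[ℚ] Kq b c) ∣ 2 := by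
      apply Monoid.exponent_dvd_of_forall_pow_eq_one
      intro f
      rw [pow_two]
      apply aut_ext
      · rcases aut_pm (memB b c) f with h | h <;> simp [h]
      · rcases aut_pm (memC b c) f with h | h <;> simp [h]
    rcases (Nat.dvd_prime Nat.prime_two).mp hd with h | h
    · exfalso
      have := Monoid.exp_eq_one_iff.mp h
      have := Nat.card_of_subsingleton (1 : Kq b c ≃ₐ[ℚ] Kq b c)
      omega
    · exact h
  exact IsKleinFour.nonempty_mulEquiv

structure Tri (x y z a b c : ℤ) : Prop where
  ea : a = y * z
  eb : b = x * z
  ec : c = x * y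
  ha : Squarefree a
  hb : Squarefree b
  hc : Squarefree c
  ha1 : a ≠ 1
  hb1 : b ≠ 1
  hc1 : c ≠ 1

namespace Tri
variable {x y z a b c : ℤ}
lemma rot (H : Tri x y z a b c) : Tri y z x b c a := by
  obtain ⟨h1,h2,h3,h4,h5,h6,h7,h8,h9⟩ := H
  constructor <;> first | assumption | (rw [h2]; ring) | (rw [h3]; ring)
lemma swap (H : Tri x y z a b c) : Tri x z y a c b := by
  obtain ⟨h1,h2,h3,h4,h5,h6,h7,h8,h9⟩ := H
  constructor <;> first | assumption | (rw [h2]) | (rw [h3]) | (rw [h1]; ring)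
lemma pair (H : Tri x y z a b c) : Pair b c := by
  refine ⟨H.hb, H.hb1, H.hc, H.hc1, fun h => ?_⟩
  have hx : x ≠ 0 := by rintro rfl; exact H.hb.ne_zero (by rw [H.eb]; ring)
  have : z = y := by
    apply mul_left_cancel₀ hx
    rw [← H.eb, ← H.ec, h]
  subst this
  have h1 := H.ha z ⟨1, by rw [H.ea]; ring⟩
  apply H.ha1
  rw [H.ea]
  rcases Int.isUnit_iff.mp h1 with rfl | rfl <;> rfl
end Tri

lemma tri_of_pair {b c : ℤ} (H : Pair b c) : 
    ∃ x y z a, Tri x y z a b c ∧ 0 < x ∧ IsCoprime y z := by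
  have hb0 := H.hb.ne_zero
  have hx : 0 < Int.gcd b c := Int.gcd_pos_of_ne_zero_left _ hb0
  obtain ⟨z, hz⟩ := Int.gcd_dvd_left b c
  obtain ⟨y, hy⟩ := Int.gcd_dvd_right b c
  set x : ℤ := (Int.gcd b c : ℤ) with hxd
  have hx' : 0 < x := by rw [hxd]; exact_mod_cast hx
  have hcop : IsCoprime z y := by
    have h := Int.gcd_eq_gcd_ab b c
    rw [← hxd] at h
    refine ⟨b.gcdA c, b.gcdB c, ?_⟩
    have : x * (b.gcdA c * z + b.gcdB c * y) = x * 1 := by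
      linear_combination -h - (b.gcdA c) * hz - (b.gcdB c) * hy
    exact mul_left_cancel₀ hx'.ne' this
  have hsz : Squarefree z := H.hb.squarefree_of_dvd ⟨x, by rw [hz]; ring⟩
  have hsy : Squarefree y := H.hc.squarefree_of_dvd ⟨x, by rw [hy]; ring⟩
  refine ⟨x, y, z, y * z, ⟨rfl, hz, hy, ?_, H.hb, H.hc, ?_, H.hb1, H.hc1⟩, hx', hcop.symm⟩
  · exact (squarefree_mul_iff.mpr ⟨hcop.symm.isRelPrime, hsy, hsz⟩)
  · intro h
    apply H.hne
    rcases Int.eq_one_or_neg_one_of_mul_eq_one' h with ⟨h1, h2⟩ | ⟨h1, h2⟩ <;> rw [hz, hy, h1, h2]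

open Module IntermediateField

namespace Tri
variable {x y z a b c : ℤ}

lemma hx0 (H : Tri x y z a b c) : x ≠ 0 := by
  rintro rfl; exact H.hb.ne_zero (by rw [H.eb]; ring)

lemma nf (H : Tri x y z a b c) : NumberField (Kq b c) := by
  have := fd_of_finrank H.pair.finrank (by norm_num)
  exact ⟨⟩

lemma biquad (H : Tri x y z a b c) [NumberField (Kq b c)] :
    ∃ (A : Kq b c) (σ τ : Kq b c ≃+* Kq b c),
    Biquad (Kq b c) x y z A ⟨sqC b, memB b c⟩ ⟨sqC c, memC b c⟩ σ τ := by
  have hx : (x : Kq b c) ≠ 0 := by exact_mod_cast H.hx0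
  obtain ⟨⟨σ, s1, s2⟩, ⟨τ, t1, t2⟩⟩ := H.pair.auts
  have eB := sq_sub (memB b c)
  have eC := sq_sub (memC b c)
  set B : Kq b c := ⟨sqC b, memB b c⟩ with hB
  set C : Kq b c := ⟨sqC c, memC b c⟩ with hC
  rw [show ((b : ℤ) : Kq b c) = x * z by rw [H.eb]; push_cast; rfl] at eB
  rw [show ((c : ℤ) : Kq b c) = x * y by rw [H.ec]; push_cast; rfl] at eC
  refine ⟨B * C / x, σ.toRingEquiv, τ.toRingEquiv, H.pair.finrank, H.ea ▸ H.ha, H.eb ▸ H.hb,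
    H.ec ▸ H.hc, ?_, eB, eC, ?_, ?_, ?_, ?_, s1, s2, ?_, t1, t2⟩
  · rw [div_pow, mul_pow, eB, eC]; field_simp
  · field_simp; rw [eB]; ring
  · field_simp; rw [eC]; ring
  · field_simp
  · change σ (B * C / x) = _
    rw [map_div₀, map_mul, s1, s2, map_intCast]; ring
  · change τ (B * C / x) = _
    rw [map_div₀, map_mul, t1, t2, map_intCast]; ring

lemma memA (H : Tri x y z a b c) : sqC a ∈ Kq b c := by
  have := H.nf
  obtain ⟨A, σ, τ, h⟩ := H.biquad
  refine sqC_mem_of_sq (t := (A : ℂ)) (SetLike.coe_mem _) ?_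
  have := congrArg (fun x : Kq b c => (x : ℂ)) h.hA
  simpa [H.ea] using this

lemma Kq_rot (H : Tri x y z a b c) : Kq b c = Kq c a := by
  have := fd_of_finrank H.pair.finrank (by norm_num)
  symm
  exact eq_of_le_of_finrank_eq (Kq_le (memC b c) H.memA) (by rw [H.pair.finrank, H.rot.pair.finrank])

lemma Kq_swap (b c : ℤ) : Kq b c = Kq c b := sup_comm _ _

lemma quadA (H : Tri x y z a b c) : IsQuadSubfield (Kq b c) (Fq a) :=
  ⟨Fq_le.mpr H.memA, finrank_Fq H.ha H.ha1⟩
lemma quadB (H : Tri x y z a b c) : IsQuadSubfield (Kq b c) (Fq b) :=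
  ⟨Fq_le.mpr (memB b c), finrank_Fq H.hb H.hb1⟩
lemma quadC (H : Tri x y z a b c) : IsQuadSubfield (Kq b c) (Fq c) :=
  ⟨Fq_le.mpr (memC b c), finrank_Fq H.hc H.hc1⟩

lemma quad_cases (H : Tri x y z a b c) {F : IntermediateField ℚ ℂ}
    (hF : IsQuadSubfield (Kq b c) F) : F = Fq a ∨ F = Fq b ∨ F = Fq c := by
  obtain ⟨m, hm, hm1, rfl⟩ := quad_exists hF.2
  have hmem := Fq_le.mp hF.1
  have := H.nf
  obtain ⟨A, σ, τ, h⟩ := H.biquad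
  have et := sq_sub hmem
  have hir := irr_Fq hm hm1 hmem
  set t : Kq b c := ⟨sqC m, hmem⟩ with ht
  obtain ⟨p, q, r, s, e⟩ := h.rep t
  have hB := h.hB
  have hC := h.hC
  have sB := h.σB
  have sC := h.σC
  have tB := h.τB
  have tC := h.τC
  set B : Kq b c := ⟨sqC b, memB b c⟩ with hBd
  set C : Kq b c := ⟨sqC c, memC b c⟩ with hCd
  have hs : σ t = t ∨ σ t = -t := by
    apply sq_eq_sq_iff_eq_or_eq_neg.mp; rw [← map_pow, et]; simp
  have hu : τ t = t ∨ τ t = -t := by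
    apply sq_eq_sq_iff_eq_or_eq_neg.mp; rw [← map_pow, et]; simp
  have e1 : σ t = p + q * A - r * B - s * C := by
    rw [e]; simp [h.σA, sB, sC]; ring
  have e2 : τ t = p - q * A + r * B - s * C := by
    rw [e]; simp [h.τA, tB, tC]; ring
  have hcast : ∀ (n k : ℤ) (q : ℚ), Squarefree n → (k : Kq b c) = ((n : ℚ) * q ^ 2 : ℚ) →
      Squarefree k → k = n := fun n k q h1 h2 h3 => by
    refine sqfree_eq h1 h3 q ?_
    exact_mod_cast h2.symm
  rcases hs with hs | hs <;> rcases hu with hu | hu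
  · exfalso
    have h2 : τ (σ t) = p - q * A - r * B + s * C := by
      rw [e1]; simp [h.τA, tB, tC]; ring
    rw [hs, hu] at h2
    rw [hs] at e1
    rw [hu] at e2
    exact hir p (by linear_combination (e + e1 + e2 + h2) / 4)
  · left
    congr 1
    rw [hs] at e1
    rw [hu] at e2
    have h2 : τ (σ t) = p - q * A - r * B + s * C := by
      rw [hs, hu]
      have : τ (σ t) = p - q * A - r * B + s * C := by
        nth_rewrite 1 [hs]; rw [hs] at *; rw [e1]; simp [h.τA, tB, tC]; ring
      rw [← this, hs, hu]
    have e3 : t = q * A := by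
      rw [hs, hu] at h2
      linear_combination (e + e1 - e2 - h2) / 4
    refine hcast a m q H.ha ?_ hm
    rw [← et, e3, mul_pow, h.hA, H.ea]; push_cast; ring
  · right; left
    congr 1
    have h2 : τ (σ t) = p - q * A - r * B + s * C := by
      rw [e1]; simp [h.τA, tB, tC]; ring
    have e3 : t = r * B := by
      rw [hs, map_neg, hu] at h2
      rw [hs] at e1
      rw [hu] at e2
      linear_combination (e - e1 + e2 - h2) / 4
    refine hcast b m r H.hb ?_ hm
    rw [← et, e3, mul_pow, hB, H.eb]; push_cast; ring
  · right; right
    congr 1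
    have h2 : τ (σ t) = p - q * A - r * B + s * C := by
      rw [e1]; simp [h.τA, tB, tC]; ring
    have e3 : t = s * C := by
      rw [hs, map_neg, hu] at h2
      rw [hs] at e1
      rw [hu] at e2
      linear_combination (e - e1 - e2 + h2) / 4
    refine hcast c m s H.hc ?_ hm
    rw [← et, e3, mul_pow, hC, H.ec]; push_cast; ring

lemma disc1 (H : Tri x y z a b c) (ha : a % 4 = 1) (hb : b % 4 ≠ 1) (hc : c % 4 ≠ 1) :
    quartDisc (Kq b c) = 16 * (a * b * c) := by
  have := H.nf
  obtain ⟨A, σ, τ, h⟩ := H.biquad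
  rw [quartDisc_eq, h.discr_type1 (H.eb ▸ hb) (H.ec ▸ hc) (H.ea ▸ ha), H.ea, H.eb, H.ec]; ring

lemma disc3 (H : Tri x y z a b c) (ha : a % 4 = 3) (hx : x % 2 = 0) :
    quartDisc (Kq b c) = 64 * (a * b * c) := by
  have := H.nf
  obtain ⟨A, σ, τ, h⟩ := H.biquad
  rw [quartDisc_eq, h.discr_type3 hx (H.ea ▸ ha), H.ea, H.eb, H.ec]; ring

lemma disc_odd (H : Tri x y z a b c) (ha : a % 4 = 1) (hb : b % 4 = 1) :
    ¬ Even (quartDisc (Kq b c)) := by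
  have := H.nf
  obtain ⟨A, σ, τ, h⟩ := H.biquad
  rw [quartDisc_eq]
  exact h.discr_odd (H.ea ▸ ha) (H.eb ▸ hb)

end Tri

lemma v4_pair {K : IntermediateField ℚ ℂ} (h : IsV4Quartic K) : ∃ b c, Pair b c ∧ K = Kq b c := by
  obtain ⟨hf, hg, ⟨e⟩⟩ := h
  have := fd_of_finrank hf (by norm_num)
  -- elements of order two give quadratic subfields
  have hz : ∀ f : K ≃ₐ[ℚ] K, f ≠ 1 → f ^ 2 = 1 → 
      finrank ℚ (lift (fixedField (Subgroup.zpowers f))) = 2 := by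
    intro f h1 h2
    have h3 := finrank_fixedField_eq_card (Subgroup.zpowers f)
    rw [Nat.card_zpowers, orderOf_eq_prime h2 h1] at h3
    have h4 := finrank_mul_finrank ℚ (fixedField (Subgroup.zpowers f)) K
    rw [h3, hf] at h4
    have h5 := (liftAlgEquiv (fixedField (Subgroup.zpowers f))).toLinearEquiv.finrank_eq
    exact h5.symm.trans (Nat.eq_of_mul_eq_mul_right two_pos h4)
  have hsq : ∀ f : K ≃ₐ[ℚ] K, f ^ 2 = 1 := by
    intro f
    apply e.injective
    rw [map_pow, map_one]
    generalize e f = g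
    revert g; decide
  obtain ⟨f, hfe⟩ := e.surjective (Multiplicative.ofAdd (1, 0))
  obtain ⟨g, hge⟩ := e.surjective (Multiplicative.ofAdd (0, 1))
  have hf1 : f ≠ 1 := by rintro rfl; rw [map_one] at hfe; revert hfe; decide
  have hg1 : g ≠ 1 := by rintro rfl; rw [map_one] at hge; revert hge; decide
  have hfg : f ≠ g := by rintro rfl; rw [hfe] at hge; revert hge; decide
  have k1 := hz f hf1 (hsq f)
  have k2 := hz g hg1 (hsq g)
  obtain ⟨b, hb, hb1, eb⟩ := quad_exists k1
  obtain ⟨c, hc, hc1, ec⟩ := quad_exists k2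
  have hne : b ≠ c := by
    rintro rfl
    have h1 := eb.trans ec.symm
    have h2 : fixedField (Subgroup.zpowers f) = fixedField (Subgroup.zpowers g) :=
      lift_injective _ h1
    have h3 := congrArg (fixingSubgroup) h2
    rw [fixingSubgroup_fixedField, fixingSubgroup_fixedField] at h3
    have h4 : f ∈ Subgroup.zpowers g := h3 ▸ Subgroup.mem_zpowers f
    obtain ⟨n, hn⟩ := Subgroup.mem_zpowers_iff.mp h4
    rcases Int.even_or_odd' n with ⟨k, rfl | rfl⟩
    · apply hf1; rw [← hn, zpow_mul]; simp [zpow_ofNat, hsq g]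
    · apply hfg; rw [← hn, zpow_add, zpow_mul]; simp [zpow_ofNat, hsq g]
  have hp : Pair b c := ⟨hb, hb1, hc, hc1, hne⟩
  refine ⟨b, c, hp, ?_⟩
  symm
  refine eq_of_le_of_finrank_eq (sup_le ?_ ?_) (by rw [hp.finrank, hf])
  · rw [← eb]; exact lift_le _
  · rw [← ec]; exact lift_le _

open Module IntermediateField

def Good (a b c : ℤ) : Prop :=
  (a % 4 = 1 ∧ b % 4 = 3 ∧ c % 4 = 3) ∨ (a % 4 = 1 ∧ b % 4 = 2 ∧ c % 4 = 2) ∨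
    (a % 4 = 3 ∧ b % 4 = 2 ∧ c % 4 = 2)

noncomputable def vq (m : ℤ) : ℕ := padicValInt 2 (Dq m)

lemma vq1 {m : ℤ} (h : m % 4 = 1) : vq m = 0 := by
  unfold vq Dq
  rw [if_pos h]
  exact padicValInt.eq_zero_of_not_dvd (by omega)

lemma padic_eq (n k : ℕ) (m : ℤ) (h : m % 2 = 1) (e : k = 2 ^ n) : padicValInt 2 (k * m) = n := by
  have hk : (k : ℤ) ≠ 0 := by subst e; positivity
  have hp : Fact (Nat.Prime 2) := ⟨Nat.prime_two⟩
  rw [padicValInt.mul hk (by rintro rfl; simp at h), padicValInt.eq_zero_of_not_dvd (show ¬ ((2:ℕ):ℤ) ∣ m by omega)]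
  rw [padicValInt.of_nat, e, padicValNat.prime_pow]; rfl

lemma vq3 {m : ℤ} (h : m % 4 = 3) : vq m = 2 := by
  unfold vq Dq
  rw [if_neg (by omega)]
  exact padic_eq 2 4 m (by omega) rfl

lemma vq2 {m : ℤ} (h : m % 4 = 2) : vq m = 3 := by
  unfold vq Dq
  rw [if_neg (by omega)]
  have := padic_eq 3 8 (m / 2) (by omega) rfl
  rw [show 4 * m = ((8 : ℕ) : ℤ) * (m / 2) by push_cast; omega]
  exact this

namespace Tri
variable {x y z a b c : ℤ}

lemma sq_prod (H : Tri x y z a b c) : a * b * c = (x * y * z) ^ 2 := by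
  rw [H.ea, H.eb, H.ec]; ring

lemma classify (H : Tri x y z a b c) : (a % 4 = 1 ∧ b % 4 = 1 ∧ c % 4 = 1) ∨
    Good a b c ∨ Good b c a ∨ Good c a b := by
  have hw := H.sq_prod
  have h1 := emod4_cases a H.ha
  have h2 := emod4_cases b H.hb
  have h3 := emod4_cases c H.hc
  have h4 := sq_emod4 (x * y * z)
  have hm : a * b * c % 4 = (a % 4) * (b % 4) * (c % 4) % 4 := by
    rw [Int.mul_emod (a * b), Int.mul_emod a b]; simp [Int.mul_emod]
  rw [hw] at hm
  have h5 : (x * y * z) ^ 2 % 4 = 0 ∨ (x * y * z) ^ 2 % 4 = 1 := by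
    rcases h4 with h | h
    · exact Or.inl h.2
    · exact Or.inr h.2
  by_cases hev : ¬ (a % 4 = 2 ∧ b % 4 = 2 ∧ c % 4 = 2)
  · clear hw h4 H
    unfold Good
    generalize (x * y * z) ^ 2 % 4 = w at *
    generalize a % 4 = a at *
    generalize b % 4 = b at *
    generalize c % 4 = c at *
    rcases h1 with rfl | rfl | rfl <;> rcases h2 with rfl | rfl | rfl <;>
      rcases h3 with rfl | rfl | rfl <;> norm_num at hm <;> simp at hev ⊢ <;> omega
  rw [not_not] at hev
  obtain ⟨h1, h2, h3⟩ := hev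
  rw [h1, h2, h3] at hm
  norm_num at hm
  exfalso
  obtain ⟨k, rfl⟩ : ∃ k, a = 2 * (2 * k + 1) := ⟨a / 4, by omega⟩
  obtain ⟨l, rfl⟩ : ∃ k, b = 2 * (2 * k + 1) := ⟨b / 4, by omega⟩
  obtain ⟨n, rfl⟩ : ∃ k, c = 2 * (2 * k + 1) := ⟨c / 4, by omega⟩
  obtain ⟨u, hu⟩ : ∃ u, x * y * z = 2 * u := ⟨x * y * z / 2, by omega⟩
  rw [hu] at hw
  have e : 2 * ((2 * k + 1) * (2 * l + 1) * (2 * n + 1)) = u ^ 2 := by linarith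
  have h5 := sq_emod4 u
  have e2 : (2 * k + 1) * (2 * l + 1) * (2 * n + 1) =
    2 * (4 * k * l * n + 2 * k * l + 2 * k * n + 2 * l * n + k + l + n) + 1 := by ring
  omega

lemma good_of_lt (H : Tri x y z a b c) (h1 : vq a < vq b) (h2 : vq a < vq c) : Good a b c := by
  rcases H.classify with ⟨g1, g2, g3⟩ | g | g | g
  · rw [vq1 g1, vq1 g2] at h1; omega
  · exact g
  · exfalso
    rcases g with ⟨g1, g2, g3⟩ | ⟨g1, g2, g3⟩ | ⟨g1, g2, g3⟩
    · rw [vq1 g1, vq3 g3] at h1; omega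
    · rw [vq1 g1, vq2 g3] at h1; omega
    · rw [vq3 g1, vq2 g3] at h1; omega
  · exfalso
    rcases g with ⟨g1, g2, g3⟩ | ⟨g1, g2, g3⟩ | ⟨g1, g2, g3⟩
    · rw [vq1 g1, vq3 g2] at h2; omega
    · rw [vq1 g1, vq2 g2] at h2; omega
    · rw [vq3 g1, vq2 g2] at h2; omega
end Tri

lemma Good.lt {a b c : ℤ} (g : Good a b c) : vq a < vq b ∧ vq a < vq c := by
  rcases g with ⟨g1, g2, g3⟩ | ⟨g1, g2, g3⟩ | ⟨g1, g2, g3⟩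
  · rw [vq1 g1, vq3 g2, vq3 g3]; omega
  · rw [vq1 g1, vq2 g2, vq2 g3]; omega
  · rw [vq3 g1, vq2 g2, vq2 g3]; omega

lemma Good.swap {a b c : ℤ} (g : Good a b c) : Good a c b := by
  unfold Good at *; omega

namespace Tri
variable {x y z a b c : ℤ}
lemma vA (H : Tri x y z a b c) : padicValInt 2 (quartDisc (Fq a)) = vq a := by
  rw [quartDisc_Fq H.ha H.ha1]; rfl
lemma vB (H : Tri x y z a b c) : padicValInt 2 (quartDisc (Fq b)) = vq b := by
  rw [quartDisc_Fq H.hb H.hb1]; rfl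
lemma vC (H : Tri x y z a b c) : padicValInt 2 (quartDisc (Fq c)) = vq c := by
  rw [quartDisc_Fq H.hc H.hc1]; rfl

lemma good_disc (H : Tri x y z a b c) (g : Good a b c) :
    quartDisc (Kq b c) = (if a % 4 = 1 then 16 else 64) * (a * b * c) := by
  rcases g with ⟨g1, g2, g3⟩ | ⟨g1, g2, g3⟩ | ⟨g1, g2, g3⟩
  · rw [if_pos g1, H.disc1 g1 (by omega) (by omega)]
  · rw [if_pos g1, H.disc1 g1 (by omega) (by omega)]
  · rw [if_neg (by omega), H.disc3 g1]
    by_contra hx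
    have h1 : Odd x := Int.odd_iff.mpr (by omega)
    have h2 : Even (x * z) := by rw [← H.eb, Int.even_iff]; omega
    have h3 : Odd (y * z) := by rw [← H.ea, Int.odd_iff]; omega
    rw [Int.odd_mul] at h3
    have := h1.mul h3.2
    exact (Int.not_even_iff_odd.mpr this) h2

lemma good_even (H : Tri x y z a b c) (g : Good a b c) : Even (quartDisc (Kq b c)) := by
  rw [H.good_disc g, Int.even_iff]
  split_ifs <;> omega

/-- relabelling -/
lemma exists_good (H : Tri x y z a b c) (he : Even (quartDisc (Kq b c))) :
    ∃ x' y' z' a' b' c', Tri x' y' z' a' b' c' ∧ Good a' b' c' ∧ Kq b c = Kq b' c' := by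
  rcases H.classify with ⟨g1, g2, g3⟩ | g | g | g
  · exact absurd he (H.disc_odd g1 g2)
  · exact ⟨_, _, _, _, _, _, H, g, rfl⟩
  · exact ⟨_, _, _, _, _, _, H.rot, g, H.Kq_rot⟩
  · exact ⟨_, _, _, _, _, _, H.rot.rot, g, H.Kq_rot.trans H.rot.Kq_rot⟩
end Tri

lemma part1 (K : IntermediateField ℚ ℂ) (hK : IsV4Quartic K) (he : Even (quartDisc K)) :
      ∃! F₃ : IntermediateField ℚ ℂ, IsQuadSubfield K F₃ ∧
        ∀ F : IntermediateField ℚ ℂ, IsQuadSubfield K F → F ≠ F₃ →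
          padicValInt 2 (quartDisc F₃) < padicValInt 2 (quartDisc F) := by
  obtain ⟨b, c, hp, rfl⟩ := v4_pair hK
  obtain ⟨x, y, z, a, H0, -, -⟩ := tri_of_pair hp
  obtain ⟨x, y, z, a, b, c, H, g, e⟩ := H0.exists_good he
  rw [e]
  have hg := g.lt
  refine ⟨Fq a, ⟨H.quadA, fun F hF hne => ?_⟩, ?_⟩
  · rcases H.quad_cases hF with rfl | rfl | rfl
    · exact absurd rfl hne
    · rw [H.vA, H.vB]; exact hg.1
    · rw [H.vA, H.vC]; exact hg.2
  · rintro F ⟨h1, h2⟩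
    by_contra hne
    have := h2 _ H.quadA (Ne.symm hne)
    rcases H.quad_cases h1 with rfl | rfl | rfl
    · exact hne rfl
    · rw [H.vA, H.vB] at this; omega
    · rw [H.vA, H.vC] at this; omega

def Kset (R₁ R₂ X : ℝ) : Set (IntermediateField ℚ ℂ) := {K |
            IsV4Quartic K ∧ (quartDisc K : ℝ) < X ∧ Even (quartDisc K) ∧
            ∃ F₁ F₂ F₃ : IntermediateField ℚ ℂ,
              F₁ ≠ F₂ ∧ F₁ ≠ F₃ ∧ F₂ ≠ F₃ ∧
              IsQuadSubfield K F₁ ∧ IsQuadSubfield K F₂ ∧ IsQuadSubfield K F₃ ∧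
              padicValInt 2 (quartDisc F₃) < padicValInt 2 (quartDisc F₁) ∧
              padicValInt 2 (quartDisc F₃) < padicValInt 2 (quartDisc F₂) ∧
              |quartDisc F₁| ≤ |quartDisc F₂| ∧
              R₁ ^ 2 * |(quartDisc F₃ : ℝ)| ≤ |(quartDisc F₁ : ℝ)| ∧
              |(quartDisc F₂ : ℝ)| < R₂ ^ 2 * |(quartDisc F₃ : ℝ)|}

structure JP (R₁ R₂ X : ℝ) (x y z a b c : ℤ) : Prop where
  T : Tri x y z a b c
  x0 : 0 < x
  cop : IsCoprime y z
  g : Good a b c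
  d : (quartDisc (Kq b c) : ℝ) < X
  r1 : R₁ ^ 2 * |(Dq a : ℝ)| ≤ |(Dq b : ℝ)|
  r2 : R₁ ^ 2 * |(Dq a : ℝ)| ≤ |(Dq c : ℝ)|
  r3 : |(Dq b : ℝ)| < R₂ ^ 2 * |(Dq a : ℝ)|
  r4 : |(Dq c : ℝ)| < R₂ ^ 2 * |(Dq a : ℝ)|

lemma JP.swap {R₁ R₂ X : ℝ} {x y z a b c : ℤ} (H : JP R₁ R₂ X x y z a b c) :
    JP R₁ R₂ X x z y a c b :=
  ⟨H.T.swap, H.x0, H.cop.symm, H.g.swap, by rw [Tri.Kq_swap]; exact H.d, H.r2, H.r1, H.r4, H.r3⟩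

def J (R₁ R₂ X : ℝ) : Set (ℤ × ℤ) := {p | ∃ x y z a, JP R₁ R₂ X x y z a p.1 p.2}

def Jlt (R₁ R₂ X : ℝ) : Set (ℤ × ℤ) := {p | p ∈ J R₁ R₂ X ∧ p.1 < p.2}

lemma J_swap {R₁ R₂ X : ℝ} {p : ℤ × ℤ} (h : p ∈ J R₁ R₂ X) : p.swap ∈ J R₁ R₂ X := by
  obtain ⟨x, y, z, a, H⟩ := h
  exact ⟨x, z, y, a, H.swap⟩

lemma Tri.good_unique {x y z a b c x' y' z' a' b' c' : ℤ} (H : Tri x y z a b c) (g : Good a b c)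
    (H' : Tri x' y' z' a' b' c') (g' : Good a' b' c') (h : Kq b c = Kq b' c') :
    a = a' ∧ ((b = b' ∧ c = c') ∨ (b = c' ∧ c = b')) := by
  have hg := g.lt
  have hg' := g'.lt
  have mA : ∀ m : ℤ, Squarefree m → m ≠ 1 → IsQuadSubfield (Kq b' c') (Fq m) →
      m = a' ∨ m = b' ∨ m = c' := by
    intro m h1 h2 h3
    rcases H'.quad_cases h3 with h4 | h4 | h4
    · exact Or.inl (Fq_inj h1 h2 H'.ha H'.ha1 h4)
    · exact Or.inr (Or.inl (Fq_inj h1 h2 H'.hb H'.hb1 h4))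
    · exact Or.inr (Or.inr (Fq_inj h1 h2 H'.hc H'.hc1 h4))
  have e1 := mA a H.ha H.ha1 (h ▸ H.quadA)
  have e2 := mA b H.hb H.hb1 (h ▸ H.quadB)
  have e3 := mA c H.hc H.hc1 (h ▸ H.quadC)
  have n1 := H.pair.hne
  have n2 := H.rot.pair.hne
  have n3 := H.rot.rot.pair.hne
  rcases e1 with rfl | rfl | rfl <;> rcases e2 with rfl | rfl | rfl <;> rcases e3 with rfl | rfl | rfl <;>
    omega

lemma card_Jlt (R₁ R₂ X : ℝ) : Nat.card (Jlt R₁ R₂ X) = Nat.card (Kset R₁ R₂ X) := by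
  have hmem : ∀ p ∈ Jlt R₁ R₂ X, Kq p.1 p.2 ∈ Kset R₁ R₂ X := by
    rintro ⟨b, c⟩ ⟨⟨x, y, z, a, H⟩, hlt⟩
    have T := H.T
    have hg := H.g.lt
    refine ⟨T.pair.v4, H.d, T.good_even H.g, ?_⟩
    have nab : Fq b ≠ Fq a := fun h => by
      rw [← T.vA, ← T.vB, h] at hg; omega
    have nac : Fq c ≠ Fq a := fun h => by
      rw [← T.vA, ← T.vC, h] at hg; omega
    have nbc : Fq b ≠ Fq c := fun h => T.pair.hne (Fq_inj T.hb T.hb1 T.hc T.hc1 h)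
    have eA := quartDisc_Fq T.ha T.ha1
    have eB := quartDisc_Fq T.hb T.hb1
    have eC := quartDisc_Fq T.hc T.hc1
    rcases le_total |Dq b| |Dq c| with hle | hle
    · refine ⟨Fq b, Fq c, Fq a, nbc, nab, nac, T.quadB, T.quadC, T.quadA, ?_, ?_, ?_, ?_, ?_⟩
      · rw [T.vA, T.vB]; exact hg.1
      · rw [T.vA, T.vC]; exact hg.2
      · rw [eB, eC]; exact hle
      · rw [eA, eB]; exact H.r1
      · rw [eA, eC]; exact H.r4
    · refine ⟨Fq c, Fq b, Fq a, nbc.symm, nac, nab, T.quadC, T.quadB, T.quadA, ?_, ?_, ?_, ?_, ?_⟩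
      · rw [T.vA, T.vC]; exact hg.2
      · rw [T.vA, T.vB]; exact hg.1
      · rw [eB, eC]; exact hle
      · rw [eA, eC]; exact H.r2
      · rw [eA, eB]; exact H.r3
  refine Nat.card_eq_of_bijective (fun p : Jlt R₁ R₂ X => (⟨Kq p.1.1 p.1.2, hmem _ p.2⟩ : Kset R₁ R₂ X))
    ⟨?_, ?_⟩
  · rintro ⟨⟨b, c⟩, ⟨⟨x, y, z, a, H⟩, hlt⟩⟩ ⟨⟨b', c'⟩, ⟨⟨x', y', z', a', H'⟩, hlt'⟩⟩ h
    simp only [Subtype.mk.injEq] at h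
    simp only at H hlt H' hlt'
    have := H.T.good_unique H.g H'.T H'.g h
    have : b = b' ∧ c = c' := by omega
    simp [this]
  · -- surjectivity
    have main : ∀ b c : ℤ, (∃ x y z a, Tri x y z a b c ∧ 0 < x ∧ IsCoprime y z ∧ Good a b c ∧
        R₁ ^ 2 * |(Dq a : ℝ)| ≤ |(Dq b : ℝ)| ∧ R₁ ^ 2 * |(Dq a : ℝ)| ≤ |(Dq c : ℝ)| ∧
        |(Dq b : ℝ)| < R₂ ^ 2 * |(Dq a : ℝ)| ∧ |(Dq c : ℝ)| < R₂ ^ 2 * |(Dq a : ℝ)|) →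
        (quartDisc (Kq b c) : ℝ) < X → ∃ p ∈ Jlt R₁ R₂ X, Kq p.1 p.2 = Kq b c := by
      rintro b c ⟨x, y, z, a, T, h1, h2, h3, h4, h5, h6, h7⟩ hX
      have hJ : JP R₁ R₂ X x y z a b c := ⟨T, h1, h2, h3, hX, h4, h5, h6, h7⟩
      rcases lt_or_gt_of_ne T.pair.hne with h | h
      · exact ⟨(b, c), ⟨⟨x, y, z, a, hJ⟩, h⟩, rfl⟩
      · exact ⟨(c, b), ⟨⟨x, z, y, a, hJ.swap⟩, h⟩, Tri.Kq_swap _ _⟩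
    rintro ⟨K, hK, hX, he, F₁, F₂, F₃, n12, n13, n23, q1, q2, q3, v1, v2, hle, r1, r2⟩
    suffices h : ∃ p ∈ Jlt R₁ R₂ X, Kq p.1 p.2 = K by
      obtain ⟨p, hp, e⟩ := h
      exact ⟨⟨p, hp⟩, Subtype.ext e⟩
    obtain ⟨b, hb, hb1, rfl⟩ := quad_exists q1.2
    obtain ⟨c, hc, hc1, rfl⟩ := quad_exists q2.2
    have hp : Pair b c := ⟨hb, hb1, hc, hc1, fun h => n12 (by rw [h])⟩
    have hKe : K = Kq b c := by
      have := fd_of_finrank hK.1 (by norm_num)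
      symm
      exact eq_of_le_of_finrank_eq (sup_le q1.1 q2.1) (by rw [hp.finrank, hK.1])
    subst hKe
    obtain ⟨x, y, z, a, T, hx, hcop⟩ := tri_of_pair hp
    have h3 : F₃ = Fq a := by
      rcases T.quad_cases q3 with h | h | h
      · exact h
      · exact absurd h.symm n13
      · exact absurd h.symm n23
    subst h3
    rw [T.vA, T.vB] at v1
    rw [T.vA, T.vC] at v2
    rw [quartDisc_Fq T.hb T.hb1, quartDisc_Fq T.hc T.hc1] at hle
    rw [quartDisc_Fq T.ha T.ha1, quartDisc_Fq T.hb T.hb1] at r1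
    rw [quartDisc_Fq T.ha T.ha1, quartDisc_Fq T.hc T.hc1] at r2
    have hle' : |(Dq b : ℝ)| ≤ |(Dq c : ℝ)| := by exact_mod_cast hle
    exact main b c ⟨x, y, z, a, T, hx, hcop, T.good_of_lt v1 v2, r1, r1.trans hle', hle'.trans_lt r2, r2⟩ hX

lemma card_J (R₁ R₂ X : ℝ) : Nat.card (J R₁ R₂ X) = 2 * Nat.card (Kset R₁ R₂ X) := by
  rw [← card_Jlt]
  have e : Nat.card (Bool × Jlt R₁ R₂ X) = Nat.card (J R₁ R₂ X) := by
    refine Nat.card_eq_of_bijective (fun q : Bool × Jlt R₁ R₂ X =>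
      (⟨if q.1 then q.2.1 else q.2.1.swap, by
        split_ifs
        · exact q.2.2.1
        · exact J_swap q.2.2.1⟩ : J R₁ R₂ X)) ⟨?_, ?_⟩
    · rintro ⟨u, ⟨⟨b, c⟩, hJ, hlt⟩⟩ ⟨u', ⟨⟨b', c'⟩, hJ', hlt'⟩⟩ h
      simp only [Subtype.mk.injEq] at h
      simp only at hlt hlt'
      cases u <;> cases u' <;> simp at h <;> first | omega | simp [h]
    · rintro ⟨⟨b, c⟩, hJ⟩
      have hne : b ≠ c := by
        obtain ⟨x, y, z, a, H⟩ := hJ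
        exact H.T.pair.hne
      rcases lt_or_gt_of_ne hne with h | h
      · exact ⟨(true, ⟨(b, c), hJ, h⟩), by simp⟩
      · exact ⟨(false, ⟨(c, b), J_swap hJ, h⟩), by simp⟩
  rw [← e, Nat.card_prod]
  simp

open Module IntermediateField

def G (A B Y : ℝ) : Set (ℕ × ℕ × ℕ) := {t | Odd (t.1 * t.2.1 * t.2.2) ∧
  Squarefree (t.1 * t.2.1 * t.2.2) ∧ ((t.1 * t.2.1 * t.2.2 : ℕ) : ℝ) < Y ∧
  A * t.2.1 ≤ t.1 ∧ (t.1 : ℝ) < B * t.2.1 ∧ A * t.2.2 ≤ t.1 ∧ (t.1 : ℝ) < B * t.2.2}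

structure Cls (k ν : ℕ) (r r' : ℤ) : Prop where
  h : (k = 1 ∧ ν = 1 ∧ r = 3 ∧ r' = 3) ∨ (k = 2 ∧ ν = 1 ∧ r = 1 ∧ r' = 1) ∨
    (k = 2 ∧ ν = 1 ∧ r = 3 ∧ r' = 3) ∨ (k = 2 ∧ ν = 2 ∧ r = 1 ∧ r' = 3) ∨
    (k = 2 ∧ ν = 2 ∧ r = 3 ∧ r' = 1)

lemma mod4_aux (d y z : ℤ) : (d * z % 4 = 3 ∧ d * y % 4 = 3 → y * z % 4 = 1) ∧
    (d * z % 4 = 1 ∧ d * y % 4 = 1 → y * z % 4 = 1) ∧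
    (d * z % 4 = 1 ∧ d * y % 4 = 3 → y * z % 4 = 3) ∧
    (d * z % 4 = 3 ∧ d * y % 4 = 1 → y * z % 4 = 3) := by
  rw [Int.mul_emod d z, Int.mul_emod d y, Int.mul_emod y z]
  have hd : d % 4 = 0 ∨ d % 4 = 1 ∨ d % 4 = 2 ∨ d % 4 = 3 := by omega
  have hy : y % 4 = 0 ∨ y % 4 = 1 ∨ y % 4 = 2 ∨ y % 4 = 3 := by omega
  have hz : z % 4 = 0 ∨ z % 4 = 1 ∨ z % 4 = 2 ∨ z % 4 = 3 := by omega
  rcases hd with h1 | h1 | h1 | h1 <;> rcases hy with h2 | h2 | h2 | h2 <;>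
    rcases hz with h3 | h3 | h3 | h3 <;> rw [h1, h2, h3] <;> norm_num

namespace Cls
variable {k ν : ℕ} {r r' : ℤ} {d : ℕ} {y z : ℤ}

lemma k0 (H : Cls k ν r r') : 0 < k := by rcases H.h with h | h | h | h | h <;> omega

lemma amod (H : Cls k ν r r') (hz : d * z % 4 = r) (hy : d * y % 4 = r') :
    (ν = 1 ∧ y * z % 4 = 1) ∨ (ν = 2 ∧ y * z % 4 = 3) := by
  have := mod4_aux d y z
  rcases H.h with h | h | h | h | h <;> obtain ⟨h1, h2, rfl, rfl⟩ := h <;> simp [hz, hy] at this <;>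
    simp [h2, this]

lemma bmod (H : Cls k ν r r') (hz : d * z % 4 = r) : (k * d * z) % 4 ≠ 1 := by
  rw [mul_assoc]
  rcases H.h with h | h | h | h | h <;> obtain ⟨rfl, h2, rfl, rfl⟩ := h <;> push_cast <;> omega
lemma cmod (H : Cls k ν r r') (hy : d * y % 4 = r') : (k * d * y) % 4 ≠ 1 := by
  rw [mul_assoc]
  rcases H.h with h | h | h | h | h <;> obtain ⟨rfl, h2, rfl, rfl⟩ := h <;> push_cast <;> omega

lemma good (H : Cls k ν r r') (hz : d * z % 4 = r) (hy : d * y % 4 = r') :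
    Good (y * z) (k * d * z) (k * d * y) := by
  have := H.amod hz hy
  rw [mul_assoc (k : ℤ), mul_assoc (k : ℤ)]
  unfold Good
  rcases H.h with h | h | h | h | h <;> obtain ⟨rfl, h2, rfl, rfl⟩ := h <;> push_cast <;> omega

lemma absDa (H : Cls k ν r r') (hz : d * z % 4 = r) (hy : d * y % 4 = r') :
    |(Dq (y * z) : ℝ)| = (ν : ℝ) ^ 2 * (y.natAbs * z.natAbs) := by
  rw [Nat.cast_natAbs, Nat.cast_natAbs]
  push_cast
  unfold Dq
  rcases H.amod hz hy with ⟨rfl, h⟩ | ⟨rfl, h⟩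
  · rw [if_pos h]; push_cast; rw [abs_mul]; ring
  · rw [if_neg (by omega)]; push_cast; rw [abs_mul, abs_mul]; norm_num

lemma absDb (hb : (k * d * z) % 4 ≠ 1) :
    |(Dq (k * d * z) : ℝ)| = 4 * k * d * z.natAbs := by
  rw [Nat.cast_natAbs]
  unfold Dq
  rw [if_neg hb]; push_cast; simp only [abs_mul, Nat.abs_cast, Nat.abs_ofNat]; ring

lemma tri (H : Cls k ν r r') (hz : d * z % 4 = r) (hy : d * y % 4 = r') (h1 : y * z ≠ 1)
    (hs : Squarefree (d * y.natAbs * z.natAbs)) (ho : Odd (d * y.natAbs * z.natAbs)) :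
    Tri (k * d) y z (y * z) (k * d * z) (k * d * y) := by
  have hk : Squarefree k := by
    rcases H.h with h | h | h | h | h <;> obtain ⟨rfl, h2, rfl, rfl⟩ := h <;> 
      first | exact squarefree_one | exact Nat.prime_two.squarefree
  have hsq : ∀ m : ℕ, m ∣ d * y.natAbs * z.natAbs → Squarefree (k * m) := by
    intro m hm
    have ho' : Odd m := ho.of_dvd_nat hm
    refine Nat.squarefree_mul_iff.mpr ⟨?_, hk, hs.squarefree_of_dvd hm⟩
    rcases H.h with h | h | h | h | h <;> obtain ⟨rfl, h2, rfl, rfl⟩ := h <;>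
      first | exact Nat.coprime_one_left m | exact Nat.coprime_two_left.mpr ho'
  refine ⟨rfl, rfl, rfl, ?_, ?_, ?_, h1, ?_, ?_⟩
  · rw [← Int.squarefree_natAbs, Int.natAbs_mul]
    exact hs.squarefree_of_dvd ⟨d, by ring⟩
  · rw [← Int.squarefree_natAbs, Int.natAbs_mul, Int.natAbs_mul, mul_assoc]
    exact hsq _ ⟨y.natAbs, by simp; ring⟩
  · rw [← Int.squarefree_natAbs, Int.natAbs_mul, Int.natAbs_mul, mul_assoc]
    exact hsq _ ⟨z.natAbs, by simp⟩
  · intro h; apply H.bmod hz; rw [h]; rfl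
  · intro h; apply H.cmod hy; rw [h]; rfl

lemma disc (H : Cls k ν r r') (hz : d * z % 4 = r) (hy : d * y % 4 = r')
    (T : Tri (k * d) y z (y * z) (k * d * z) (k * d * y)) :
    (quartDisc (Kq (k * d * z) (k * d * y)) : ℝ) =
      (4 * k * ν * (d * y.natAbs * z.natAbs : ℕ)) ^ 2 := by
  rw [T.good_disc (H.good hz hy)]
  have e : ((d * y.natAbs * z.natAbs : ℕ) : ℝ) ^ 2 = (d * y * z) ^ 2 := by
    push_cast
    rw [Nat.cast_natAbs, Nat.cast_natAbs]
    push_cast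
    rw [mul_pow, mul_pow, sq_abs, sq_abs]; ring
  rw [mul_pow, e]
  rcases H.amod hz hy with ⟨rfl, h⟩ | ⟨rfl, h⟩
  · rw [if_pos h]; push_cast; ring
  · rw [if_neg (by omega)]; push_cast; ring

lemma core (H : Cls k ν r r') (hz : d * z % 4 = r) (hy : d * y % 4 = r') (R₁ R₂ X : ℝ)
    (hd : 0 < d) (hy0 : y ≠ 0) (hz0 : z ≠ 0)
    (T : Tri (k * d) y z (y * z) (k * d * z) (k * d * y)) :
    ((quartDisc (Kq (k * d * z) (k * d * y)) : ℝ) < X ∧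
      R₁ ^ 2 * |(Dq (y * z) : ℝ)| ≤ |(Dq (k * d * z) : ℝ)| ∧
      R₁ ^ 2 * |(Dq (y * z) : ℝ)| ≤ |(Dq (k * d * y) : ℝ)| ∧
      |(Dq (k * d * z) : ℝ)| < R₂ ^ 2 * |(Dq (y * z) : ℝ)| ∧
      |(Dq (k * d * y) : ℝ)| < R₂ ^ 2 * |(Dq (y * z) : ℝ)|) ↔
    (((d * y.natAbs * z.natAbs : ℕ) : ℝ) < √X / (4 * k * ν) ∧
      R₁ ^ 2 * ν ^ 2 / (4 * k) * y.natAbs ≤ d ∧ (d : ℝ) < R₂ ^ 2 * ν ^ 2 / (4 * k) * y.natAbs ∧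
      R₁ ^ 2 * ν ^ 2 / (4 * k) * z.natAbs ≤ d ∧ (d : ℝ) < R₂ ^ 2 * ν ^ 2 / (4 * k) * z.natAbs) := by
  rw [H.disc hz hy T, H.absDa hz hy, absDb (H.bmod hz), absDb (H.cmod hy)]
  have hk : (0 : ℝ) < k := by exact_mod_cast H.k0
  have hν : (0 : ℝ) < ν := by
    rcases H.h with h | h | h | h | h <;> obtain ⟨h1, rfl, h2, h3⟩ := h <;> norm_num
  have he : (0 : ℝ) < y.natAbs := by exact_mod_cast Int.natAbs_pos.mpr hy0
  have hf : (0 : ℝ) < z.natAbs := by exact_mod_cast Int.natAbs_pos.mpr hz0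
  generalize (y.natAbs : ℝ) = e at *
  generalize hff : (z.natAbs : ℝ) = f at *
  have a1 : (4 * k * ν * ((d * y.natAbs * z.natAbs : ℕ) : ℝ)) ^ 2 < X ↔
      ((d * y.natAbs * z.natAbs : ℕ) : ℝ) < √X / (4 * k * ν) := by
    rw [lt_div_iff₀ (by positivity), ← Real.lt_sqrt (by positivity)]
    rw [mul_comm]
  have a2 : ∀ (R u v : ℝ), 0 < u → 0 < v → (R ^ 2 * (ν ^ 2 * (u * v)) ≤ 4 * k * d * v ↔
      R ^ 2 * ν ^ 2 / (4 * k) * u ≤ d) := by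
    intro R u v hu hv
    rw [div_mul_eq_mul_div, div_le_iff₀ (by positivity)]
    rw [show R ^ 2 * (ν ^ 2 * (u * v)) = (R ^ 2 * ν ^ 2 * u) * v by ring,
      show 4 * k * d * v = (d * (4 * k)) * v by ring]
    exact mul_le_mul_iff_left₀ hv
  have a3 : ∀ (R u v : ℝ), 0 < u → 0 < v → (4 * k * d * v < R ^ 2 * (ν ^ 2 * (u * v)) ↔
      d < R ^ 2 * ν ^ 2 / (4 * k) * u) := by
    intro R u v hu hv
    rw [← not_le, ← not_le, a2 R u v hu hv]
  rw [a1, a2 _ _ _ he hf, a3 _ _ _ he hf, mul_comm e f, a2 _ _ _ hf he, a3 _ _ _ hf he]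
  tauto
end Cls

open Module IntermediateField

def zz (r : ℤ) (d f : ℕ) : ℤ := if (d * f : ℤ) % 4 = r then (f : ℤ) else -f

lemma zz_natAbs (r : ℤ) (d f : ℕ) : (zz r d f).natAbs = f := by
  unfold zz; split_ifs <;> simp

lemma zz_mod {r : ℤ} {d f : ℕ} (hr : r = 1 ∨ r = 3) (h : Odd (d * f)) : d * zz r d f % 4 = r := by
  unfold zz
  have h2 : (d * f : ℤ) % 2 = 1 := by
    have := Nat.odd_iff.mp h
    zify at this
    exact this
  split_ifs with h1
  · exact h1
  · rw [mul_neg]; omega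

lemma zz_eq {r : ℤ} {d : ℕ} {z : ℤ} (hr : r = 1 ∨ r = 3) (h : d * z % 4 = r) :
    zz r d z.natAbs = z := by
  unfold zz
  rcases Int.natAbs_eq z with h1 | h1
  · rw [← h1, if_pos h]
  · have h2 : (z.natAbs : ℤ) = - z := by omega
    rw [h2, mul_neg, if_neg (by omega)]; ring

def psi (k : ℕ) (r r' : ℤ) (t : ℕ × ℕ × ℕ) : ℤ × ℤ :=
  (k * t.1 * zz r t.1 t.2.2, k * t.1 * zz r' t.1 t.2.1)

def Jc (R₁ R₂ X : ℝ) (k : ℕ) (r r' : ℤ) : Set (ℤ × ℤ) :=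
  {p | p ∈ J R₁ R₂ X ∧ p.1 % (k * 4) = k * r ∧ p.2 % (k * 4) = k * r'}

lemma G_pos {A B Y : ℝ} {t : ℕ × ℕ × ℕ} (h : t ∈ G A B Y) : 0 < t.1 ∧ 0 < t.2.1 ∧ 0 < t.2.2 := by
  obtain ⟨h1, -⟩ := h
  have := h1.pos
  refine ⟨?_, ?_, ?_⟩ <;> rw [Nat.pos_iff_ne_zero] <;> intro h0 <;> simp [h0] at this

lemma G_finite (A B Y : ℝ) : (G A B Y).Finite := by
  refine Set.Finite.subset ((Set.finite_Iic ⌈Y⌉₊).prod ((Set.finite_Iic ⌈Y⌉₊).prod (Set.finite_Iic ⌈Y⌉₊))) ?_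
  rintro ⟨d, e, f⟩ h
  have hp := G_pos h
  obtain ⟨-, -, h3, -⟩ := h
  simp only at hp h3
  have h4 : d * e * f ≤ ⌈Y⌉₊ := by
    have := h3.le.trans (Nat.le_ceil Y)
    exact_mod_cast this
  have hde : 0 < d * e := Nat.mul_pos hp.1 hp.2.1
  have h5 : d * e ≤ d * e * f := Nat.le_mul_of_pos_right _ hp.2.2
  refine ⟨?_, ?_, ?_⟩ <;> simp only [Set.mem_Iic]
  · exact (Nat.le_mul_of_pos_right _ hp.2.1).trans (h5.trans h4)
  · exact (Nat.le_mul_of_pos_left _ hp.1).trans (h5.trans h4)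
  · exact (Nat.le_mul_of_pos_left _ hde).trans h4

namespace Cls
variable {k ν : ℕ} {r r' : ℤ}

lemma hr (H : Cls k ν r r') : (r = 1 ∨ r = 3) ∧ (r' = 1 ∨ r' = 3) := by
  rcases H.h with h | h | h | h | h <;> omega

lemma sub_image (H : Cls k ν r r') (R₁ R₂ X : ℝ) : Jc R₁ R₂ X k r r' ⊆
    (psi k r r') '' G (R₁ ^ 2 * ν ^ 2 / (4 * k)) (R₂ ^ 2 * ν ^ 2 / (4 * k)) (√X / (4 * k * ν)) := by
  rintro ⟨b, c⟩ ⟨⟨x, y, z, a, P⟩, h1, h2⟩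
  simp only at P h1 h2
  have hk : (0 : ℤ) < k := by exact_mod_cast H.k0
  obtain rfl := P.T.ea
  obtain rfl := P.T.eb
  obtain rfl := P.T.ec
  have kb : (k : ℤ) ∣ x * z := by
    have : (k : ℤ) ∣ x * z % (k * 4) := h1 ▸ dvd_mul_right _ _
    exact (Int.dvd_iff_emod_eq_zero.mpr (by
      have := Int.emod_eq_zero_of_dvd this
      rwa [Int.emod_emod_of_dvd _ (dvd_mul_right _ _)] at this))
  have kc : (k : ℤ) ∣ x * y := by
    have : (k : ℤ) ∣ x * y % (k * 4) := h2 ▸ dvd_mul_right _ _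
    exact (Int.dvd_iff_emod_eq_zero.mpr (by
      have := Int.emod_eq_zero_of_dvd this
      rwa [Int.emod_emod_of_dvd _ (dvd_mul_right _ _)] at this))
  have kx : (k : ℤ) ∣ x := by
    obtain ⟨u, v, huv⟩ := P.cop
    have e : x = u * (x * y) + v * (x * z) := by linear_combination -x * huv
    rw [e]
    exact dvd_add (Dvd.dvd.mul_left kc u) (Dvd.dvd.mul_left kb v)
  obtain ⟨d, rfl⟩ := kx
  have hd : 0 < d := (mul_pos_iff_of_pos_left hk).mp P.x0
  lift d to ℕ using hd.le
  have hd' : 0 < d := by exact_mod_cast hd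
  rw [mul_assoc, Int.mul_emod_mul_of_pos _ _ hk] at h1 h2
  have hz := mul_left_cancel₀ hk.ne' h1
  have hy := mul_left_cancel₀ hk.ne' h2
  have hz0 : z ≠ 0 := by rintro rfl; exact P.T.ha.ne_zero (by ring)
  have hy0 : y ≠ 0 := by rintro rfl; exact P.T.ha.ne_zero (by ring)
  have hr := H.hr
  have hcore := (H.core hz hy R₁ R₂ X hd' hy0 hz0 P.T).mp ⟨P.d, P.r1, P.r2, P.r3, P.r4⟩
  have odz : Odd ((d : ℤ) * z) := Int.odd_iff.mpr (by omega)
  have ody : Odd ((d : ℤ) * y) := Int.odd_iff.mpr (by omega)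
  rw [Int.odd_mul] at odz ody
  have sz : Squarefree (d * z.natAbs) := by
    have := Int.squarefree_natAbs.mpr P.T.hb
    rw [Int.natAbs_mul, Int.natAbs_mul, mul_assoc] at this
    simpa using this.squarefree_of_dvd (dvd_mul_left _ _)
  have sy : Squarefree (d * y.natAbs) := by
    have := Int.squarefree_natAbs.mpr P.T.hc
    rw [Int.natAbs_mul, Int.natAbs_mul, mul_assoc] at this
    simpa using this.squarefree_of_dvd (dvd_mul_left _ _)
  refine ⟨(d, y.natAbs, z.natAbs), ⟨?_, ?_, hcore⟩, ?_⟩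
  · simp only [Nat.odd_mul, Int.natAbs_odd]
    exact ⟨⟨by exact_mod_cast odz.1, ody.2⟩, odz.2⟩
  · simp only
    have cz := (Nat.squarefree_mul_iff.mp sz)
    refine Nat.squarefree_mul_iff.mpr ⟨Nat.Coprime.mul_left cz.1 ?_, sy, cz.2.2⟩
    exact Int.isCoprime_iff_nat_coprime.mp P.cop
  · simp only [psi]
    rw [zz_eq hr.1 hz, zz_eq hr.2 hy]

lemma maps (H : Cls k ν r r') (R₁ R₂ X : ℝ) (t : ℕ × ℕ × ℕ) (ht : t ∈
    G (R₁ ^ 2 * ν ^ 2 / (4 * k)) (R₂ ^ 2 * ν ^ 2 / (4 * k)) (√X / (4 * k * ν)))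
    (hne : ¬ (t.2.1 = 1 ∧ t.2.2 = 1)) : psi k r r' t ∈ Jc R₁ R₂ X k r r' := by
  have hp := G_pos ht
  have hr := H.hr
  obtain ⟨d, e, f⟩ := t
  obtain ⟨ho, hs, hcore⟩ := ht
  simp only at hp ho hs hcore hne
  have hk : (0 : ℤ) < k := by exact_mod_cast H.k0
  have ho2 := ho
  rw [Nat.odd_mul, Nat.odd_mul] at ho2
  have hz := zz_mod (f := f) hr.1 (ho2.1.1.mul ho2.2)
  have hy := zz_mod (f := e) hr.2 (ho2.1.1.mul ho2.1.2)
  have az := zz_natAbs r d f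
  have ay := zz_natAbs r' d e
  set z := zz r d f with hzd
  set y := zz r' d e with hyd
  have hz0 : z ≠ 0 := by intro h; rw [h] at az; simp at az; omega
  have hy0 : y ≠ 0 := by intro h; rw [h] at ay; simp at ay; omega
  rw [← az, ← ay] at hcore hs ho
  have hyz : y * z ≠ 1 := by
    intro h
    apply hne
    have := congrArg Int.natAbs h
    rw [Int.natAbs_mul, az, ay] at this
    exact mul_eq_one.mp (by simpa using this)
  have T := H.tri hz hy hyz hs ho
  have hc := (H.core hz hy R₁ R₂ X hp.1 hy0 hz0 T).mpr hcore
  refine ⟨⟨k * d, y, z, y * z, T, ?_, ?_, H.good hz hy, hc.1, hc.2.1, hc.2.2.1, hc.2.2.2.1, hc.2.2.2.2⟩, ?_, ?_⟩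
  · have : (0 : ℤ) < d := by exact_mod_cast hp.1
    positivity
  · rw [Int.isCoprime_iff_nat_coprime]
    have h1 := hs.squarefree_of_dvd (show y.natAbs * z.natAbs ∣ _ from ⟨d, by ring⟩)
    exact (Nat.squarefree_mul_iff.mp h1).1
  · simp only [psi]
    rw [mul_assoc, Int.mul_emod_mul_of_pos _ _ hk, hz]
  · simp only [psi]
    rw [mul_assoc, Int.mul_emod_mul_of_pos _ _ hk, hy]

lemma inj (H : Cls k ν r r') (A B Y : ℝ) : Set.InjOn (psi k r r') (G A B Y) := by
  have key : ∀ d e f d' e' f' : ℕ, 0 < d → 0 < e → 0 < f → Nat.Coprime e f → Nat.Coprime e' f' → 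
      d * f = d' * f' → d * e = d' * e' → (d, e, f) = (d', e', f') := by
    intro d e f d' e' f' hd he hf h1 h2 h3 h4
    have h5 : d = d' := by
      have a := Nat.gcd_mul_left d e f
      have b := Nat.gcd_mul_left d' e' f'
      rw [h1] at a
      rw [h2] at b
      rw [h3, h4] at a
      omega
    subst h5
    rw [Nat.eq_of_mul_eq_mul_left hd h3, Nat.eq_of_mul_eq_mul_left hd h4]
  have hco : ∀ t ∈ G A B Y, Nat.Coprime t.2.1 t.2.2 := by
    rintro ⟨d, e, f⟩ ⟨-, hs, -⟩
    have h1 := hs.squarefree_of_dvd (show e * f ∣ _ from ⟨d, by simp only; ring⟩)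
    exact (Nat.squarefree_mul_iff.mp h1).1
  have hna : ∀ (r : ℤ) (d f : ℕ), ((k : ℤ) * d * zz r d f).natAbs = k * (d * f) := by
    intro r d f
    rw [Int.natAbs_mul, Int.natAbs_mul, zz_natAbs]; simp; ring
  rintro ⟨d, e, f⟩ ht ⟨d', e', f'⟩ ht' h
  have c1 := hco _ ht
  have c2 := hco _ ht'
  have p1 := G_pos ht
  simp only [psi, Prod.mk.injEq] at h c1 c2 p1
  have e1 := congrArg Int.natAbs h.1
  have e2 := congrArg Int.natAbs h.2
  rw [hna, hna] at e1 e2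
  exact key _ _ _ _ _ _ p1.1 p1.2.1 p1.2.2 c1 c2 (Nat.eq_of_mul_eq_mul_left H.k0 e1)
    (Nat.eq_of_mul_eq_mul_left H.k0 e2)

lemma finite (H : Cls k ν r r') (R₁ R₂ X : ℝ) : (Jc R₁ R₂ X k r r').Finite :=
  ((G_finite _ _ _).image _).subset (H.sub_image R₁ R₂ X)

lemma card_le (H : Cls k ν r r') (R₁ R₂ X : ℝ) : (Jc R₁ R₂ X k r r').ncard ≤
    (G (R₁ ^ 2 * ν ^ 2 / (4 * k)) (R₂ ^ 2 * ν ^ 2 / (4 * k)) (√X / (4 * k * ν))).ncard :=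
  (Set.ncard_le_ncard (H.sub_image R₁ R₂ X) ((G_finite _ _ _).image _)).trans
    (Set.ncard_image_le (G_finite _ _ _))

lemma le_card (H : Cls k ν r r') (R₁ R₂ X : ℝ) :
    (G (R₁ ^ 2 * ν ^ 2 / (4 * k)) (R₂ ^ 2 * ν ^ 2 / (4 * k)) (√X / (4 * k * ν))).ncard ≤
    (Jc R₁ R₂ X k r r').ncard + ⌈R₂ ^ 2 * ν ^ 2 / (4 * k)⌉₊ := by
  set S := G (R₁ ^ 2 * ν ^ 2 / (4 * k)) (R₂ ^ 2 * ν ^ 2 / (4 * k)) (√X / (4 * k * ν)) with hS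
  set E : Set (ℕ × ℕ × ℕ) := (fun d => (d, 1, 1)) '' (Set.Iio ⌈R₂ ^ 2 * ν ^ 2 / (4 * k)⌉₊) with hE
  have h1 : S ⊆ (S \ E) ∪ E := by intro t ht; by_cases h : t ∈ E <;> simp [h, ht]
  have hEf : E.Finite := (Set.finite_Iio _).image _
  have hSf : S.Finite := G_finite _ _ _
  refine (Set.ncard_le_ncard h1 (hSf.sdiff.union hEf)).trans ((Set.ncard_union_le _ _).trans ?_)
  gcongr
  · refine Set.ncard_le_ncard_of_injOn (psi k r r') ?_ ((H.inj _ _ _).mono Set.sdiff_subset) (H.finite _ _ _)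
    rintro ⟨d, e, f⟩ ⟨ht, hn⟩
    refine H.maps _ _ _ _ ht ?_
    rintro ⟨he, hf⟩
    apply hn
    simp only at he hf
    subst he hf
    refine ⟨d, ?_, rfl⟩
    have := ht.2.2.2.2.1
    simp only [Nat.cast_one, mul_one] at this
    exact Nat.lt_ceil.mpr this
  · refine (Set.ncard_image_le (Set.finite_Iio _)).trans ?_
    rw [← Finset.coe_Iio, Set.ncard_coe_finset]; simp
end Cls

lemma J_eq (R₁ R₂ X : ℝ) : J R₁ R₂ X = Jc R₁ R₂ X 1 3 3 ∪ (Jc R₁ R₂ X 2 1 1 ∪ (Jc R₁ R₂ X 2 3 3 ∪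
    (Jc R₁ R₂ X 2 1 3 ∪ Jc R₁ R₂ X 2 3 1))) := by
  ext ⟨b, c⟩
  simp only [Set.mem_union, Jc, Set.mem_ofPred_eq]
  constructor
  · intro h
    have := h
    obtain ⟨x, y, z, a, P⟩ := this
    have hg := P.g
    simp only [h, true_and]
    unfold Good at hg
    simp only at hg
    push_cast
    omega
  · rintro (h | h | h | h | h) <;> exact h.1

lemma card_J_eq (R₁ R₂ X : ℝ) : Nat.card (J R₁ R₂ X) = (Jc R₁ R₂ X 1 3 3).ncard +
    ((Jc R₁ R₂ X 2 1 1).ncard + ((Jc R₁ R₂ X 2 3 3).ncard +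
    ((Jc R₁ R₂ X 2 1 3).ncard + (Jc R₁ R₂ X 2 3 1).ncard))) := by
  have f1 := Cls.finite (k := 1) (ν := 1) (r := 3) (r' := 3) ⟨by simp⟩ R₁ R₂ X
  have f2 := Cls.finite (k := 2) (ν := 1) (r := 1) (r' := 1) ⟨by simp⟩ R₁ R₂ X
  have f3 := Cls.finite (k := 2) (ν := 1) (r := 3) (r' := 3) ⟨by simp⟩ R₁ R₂ X
  have f4 := Cls.finite (k := 2) (ν := 2) (r := 1) (r' := 3) ⟨by simp⟩ R₁ R₂ X
  have f5 := Cls.finite (k := 2) (ν := 2) (r := 3) (r' := 1) ⟨by simp⟩ R₁ R₂ X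
  rw [Nat.card_coe_set_eq, J_eq]
  rw [Set.ncard_union_eq _ f1 (f2.union (f3.union (f4.union f5))),
    Set.ncard_union_eq _ f2 (f3.union (f4.union f5)), Set.ncard_union_eq _ f3 (f4.union f5),
    Set.ncard_union_eq _ f4 f5]
  all_goals
    rw [Set.disjoint_left]
    rintro ⟨b, c⟩ ⟨-, h1, h2⟩ h
    simp only [Set.mem_union, Jc, Set.mem_ofPred_eq] at h h1 h2
    push_cast at h h1 h2
    omega

open Module

section region
open MeasureTheory Filter Topology

def Cn (A B A' B' : ℝ) : Set (Fin 3 → ℝ) := {x | 0 < x 0 ∧ 0 < x 1 ∧ 0 < x 2 ∧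
  A * x 1 ≤ x 0 ∧ x 0 < B * x 1 ∧ A' * x 2 ≤ x 0 ∧ x 0 < B' * x 2}

def Fp (x : Fin 3 → ℝ) : ℝ := x 0 * x 1 * x 2

lemma cube_bound {A B A' B' Y x y z : ℝ} (hA : 0 < A) (hB : 0 < B) (hA' : 0 < A') (hB' : 0 < B')
    (hx : 0 < x) (hy : 0 < y) (hz : 0 < z) (h1 : A * y ≤ x) (h2 : x < B * y) (h3 : A' * z ≤ x)
    (h4 : x < B' * z) (hY : x * y * z ≤ Y) :
    x ^ 3 ≤ (B * B' + B' / A ^ 2 + B / A' ^ 2) * Y ∧ y ^ 3 ≤ (B * B' + B' / A ^ 2 + B / A' ^ 2) * Y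
      ∧ z ^ 3 ≤ (B * B' + B' / A ^ 2 + B / A' ^ 2) * Y := by
  have hY0 : 0 < Y := lt_of_lt_of_le (by positivity) hY
  have a1 : 0 < B * B' * Y := by positivity
  have a2 : 0 < B' / A ^ 2 * Y := by positivity
  have a3 : 0 < B / A' ^ 2 * Y := by positivity
  have b1 : x ^ 3 ≤ B * B' * Y := by
    calc x ^ 3 = x * (x * x) := by ring
      _ ≤ x * ((B * y) * (B' * z)) := by gcongr
      _ = B * B' * (x * y * z) := by ring
      _ ≤ _ := by gcongr
  have b2 : y ^ 3 ≤ B' / A ^ 2 * Y := by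
    rw [div_mul_eq_mul_div, le_div_iff₀ (by positivity)]
    calc y ^ 3 * A ^ 2 = y * (A * y) * (A * y) := by ring
      _ ≤ y * x * (B' * z) :=
        mul_le_mul (by gcongr) (h1.trans h4.le) (by positivity) (by positivity)
      _ = B' * (x * y * z) := by ring
      _ ≤ _ := by gcongr
  have b3 : z ^ 3 ≤ B / A' ^ 2 * Y := by
    rw [div_mul_eq_mul_div, le_div_iff₀ (by positivity)]
    calc z ^ 3 * A' ^ 2 = z * (A' * z) * (A' * z) := by ring
      _ ≤ z * x * (B * y) :=
        mul_le_mul (by gcongr) (h3.trans h2.le) (by positivity) (by positivity)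
      _ = B * (x * y * z) := by ring
      _ ≤ _ := by gcongr
  refine ⟨?_, ?_, ?_⟩ <;> nlinarith

lemma Cn_convex (A B A' B' : ℝ) : Convex ℝ (Cn A B A' B') := by
  rw [convex_iff_forall_pos]
  rintro x ⟨x0, x1, x2, x3, x4, x5, x6⟩ y ⟨y0, y1, y2, y3, y4, y5, y6⟩ a b ha hb -
  refine ⟨?_, ?_, ?_, ?_, ?_, ?_, ?_⟩ <;> simp only [Pi.add_apply, Pi.smul_apply, smul_eq_mul]
  · positivity
  · positivity
  · positivity
  · linarith [mul_le_mul_of_nonneg_left x3 ha.le, mul_le_mul_of_nonneg_left y3 hb.le]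
  · linarith [mul_lt_mul_of_pos_left x4 ha, mul_lt_mul_of_pos_left y4 hb]
  · linarith [mul_le_mul_of_nonneg_left x5 ha.le, mul_le_mul_of_nonneg_left y5 hb.le]
  · linarith [mul_lt_mul_of_pos_left x6 ha, mul_lt_mul_of_pos_left y6 hb]

def Dn : Set (Fin 3 → ℝ) := {x | 0 < x 0 ∧ 0 < x 1 ∧ 0 < x 2 ∧ 1 < Fp x}

lemma Dn_convex : Convex ℝ Dn := by
  rw [convex_iff_forall_pos]
  rintro x ⟨x0, x1, x2, x3⟩ y ⟨y0, y1, y2, y3⟩ a b ha hb hab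
  have k : ∀ i, 0 < x i → 0 < y i → x i ^ a * y i ^ b ≤ a * x i + b * y i := fun i hx hy =>
    Real.geom_mean_le_arith_mean2_weighted ha.le hb.le hx.le hy.le hab
  refine ⟨?_, ?_, ?_, ?_⟩ <;> simp only [Fp, Pi.add_apply, Pi.smul_apply, smul_eq_mul]
  · positivity
  · positivity
  · positivity
  · have e : (x 0 ^ a * y 0 ^ b) * (x 1 ^ a * y 1 ^ b) * (x 2 ^ a * y 2 ^ b)
        = (Fp x) ^ a * (Fp y) ^ b := by
      unfold Fp
      rw [Real.mul_rpow (by positivity) (by positivity), Real.mul_rpow (by positivity) (by positivity),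
        Real.mul_rpow (by positivity) (by positivity), Real.mul_rpow (by positivity) (by positivity)]
      ring
    have l : 1 < (Fp x) ^ a * (Fp y) ^ b :=
      one_lt_mul_of_lt_of_le (Real.one_lt_rpow x3 ha) (Real.one_lt_rpow y3 hb).le
    refine l.trans_le ?_
    rw [← e]
    have := k 0 x0 y0
    have := k 1 x1 y1
    have := k 2 x2 y2
    gcongr

lemma S_eq (A B A' B' : ℝ) : {x | x ∈ Cn A B A' B' ∧ Fp x ≤ 1} = Cn A B A' B' ∩ Dnᶜ := by
  ext x
  simp only [Set.mem_ofPred_eq, Set.mem_inter_iff, Set.mem_compl_iff, Dn, not_and, not_lt]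
  constructor
  · rintro ⟨h, h1⟩; exact ⟨h, fun _ _ _ => h1⟩
  · rintro ⟨h, h1⟩; exact ⟨h, h1 h.1 h.2.1 h.2.2.1⟩

lemma S_frontier (A B A' B' : ℝ) : volume (frontier {x | x ∈ Cn A B A' B' ∧ Fp x ≤ 1}) = 0 := by
  rw [S_eq]
  refine measure_mono_null (t := frontier (Cn A B A' B') ∪ frontier Dn) ?_ ?_
  · refine (frontier_inter_subset _ _).trans ?_
    rw [frontier_compl]
    exact Set.union_subset_union Set.inter_subset_left Set.inter_subset_right
  · rw [measure_union_null_iff]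
    exact ⟨(Cn_convex A B A' B').addHaar_frontier _, Dn_convex.addHaar_frontier _⟩

lemma Fp_meas : Measurable Fp := by unfold Fp; fun_prop

lemma Cn_meas (A B A' B' : ℝ) : MeasurableSet (Cn A B A' B') := by
  unfold Cn
  measurability

lemma S_meas (A B A' B' : ℝ) : MeasurableSet {x | x ∈ Cn A B A' B' ∧ Fp x ≤ 1} :=
  (Cn_meas A B A' B').inter (measurableSet_le Fp_meas measurable_const)

lemma S_bdd {A B A' B' : ℝ} (hA : 0 < A) (hB : 0 < B) (hA' : 0 < A') (hB' : 0 < B') :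
    Bornology.IsBounded {x | x ∈ Cn A B A' B' ∧ Fp x ≤ 1} := by
  set C := (B * B' + B' / A ^ 2 + B / A' ^ 2) * 1 with hC
  have hC0 : 0 < C := by positivity
  refine Bornology.IsBounded.subset (Metric.isBounded_Icc (0 : Fin 3 → ℝ) (fun _ => C + 1)) ?_
  rintro x ⟨⟨x0, x1, x2, x3, x4, x5, x6⟩, h⟩
  obtain ⟨c0, c1, c2⟩ := cube_bound hA hB hA' hB' x0 x1 x2 x3 x4 x5 x6 h
  rw [← hC] at c0 c1 c2
  have key : ∀ w : ℝ, 0 < w → w ^ 3 ≤ C → w ≤ C + 1 := by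
    intro w hw hc
    by_contra! hlt
    have h1 : 1 < w := by linarith
    nlinarith [mul_pos hw hw]
  refine ⟨fun i => ?_, fun i => ?_⟩ <;> fin_cases i
  · exact x0.le
  · exact x1.le
  · exact x2.le
  · exact key _ x0 c0
  · exact key _ x1 c1
  · exact key _ x2 c2

def L3 : Submodule ℤ (Fin 3 → ℝ) := Submodule.span ℤ (Set.range (Pi.basisFun ℝ (Fin 3)))

instance : DiscreteTopology L3 := by unfold L3; infer_instance
instance : IsZLattice ℝ L3 := by unfold L3; infer_instance

lemma L3_covol : ZLattice.covolume L3 = 1 := by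
  have := ZLattice.covolume_eq_measure_fundamentalDomain L3 volume
    (ZSpan.isAddFundamentalDomain (Pi.basisFun ℝ (Fin 3)) volume)
  rw [this, ZSpan.fundamentalDomain_pi_basisFun, measureReal_def, Real.volume_pi_Ico_toReal]
  · simp
  · intro i; simp

lemma L3_mem (x : Fin 3 → ℝ) : x ∈ L3 ↔ ∀ i, ∃ n : ℤ, (n : ℝ) = x i := by
  unfold L3
  rw [Basis.mem_span_iff_repr_mem]
  simp

def Rg (A B A' B' Y : ℝ) : Set (ℕ × ℕ × ℕ) := {t | 0 < t.1 ∧ 0 < t.2.1 ∧ 0 < t.2.2 ∧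
  A * t.2.1 ≤ t.1 ∧ (t.1 : ℝ) < B * t.2.1 ∧ A' * t.2.2 ≤ t.1 ∧ (t.1 : ℝ) < B' * t.2.2 ∧
  (t.1 * t.2.1 * t.2.2 : ℝ) ≤ Y}

lemma Rg_image (A B A' B' Y : ℝ) : ({x | x ∈ Cn A B A' B' ∧ Fp x ≤ Y} ∩ L3 : Set (Fin 3 → ℝ)) =
    (fun t : ℕ × ℕ × ℕ => (![(t.1 : ℝ), t.2.1, t.2.2] : Fin 3 → ℝ)) '' Rg A B A' B' Y := by
  ext x
  simp only [Set.mem_inter_iff, Set.mem_ofPred_eq, SetLike.mem_coe, L3_mem, Set.mem_image]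
  constructor
  · rintro ⟨⟨⟨x0, x1, x2, hx⟩, h1⟩, h2⟩
    have pos : ∀ i, 0 < x i → ∃ n : ℕ, (n : ℝ) = x i := by
      intro i hi
      obtain ⟨n, hn⟩ := h2 i
      rw [← hn] at hi ⊢
      have hn0 : 0 < n := by exact_mod_cast hi
      refine ⟨n.toNat, ?_⟩
      have : ((n.toNat : ℤ) : ℝ) = n := by rw [Int.toNat_of_nonneg hn0.le]
      exact_mod_cast this
    obtain ⟨d, hd⟩ := pos 0 x0
    obtain ⟨e, he⟩ := pos 1 x1
    obtain ⟨f, hf⟩ := pos 2 x2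
    unfold Fp at h1
    rw [← hd] at x0 h1 hx
    rw [← he] at x1 h1 hx
    rw [← hf] at x2 h1 hx
    refine ⟨(d, e, f), ⟨by exact_mod_cast x0, by exact_mod_cast x1, by exact_mod_cast x2,
      hx.1, hx.2.1, hx.2.2.1, hx.2.2.2, h1⟩, ?_⟩
    funext i; fin_cases i <;> simp [*]
  · rintro ⟨⟨d, e, f⟩, ⟨h0, h1, h2, h3, h4, h5, h6, h7⟩, rfl⟩
    simp only at h0 h1 h2 h3 h4 h5 h6 h7
    refine ⟨⟨⟨?_, ?_, ?_, ?_, ?_, ?_, ?_⟩, ?_⟩, ?_⟩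
    · simpa using h0
    · simpa using h1
    · simpa using h2
    · simpa using h3
    · simpa using h4
    · simpa using h5
    · simpa using h6
    · simpa [Fp] using h7
    · intro i; fin_cases i
      · exact ⟨d, by simp⟩
      · exact ⟨e, by simp⟩
      · exact ⟨f, by simp⟩

lemma Rg_asym0 {A B A' B' : ℝ} (hA : 0 < A) (hB : 0 < B) (hA' : 0 < A') (hB' : 0 < B') :
    Tendsto (fun Y : ℝ => ((Rg A B A' B' Y).ncard : ℝ) / Y) atTop
      (𝓝 (volume.real {x | x ∈ Cn A B A' B' ∧ Fp x ≤ 1})) := by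
  have h := ZLattice.covolume.tendsto_card_le_div L3 (X := Cn A B A' B') (F := Fp) ?_ ?_
    (S_bdd hA hB hA' hB') (S_meas A B A' B') (S_frontier A B A' B')
  · rw [L3_covol, div_one] at h
    refine h.congr fun Y => ?_
    rw [Rg_image]
    change ((Set.ncard _ : ℕ) : ℝ) / Y = _
    rw [Set.ncard_image_of_injective]
    rintro ⟨d, e, f⟩ ⟨d', e', f'⟩ hh
    have e0 := congrFun hh 0
    have e1 := congrFun hh 1
    have e2 := congrFun hh 2
    simp at e0 e1 e2
    simp [e0, e1, e2]
  · rintro x r ⟨x0, x1, x2, x3, x4, x5, x6⟩ hr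
    refine ⟨?_, ?_, ?_, ?_, ?_, ?_, ?_⟩ <;> simp only [Pi.smul_apply, smul_eq_mul]
    · positivity
    · positivity
    · positivity
    · linarith [mul_le_mul_of_nonneg_left x3 hr.le]
    · linarith [mul_lt_mul_of_pos_left x4 hr]
    · linarith [mul_le_mul_of_nonneg_left x5 hr.le]
    · linarith [mul_lt_mul_of_pos_left x6 hr]
  · intro x r _
    simp [Fp]; ring

end region

open Module

section vol
open MeasureTheory Filter Topology
open scoped Pointwise

lemma lint_inv {a b : ℝ} (ha : 0 < a) (hab : a ≤ b) :
    ∫⁻ y in Set.Ioc a b, ENNReal.ofReal y⁻¹ = ENNReal.ofReal (Real.log b - Real.log a) := by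
  have hii : IntervalIntegrable (fun y : ℝ => y⁻¹) volume a b := by
    refine intervalIntegral.intervalIntegrable_inv (fun x hx => ?_) continuousOn_id
    rw [Set.uIcc_of_le hab] at hx
    exact (ha.trans_le hx.1).ne'
  rw [← ofReal_integral_eq_lintegral_ofReal]
  · rw [← intervalIntegral.integral_of_le hab, integral_inv_of_pos ha (ha.trans_le hab),
      Real.log_div (ha.trans_le hab).ne' ha.ne']
  · exact (intervalIntegrable_iff_integrableOn_Ioc_of_le hab).mp hii
  · refine (ae_restrict_mem measurableSet_Ioc).mono fun y hy => ?_
    exact inv_nonneg.mpr (ha.trans hy.1).le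

lemma lint_sq {w : ℝ} (hw : 0 < w) :
    ∫⁻ x, {x : ℝ | 0 < x ∧ x ^ 3 * w ≤ 1}.indicator (fun x => ENNReal.ofReal (x ^ 2)) x
      = ENNReal.ofReal (w⁻¹ / 3) := by
  set b : ℝ := w⁻¹ ^ ((1 : ℝ) / 3) with hb
  have hb0 : 0 < b := by positivity
  have hb3 : b ^ 3 = w⁻¹ := by
    rw [hb, ← Real.rpow_natCast, ← Real.rpow_mul (by positivity)]; norm_num
  have e : {x : ℝ | 0 < x ∧ x ^ 3 * w ≤ 1} = Set.Ioc 0 b := by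
    ext x
    simp only [Set.mem_ofPred_eq, Set.mem_Ioc]
    refine and_congr_right fun hx => ?_
    rw [← pow_le_pow_iff_left₀ hx.le hb0.le (n := 3) (by norm_num), hb3, ← one_div, le_div_iff₀ hw]
  rw [e, lintegral_indicator measurableSet_Ioc, ← ofReal_integral_eq_lintegral_ofReal]
  · rw [← intervalIntegral.integral_of_le hb0.le, integral_pow]
    norm_num [hb3]
  · exact ((continuous_pow 2).integrableOn_Icc).mono_set Set.Ioc_subset_Icc_self
  · exact Eventually.of_forall fun x => by positivity

def S' (A B A' B' : ℝ) : Set (ℝ × ℝ × ℝ) := {x | 0 < x.1 ∧ 0 < x.2.1 ∧ 0 < x.2.2 ∧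
  A * x.2.1 ≤ x.1 ∧ x.1 < B * x.2.1 ∧ A' * x.2.2 ≤ x.1 ∧ x.1 < B' * x.2.2 ∧
  x.1 * x.2.1 * x.2.2 ≤ 1}

lemma S'_meas (A B A' B' : ℝ) : MeasurableSet (S' A B A' B') := by
  unfold S'
  measurability

def Bx (A B A' B' : ℝ) : Set (ℝ × ℝ) := Set.Ioc B⁻¹ A⁻¹ ×ˢ Set.Ioc B'⁻¹ A'⁻¹

def T' (A B A' B' : ℝ) : Set (ℝ × ℝ × ℝ) :=
  {x | 0 < x.1 ∧ x.2 ∈ Bx A B A' B' ∧ x.1 ^ 3 * (x.2.1 * x.2.2) ≤ 1}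

lemma T'_meas (A B A' B' : ℝ) : MeasurableSet (T' A B A' B') := by
  have h1 : MeasurableSet (Bx A B A' B') := measurableSet_Ioc.prod measurableSet_Ioc
  refine (measurableSet_lt measurable_const measurable_fst).inter
    ((h1.preimage measurable_snd).inter (measurableSet_le
      (f := fun x : ℝ × ℝ × ℝ => x.1 ^ 3 * (x.2.1 * x.2.2)) (by fun_prop) measurable_const))

lemma slice_eq {A B A' B' : ℝ} (hA : 0 < A) (hB : 0 < B) (hA' : 0 < A') (hB' : 0 < B')
    (x : ℝ) : volume (Prod.mk x ⁻¹' S' A B A' B') =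
      ENNReal.ofReal (x ^ 2) * volume (Prod.mk x ⁻¹' T' A B A' B') := by
  rcases le_or_gt x 0 with hx | hx
  · have h1 : Prod.mk x ⁻¹' S' A B A' B' = ∅ := by
      ext w; simp [S', not_lt.mpr hx]
    have h2 : Prod.mk x ⁻¹' T' A B A' B' = ∅ := by
      ext w; simp [T', not_lt.mpr hx]
    rw [h1, h2]; simp
  · have h1 : Prod.mk x ⁻¹' S' A B A' B' = x • (Prod.mk x ⁻¹' T' A B A' B') := by
      ext ⟨y, z⟩
      rw [Set.mem_smul_set_iff_inv_smul_mem₀ hx.ne']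
      simp only [Set.mem_preimage, S', T', Bx, Set.mem_ofPred_eq, Set.mem_prod, Set.mem_Ioc,
        Prod.smul_mk, smul_eq_mul, hx, true_and]
      have i1 : B⁻¹ < x⁻¹ * y ↔ x < B * y := by
        rw [inv_mul_eq_div, lt_div_iff₀ hx, inv_mul_lt_iff₀ hB]
      have i2 : x⁻¹ * y ≤ A⁻¹ ↔ A * y ≤ x := by
        rw [inv_mul_eq_div, div_le_iff₀ hx, ← div_eq_inv_mul, le_div_iff₀ hA, mul_comm]
      have i3 : B'⁻¹ < x⁻¹ * z ↔ x < B' * z := by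
        rw [inv_mul_eq_div, lt_div_iff₀ hx, inv_mul_lt_iff₀ hB']
      have i4 : x⁻¹ * z ≤ A'⁻¹ ↔ A' * z ≤ x := by
        rw [inv_mul_eq_div, div_le_iff₀ hx, ← div_eq_inv_mul, le_div_iff₀ hA', mul_comm]
      have i5 : x ^ 3 * (x⁻¹ * y * (x⁻¹ * z)) = x * y * z := by field_simp
      rw [i1, i2, i3, i4, i5]
      constructor
      · rintro ⟨a, b, c, d, e, f, g⟩; exact ⟨⟨⟨d, c⟩, f, e⟩, g⟩
      · rintro ⟨⟨⟨d, c⟩, f, e⟩, g⟩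
        exact ⟨pos_of_mul_pos_right (hx.trans d) hB.le, pos_of_mul_pos_right (hx.trans f) hB'.le,
          c, d, e, f, g⟩
    rw [h1, Measure.addHaar_smul]
    congr 2
    simp

lemma S'_vol {A B A' B' : ℝ} (hA : 0 < A) (hB : A < B) (hA' : 0 < A') (hB' : A' < B') :
    volume (S' A B A' B') = ENNReal.ofReal
      ((Real.log B - Real.log A) * (Real.log B' - Real.log A') / 3) := by
  have hB0 := hA.trans hB
  have hB0' := hA'.trans hB'
  rw [Measure.volume_eq_prod, Measure.prod_apply (S'_meas A B A' B')]
  simp_rw [slice_eq hA hB0 hA' hB0']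
  have e1 : ∀ x, ENNReal.ofReal (x ^ 2) * volume (Prod.mk x ⁻¹' T' A B A' B') =
      ∫⁻ w : ℝ × ℝ, (T' A B A' B').indicator (fun q => ENNReal.ofReal (q.1 ^ 2)) (x, w) := by
    intro x
    have hm : MeasurableSet (Prod.mk x ⁻¹' T' A B A' B') :=
      (T'_meas A B A' B').preimage measurable_prodMk_left
    rw [← lintegral_indicator_const hm]
    rfl
  simp_rw [e1]
  rw [lintegral_lintegral_swap]
  swap
  · refine Measurable.aemeasurable ?_
    exact Measurable.indicator (by fun_prop) (T'_meas A B A' B')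
  have e2 : ∀ w : ℝ × ℝ, ∫⁻ x : ℝ, (T' A B A' B').indicator (fun q => ENNReal.ofReal (q.1 ^ 2)) (x, w)
      = (Bx A B A' B').indicator (fun w => ENNReal.ofReal (w.1⁻¹ / 3) * ENNReal.ofReal (w.2⁻¹)) w := by
    intro w
    by_cases hw : w ∈ Bx A B A' B'
    · rw [Set.indicator_of_mem hw]
      have p1 : 0 < w.1 := (inv_pos.mpr hB0).trans hw.1.1
      have p2 : 0 < w.2 := (inv_pos.mpr hB0').trans hw.2.1
      rw [← ENNReal.ofReal_mul (by positivity), show w.1⁻¹ / 3 * w.2⁻¹ = (w.1 * w.2)⁻¹ / 3 by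
        rw [mul_inv]; ring, ← lint_sq (mul_pos p1 p2)]
      refine lintegral_congr fun x => ?_
      simp only [Set.indicator, T', Set.mem_ofPred_eq, hw, true_and]
    · rw [Set.indicator_of_notMem hw]
      refine (lintegral_congr fun x => ?_).trans lintegral_zero
      rw [Set.indicator_of_notMem]
      exact fun h => hw h.2.1
  simp_rw [e2]
  rw [Bx, lintegral_indicator (measurableSet_Ioc.prod measurableSet_Ioc), Measure.volume_eq_prod,
    ← Measure.prod_restrict, lintegral_prod_mul (f := fun y : ℝ => ENNReal.ofReal (y⁻¹ / 3))
      (g := fun y : ℝ => ENNReal.ofReal y⁻¹) (by fun_prop) (by fun_prop)]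
  have e3 : ∀ y : ℝ, ENNReal.ofReal (y⁻¹ / 3) = ENNReal.ofReal (1 / 3) * ENNReal.ofReal y⁻¹ := by
    intro y
    rw [← ENNReal.ofReal_mul (by norm_num)]; congr 1; ring
  simp_rw [e3]
  have q1 : B⁻¹ ≤ A⁻¹ := inv_anti₀ hA hB.le
  have q2 : B'⁻¹ ≤ A'⁻¹ := inv_anti₀ hA' hB'.le
  rw [lintegral_const_mul _ (by fun_prop), lint_inv (inv_pos.mpr hB0) q1, lint_inv (inv_pos.mpr hB0') q2]
  have l1 := Real.log_le_log hA hB.le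
  rw [← ENNReal.ofReal_mul (by norm_num), ← ENNReal.ofReal_mul]
  · simp only [Real.log_inv]; congr 1; ring
  · simp only [Real.log_inv]
    have : 0 ≤ -Real.log A - -Real.log B := by linarith
    positivity

lemma S_vol {A B A' B' : ℝ} (hA : 0 < A) (hB : A < B) (hA' : 0 < A') (hB' : A' < B') :
    volume.real {x | x ∈ Cn A B A' B' ∧ Fp x ≤ 1} =
      (Real.log B - Real.log A) * (Real.log B' - Real.log A') / 3 := by
  have h1 := volume_preserving_piFinSuccAbove (fun _ : Fin 3 => ℝ) 0
  have h2 := (MeasurePreserving.id (volume : Measure ℝ)).prod (volume_preserving_finTwoArrow ℝ)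
  have h3 := h2.comp h1
  have h4 : {x | x ∈ Cn A B A' B' ∧ Fp x ≤ 1} =
      ((Prod.map id (MeasurableEquiv.finTwoArrow (α := ℝ))) ∘ 
        (MeasurableEquiv.piFinSuccAbove (fun _ : Fin 3 => ℝ) 0)) ⁻¹' (S' A B A' B') := by
    ext x
    simp only [Set.mem_ofPred_eq, Set.mem_preimage, S', Cn, Fp, and_assoc]
    rfl
  rw [measureReal_def, h4]
  have h5 := h3.measure_preimage (S'_meas A B A' B').nullMeasurableSet
  have l1 := Real.log_le_log hA hB.le
  have l2 := Real.log_le_log hA' hB'.le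
  rw [h5]
  change (volume (S' A B A' B')).toReal = _
  rw [S'_vol hA hB hA' hB', ENNReal.toReal_ofReal]
  have : 0 ≤ Real.log B - Real.log A := by linarith
  have : 0 ≤ Real.log B' - Real.log A' := by linarith
  positivity

theorem Rg_asym {A B A' B' : ℝ} (hA : 0 < A) (hB : A < B) (hA' : 0 < A') (hB' : A' < B') :
    Tendsto (fun Y : ℝ => ((Rg A B A' B' Y).ncard : ℝ) / Y) atTop
      (𝓝 ((Real.log B - Real.log A) * (Real.log B' - Real.log A') / 3)) := by
  rw [← S_vol hA hB hA' hB']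
  exact Rg_asym0 hA (hA.trans hB) hA' (hA'.trans hB')

end vol

open Module

section sieve
open Filter Topology

lemma Rg_finite (A B A' B' Y : ℝ) :
    (Rg A B A' B' Y).Finite := by
  set N := ⌈Y⌉₊ with hN
  refine Set.Finite.subset ((Set.finite_Iic N).prod ((Set.finite_Iic N).prod (Set.finite_Iic N))) ?_
  rintro ⟨d, e, f⟩ ⟨p1, p2, p3, -, -, -, -, h3⟩
  simp only at p1 p2 p3 h3
  have h4 : d * e * f ≤ ⌈Y⌉₊ := by
    have := h3.trans (Nat.le_ceil Y)
    exact_mod_cast this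
  have hde : 0 < d * e := Nat.mul_pos p1 p2
  have h5 : d * e ≤ d * e * f := Nat.le_mul_of_pos_right _ p3
  refine ⟨?_, ?_, ?_⟩ <;> simp only [Set.mem_Iic]
  · exact (Nat.le_mul_of_pos_right _ p2).trans (h5.trans h4)
  · exact (Nat.le_mul_of_pos_left _ p1).trans (h5.trans h4)
  · exact (Nat.le_mul_of_pos_left _ hde).trans h4

/-- The bounded region, as a finite set. -/
noncomputable def RF (A B Y : ℝ) : Finset (ℕ × ℕ × ℕ) := by
  classical
  exact if h : (Rg A B A B Y).Finite then h.toFinset else ∅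

lemma mem_RF {A B Y : ℝ} {t : ℕ × ℕ × ℕ} :
    t ∈ RF A B Y ↔ t ∈ Rg A B A B Y := by
  unfold RF
  rw [dif_pos (Rg_finite A B A B Y)]; simp

/-- `δ` is the density of the weight `f`. -/
def HasDens (A B : ℝ) (f : ℕ × ℕ × ℕ → ℝ) (δ : ℝ) : Prop :=
  Tendsto (fun Y : ℝ => (∑ t ∈ RF A B Y, f t) / Y) atTop
    (𝓝 (δ * ((Real.log B - Real.log A) ^ 2 / 3)))

lemma HasDens.sum {A B : ℝ} {ι : Type*} (s : Finset ι) (c : ι → ℝ) {f : ι → ℕ × ℕ × ℕ → ℝ}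
    {δ : ι → ℝ} (h : ∀ i ∈ s, HasDens A B (f i) (δ i)) :
    HasDens A B (fun t => ∑ i ∈ s, c i * f i t) (∑ i ∈ s, c i * δ i) := by
  unfold HasDens at *
  have := tendsto_finsetSum s (fun i hi => (h i hi).const_mul (c i))
  convert this using 2
  · rw [Finset.sum_comm, Finset.sum_div]
    refine Finset.sum_congr rfl fun i _ => ?_
    rw [← Finset.mul_sum, mul_div_assoc]
  · rw [Finset.sum_mul]
    exact Finset.sum_congr rfl fun i _ => by ring

/-- Indicator of divisibility of the three coordinates. -/
noncomputable def dv (a : ℕ × ℕ × ℕ) (t : ℕ × ℕ × ℕ) : ℝ :=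
  if a.1 ∣ t.1 ∧ a.2.1 ∣ t.2.1 ∧ a.2.2 ∣ t.2.2 then 1 else 0

lemma dens_dv {A B : ℝ} (hA : 0 < A) (hB : A < B) {a : ℕ × ℕ × ℕ} (h1 : 0 < a.1) (h2 : 0 < a.2.1)
    (h3 : 0 < a.2.2) : HasDens A B (dv a) (1 / (a.1 * a.2.1 * a.2.2)) := by
  obtain ⟨a, b, c⟩ := a
  simp only at h1 h2 h3 ⊢
  have ha : (0 : ℝ) < a := by exact_mod_cast h1
  have hb : (0 : ℝ) < b := by exact_mod_cast h2
  have hc : (0 : ℝ) < c := by exact_mod_cast h3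
  have hB0 := hA.trans hB
  have hA1 : 0 < A * b / a := by positivity
  have hB1 : A * b / a < B * b / a := by gcongr
  have hA2 : 0 < A * c / a := by positivity
  have hB2 : A * c / a < B * c / a := by gcongr
  have key := (Rg_asym hA1 hB1 hA2 hB2).comp
    (tendsto_id.atTop_div_const (show (0 : ℝ) < a * b * c by positivity))
  have l : ∀ u v : ℝ, 0 < u → 0 < v → Real.log (u * v / a) = Real.log u + Real.log v - Real.log a :=
    fun u v hu hv => by rw [Real.log_div (by positivity) ha.ne', Real.log_mul hu.ne' hv.ne']
  have key2 := key.const_mul (1 / ((a : ℝ) * b * c))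
  unfold HasDens
  convert key2 using 2 with Y
  · simp only [Function.comp, id]
    have e : ∑ t ∈ RF A B Y, dv (a, b, c) t =
        ((Rg (A * b / a) (B * b / a) (A * c / a) (B * c / a) (Y / (a * b * c))).ncard : ℝ) := by
      unfold dv
      rw [Finset.sum_boole, ← Set.ncard_coe_finset]
      have e2 : ((RF A B Y).filter (fun t : ℕ × ℕ × ℕ => a ∣ t.1 ∧ b ∣ t.2.1 ∧ c ∣ t.2.2) : 
          Set (ℕ × ℕ × ℕ)) = (fun t : ℕ × ℕ × ℕ => (a * t.1, b * t.2.1, c * t.2.2)) ''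
          (Rg (A * b / a) (B * b / a) (A * c / a) (B * c / a) (Y / (a * b * c))) := by
        have aux : ∀ d e f : ℕ, (a * d, b * e, c * f) ∈ Rg A B A B Y ↔ (d, e, f) ∈
            Rg (A * b / a) (B * b / a) (A * c / a) (B * c / a) (Y / (a * b * c)) := by
          intro d e f
          simp only [Rg, Set.mem_ofPred_eq, Nat.mul_pos_iff_of_pos_left h1,
            Nat.mul_pos_iff_of_pos_left h2, Nat.mul_pos_iff_of_pos_left h3, Nat.cast_mul]
          rw [div_mul_eq_mul_div, div_le_iff₀ ha, div_mul_eq_mul_div, lt_div_iff₀ ha,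
            div_mul_eq_mul_div, div_le_iff₀ ha, div_mul_eq_mul_div, lt_div_iff₀ ha,
            le_div_iff₀ (by positivity)]
          ring_nf
        ext ⟨x, y, z⟩
        simp only [Finset.coe_filter, Set.mem_ofPred_eq, mem_RF, Set.mem_image]
        constructor
        · rintro ⟨h, ⟨d, rfl⟩, ⟨e, rfl⟩, ⟨f, rfl⟩⟩
          exact ⟨(d, e, f), (aux d e f).mp h, rfl⟩
        · rintro ⟨⟨d, e, f⟩, h, h'⟩
          simp only [Prod.mk.injEq] at h'
          obtain ⟨rfl, rfl, rfl⟩ := h'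
          exact ⟨(aux d e f).mpr h, ⟨d, rfl⟩, ⟨e, rfl⟩, ⟨f, rfl⟩⟩
      simp only at e2 ⊢
      rw [e2, Set.ncard_image_of_injective]
      rintro ⟨d, e, f⟩ ⟨d', e', f'⟩ h
      simp only [Prod.mk.injEq] at h ⊢
      exact ⟨Nat.eq_of_mul_eq_mul_left h1 h.1, Nat.eq_of_mul_eq_mul_left h2 h.2.1,
        Nat.eq_of_mul_eq_mul_left h3 h.2.2⟩
    rw [e]
    field_simp
  · rw [l A b hA hb, l B b hB0 hb, l A c hA hc, l B c hB0 hc]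
    ring

/-- The local condition at `p`. -/
noncomputable def fl (p : ℕ) (t : ℕ × ℕ × ℕ) : ℝ :=
  if (if p = 2 then 2 else p ^ 2) ∣ t.1 * t.2.1 * t.2.2 then 0 else 1

/-- The local density at `p`. -/
noncomputable def dl (p : ℕ) : ℝ := if p = 2 then 1 / 8 else 1 - 6 / (p : ℝ) ^ 2 + 8 / (p : ℝ) ^ 3 - 3 / (p : ℝ) ^ 4

noncomputable def cA : Fin 3 → ℝ := ![1, -1, 0]
noncomputable def cB : Fin 3 → ℝ := ![0, 1, -1]

noncomputable def cp (p : ℕ) (i j k : Fin 3) : ℝ := if p = 2 then cA i * cA j * cA k else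
  cA i * cA j * cA k + cB i * cA j * cA k + cA i * cB j * cA k + cA i * cA j * cB k

def pm (p : ℕ) (a : ℕ × ℕ × ℕ) (m : Fin 3 × Fin 3 × Fin 3) : ℕ × ℕ × ℕ :=
  (a.1 * p ^ (m.1 : ℕ), a.2.1 * p ^ (m.2.1 : ℕ), a.2.2 * p ^ (m.2.2 : ℕ))

/-- Indicator of divisibility. -/
noncomputable def ind (a n : ℕ) : ℝ := if a ∣ n then 1 else 0

lemma dv_eq (a b c d e f : ℕ) : dv (a, b, c) (d, e, f) = ind a d * ind b e * ind c f := by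
  unfold dv ind
  by_cases h1 : a ∣ d <;> by_cases h2 : b ∣ e <;> by_cases h3 : c ∣ f <;> simp [h1, h2, h3]

lemma ind_mul {a p : ℕ} (i n : ℕ) (h : a.Coprime p) : ind (a * p ^ i) n = ind a n * ind (p ^ i) n := by
  unfold ind
  have : a * p ^ i ∣ n ↔ a ∣ n ∧ p ^ i ∣ n :=
    ⟨fun h => ⟨dvd_of_mul_right_dvd h, dvd_of_mul_left_dvd h⟩,
      fun h' => (h.pow_right i).mul_dvd_of_dvd_of_dvd h'.1 h'.2⟩
  by_cases h1 : a ∣ n <;> by_cases h2 : p ^ i ∣ n <;> simp [h1, h2, this]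

lemma fl_two (d e f : ℕ) : fl 2 (d, e, f) = (1 - ind 2 d) * (1 - ind 2 e) * (1 - ind 2 f) := by
  unfold fl ind
  simp only [if_true, Nat.prime_two.dvd_mul]
  by_cases h1 : 2 ∣ d <;> by_cases h2 : 2 ∣ e <;> by_cases h3 : 2 ∣ f <;> simp [h1, h2, h3]

lemma fl_odd {p : ℕ} (hp : p.Prime) (h2 : p ≠ 2) (d e f : ℕ) : fl p (d, e, f) =
    (1 - ind p d) * (1 - ind p e) * (1 - ind p f) + (ind p d - ind (p ^ 2) d) * (1 - ind p e) * (1 - ind p f)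
    + (1 - ind p d) * (ind p e - ind (p ^ 2) e) * (1 - ind p f)
    + (1 - ind p d) * (1 - ind p e) * (ind p f - ind (p ^ 2) f) := by
  unfold fl ind
  simp only [if_neg h2]
  have sq : ∀ n, p ^ 2 ∣ n → p ∣ n := fun n h => (dvd_pow_self p two_ne_zero).trans h
  have cop : ∀ n, ¬ p ∣ n → (p ^ 2).Coprime n := fun n h => 
    Nat.Coprime.pow_left 2 ((Nat.Prime.coprime_iff_not_dvd hp).mpr h)
  have two : ∀ m n, p ∣ m → p ∣ n → p ^ 2 ∣ m * n := fun m n h h' => by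
    rw [pow_two]; exact mul_dvd_mul h h'
  by_cases h1 : p ∣ d <;> by_cases h2 : p ∣ e <;> by_cases h3 : p ∣ f
  · have : p ^ 2 ∣ d * e * f := (two d e h1 h2).mul_right f
    simp [h1, h2, h3, this]
  · have : p ^ 2 ∣ d * e * f := (two d e h1 h2).mul_right f
    simp [h1, h2, h3, this]
  · have : p ^ 2 ∣ d * e * f := by
      rw [mul_right_comm]; exact (two d f h1 h3).mul_right e
    simp [h1, h2, h3, this]
  · have e1 : p ^ 2 ∣ d * e * f ↔ p ^ 2 ∣ d := by
      rw [(cop f h3).dvd_mul_right, (cop e h2).dvd_mul_right]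
    by_cases h4 : p ^ 2 ∣ d <;> simp [h1, h2, h3, e1, h4]
  · have : p ^ 2 ∣ d * e * f := by
      rw [mul_assoc]; exact (two e f h2 h3).mul_left d
    simp [h1, h2, h3, this]
  · have e1 : p ^ 2 ∣ d * e * f ↔ p ^ 2 ∣ e := by
      rw [(cop f h3).dvd_mul_right, (cop d h1).dvd_mul_left]
    by_cases h4 : p ^ 2 ∣ e <;> simp [h1, h2, h3, e1, h4]
  · have e1 : p ^ 2 ∣ d * e * f ↔ p ^ 2 ∣ f := by
      rw [((cop d h1).mul_right (cop e h2)).dvd_mul_left]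
    by_cases h4 : p ^ 2 ∣ f <;> simp [h1, h2, h3, e1, h4]
  · have h4 : ¬ p ^ 2 ∣ d * e * f := by
      rw [((cop d h1).mul_right (cop e h2)).dvd_mul_left]
      exact fun h => h3 (sq _ h)
    have h5 : ¬ p ^ 2 ∣ d := fun h => h1 (sq _ h)
    have h6 : ¬ p ^ 2 ∣ e := fun h => h2 (sq _ h)
    have h7 : ¬ p ^ 2 ∣ f := fun h => h3 (sq _ h)
    simp [h1, h2, h3, h4, h5, h6, h7]

lemma ind_one (n : ℕ) : ind 1 n = 1 := by simp [ind]

lemma step_fun {p : ℕ} (hp : p.Prime) {a : ℕ × ℕ × ℕ} (h1 : a.1.Coprime p) (h2 : a.2.1.Coprime p)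
    (h3 : a.2.2.Coprime p) (t : ℕ × ℕ × ℕ) :
    dv a t * fl p t = ∑ m : Fin 3 × Fin 3 × Fin 3, cp p m.1 m.2.1 m.2.2 * dv (pm p a m) t := by
  obtain ⟨a, b, c⟩ := a
  obtain ⟨d, e, f⟩ := t
  simp only at h1 h2 h3
  simp only [pm, dv_eq, ind_mul _ _ h1, ind_mul _ _ h2, ind_mul _ _ h3, Fintype.sum_prod_type,
    Fin.sum_univ_three]
  by_cases h2 : p = 2
  · subst h2
    rw [fl_two]
    simp [cp, cA, ind_one]
    ring
  · rw [fl_odd hp h2]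
    simp [cp, cA, cB, ind_one, h2]
    ring

lemma step_dens {p : ℕ} (hp : p.Prime) {a : ℕ × ℕ × ℕ} (D : ℝ) (h1 : 0 < a.1) (h2 : 0 < a.2.1)
    (h3 : 0 < a.2.2) : D * dl p / (a.1 * a.2.1 * a.2.2) =
    ∑ m : Fin 3 × Fin 3 × Fin 3, cp p m.1 m.2.1 m.2.2 *
      (D / (((pm p a m).1 : ℕ) * ((pm p a m).2.1 : ℕ) * ((pm p a m).2.2 : ℕ))) := by
  obtain ⟨a, b, c⟩ := a
  simp only at h1 h2 h3
  have ha : (0 : ℝ) < a := by exact_mod_cast h1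
  have hb : (0 : ℝ) < b := by exact_mod_cast h2
  have hc : (0 : ℝ) < c := by exact_mod_cast h3
  have hp0 : (0 : ℝ) < p := by exact_mod_cast hp.pos
  simp only [pm, Fintype.sum_prod_type, Fin.sum_univ_three]
  by_cases h2 : p = 2
  · subst h2
    simp [cp, cA, dl]
    field_simp
    ring
  · simp [cp, cA, cB, dl, h2]
    field_simp
    ring

theorem dens_sieve {A B : ℝ} (hA : 0 < A) (hB : A < B) (Q : Finset ℕ) :
    (∀ p ∈ Q, p.Prime) → ∀ a : ℕ × ℕ × ℕ, 0 < a.1 → 0 < a.2.1 → 0 < a.2.2 →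
    (∀ p ∈ Q, a.1.Coprime p ∧ a.2.1.Coprime p ∧ a.2.2.Coprime p) →
    HasDens A B (fun t => dv a t * ∏ p ∈ Q, fl p t) ((∏ p ∈ Q, dl p) / (a.1 * a.2.1 * a.2.2)) := by
  induction Q using Finset.induction_on with
  | empty =>
    intro _ a h1 h2 h3 _
    simpa using dens_dv hA hB h1 h2 h3
  | insert p Q hpQ ih =>
    intro hQ a h1 h2 h3 hc
    have hp := hQ p (Finset.mem_insert_self _ _)
    have ih' := ih (fun q hq => hQ q (Finset.mem_insert_of_mem hq))
    have hcp := hc p (Finset.mem_insert_self _ _)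
    have key := HasDens.sum (A := A) (B := B) Finset.univ
      (fun m : Fin 3 × Fin 3 × Fin 3 => cp p m.1 m.2.1 m.2.2)
      (fun m _ => ih' (pm p a m) (Nat.mul_pos h1 (pow_pos hp.pos _)) (Nat.mul_pos h2 (pow_pos hp.pos _))
        (Nat.mul_pos h3 (pow_pos hp.pos _)) (fun q hq => by
          have hq' := hc q (Finset.mem_insert_of_mem hq)
          have hpq : p.Coprime q := (Nat.coprime_primes hp (hQ q (Finset.mem_insert_of_mem hq))).mpr
            (fun h => hpQ (h ▸ hq))
          exact ⟨hq'.1.mul_left (hpq.pow_left _), hq'.2.1.mul_left (hpq.pow_left _),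
            hq'.2.2.mul_left (hpq.pow_left _)⟩))
    rw [← step_dens hp _ h1 h2 h3] at key
    rw [Finset.prod_insert hpQ, mul_comm (dl p)]
    convert key using 2 with t
    rw [Finset.prod_insert hpQ, ← mul_assoc, step_fun hp hcp.1 hcp.2.1 hcp.2.2, Finset.sum_mul]
    exact Finset.sum_congr rfl fun m _ => by ring

theorem dens_sieve' {A B : ℝ} (hA : 0 < A) (hB : A < B) (Q : Finset ℕ)
    (hQ : ∀ p ∈ Q, p.Prime) : HasDens A B (fun t => ∏ p ∈ Q, fl p t) (∏ p ∈ Q, dl p) := by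
  have := dens_sieve hA hB Q hQ (1, 1, 1) (by simp) (by simp) (by simp) (fun p _ => by simp)
  simpa [dv] using this

end sieve

open Module

section tail
open Filter Topology

lemma sq_dvd_cases {p : ℕ} (hp : p.Prime) {d e f : ℕ} (h : p ^ 2 ∣ d * e * f) :
    (p ∣ d ∧ p ∣ e) ∨ (p ∣ d ∧ p ∣ f) ∨ (p ∣ e ∧ p ∣ f) ∨ p ^ 2 ∣ d ∨ p ^ 2 ∣ e ∨ p ^ 2 ∣ f := by
  have cop : ∀ n, ¬ p ∣ n → (p ^ 2).Coprime n := fun n h => 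
    Nat.Coprime.pow_left 2 ((Nat.Prime.coprime_iff_not_dvd hp).mpr h)
  by_cases h1 : p ∣ d <;> by_cases h2 : p ∣ e <;> by_cases h3 : p ∣ f <;> simp only [h1, h2, h3,
    true_and, true_or, or_true, false_and, false_or]
  · rw [(cop f h3).dvd_mul_right, (cop e h2).dvd_mul_right] at h
    exact Or.inl h
  · rw [(cop f h3).dvd_mul_right, (cop d h1).dvd_mul_left] at h
    exact Or.inr (Or.inl h)
  · rw [((cop d h1).mul_right (cop e h2)).dvd_mul_left] at h
    exact Or.inr (Or.inr h)
  · rw [((cop d h1).mul_right (cop e h2)).dvd_mul_left] at h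
    exact Or.inr (Or.inr h)

/-- Multiples of `q` in `(0, n]`. -/
def Mq (n q : ℕ) : Finset ℕ := (Finset.Ioc 0 n).filter (q ∣ ·)

def Wp (n p : ℕ) : Finset (ℕ × ℕ × ℕ) :=
  Mq n p ×ˢ Mq n p ×ˢ Mq n 1 ∪ (Mq n p ×ˢ Mq n 1 ×ˢ Mq n p ∪ (Mq n 1 ×ˢ Mq n p ×ˢ Mq n p ∪
  (Mq n (p ^ 2) ×ˢ Mq n 1 ×ˢ Mq n 1 ∪ (Mq n 1 ×ˢ Mq n (p ^ 2) ×ˢ Mq n 1 ∪ 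
    Mq n 1 ×ˢ Mq n 1 ×ˢ Mq n (p ^ 2)))))

lemma Mq_card (n q : ℕ) : ((Mq n q).card : ℝ) ≤ n / q := by
  unfold Mq
  rw [Nat.Ioc_filter_dvd_card_eq_div]
  exact Nat.cast_div_le

lemma Mq3_card (n q r s : ℕ) :
    ((Mq n q ×ˢ Mq n r ×ˢ Mq n s).card : ℝ) ≤ (n / q) * ((n / r) * (n / s)) := by
  rw [Finset.card_product, Finset.card_product]
  push_cast
  have := Mq_card n q
  have := Mq_card n r
  have := Mq_card n s
  gcongr

lemma Wp_card (n p : ℕ) : ((Wp n p).card : ℝ) ≤ 6 * (n : ℝ) ^ 3 * ((p : ℝ) ^ 2)⁻¹ := by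
  have key : (Wp n p).card ≤ (Mq n p ×ˢ Mq n p ×ˢ Mq n 1).card + ((Mq n p ×ˢ Mq n 1 ×ˢ Mq n p).card +
      ((Mq n 1 ×ˢ Mq n p ×ˢ Mq n p).card + ((Mq n (p ^ 2) ×ˢ Mq n 1 ×ˢ Mq n 1).card +
      ((Mq n 1 ×ˢ Mq n (p ^ 2) ×ˢ Mq n 1).card + (Mq n 1 ×ˢ Mq n 1 ×ˢ Mq n (p ^ 2)).card)))) := by
    unfold Wp
    refine (Finset.card_union_le _ _).trans (Nat.add_le_add_left ?_ _)
    refine (Finset.card_union_le _ _).trans (Nat.add_le_add_left ?_ _)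
    refine (Finset.card_union_le _ _).trans (Nat.add_le_add_left ?_ _)
    refine (Finset.card_union_le _ _).trans (Nat.add_le_add_left ?_ _)
    exact Finset.card_union_le _ _
  have key' : ((Wp n p).card : ℝ) ≤ _ := Nat.cast_le.mpr key
  push_cast at key'
  have h1 := Mq3_card n p p 1
  have h2 := Mq3_card n p 1 p
  have h3 := Mq3_card n 1 p p
  have h4 := Mq3_card n (p ^ 2) 1 1
  have h5 := Mq3_card n 1 (p ^ 2) 1
  have h6 := Mq3_card n 1 1 (p ^ 2)
  refine key'.trans ((add_le_add h1 (add_le_add h2 (add_le_add h3 (add_le_add h4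
    (add_le_add h5 h6))))).trans (le_of_eq ?_))
  push_cast
  ring

open Classical in
lemma tail {A B : ℝ} (hA : 0 < A) (hB : A < B) (z : ℕ) (hz : 0 < z) {Y : ℝ} (hY : 0 < Y) :
    (((RF A B Y).filter (fun t : ℕ × ℕ × ℕ => ∃ p : ℕ, p.Prime ∧ z < p ∧
      p ^ 2 ∣ t.1 * t.2.1 * t.2.2)).card : ℝ) ≤ 6 * (B * B + B / A ^ 2 + B / A ^ 2) * Y / z := by
  have hB0 := hA.trans hB
  set C := (B * B + B / A ^ 2 + B / A ^ 2) with hC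
  have hC0 : 0 < C := by positivity
  set M : ℝ := (C * Y) ^ ((1 : ℝ) / 3) with hM
  have hM0 : 0 < M := by positivity
  have hM3 : M ^ 3 = C * Y := by
    rw [hM, ← Real.rpow_natCast, ← Real.rpow_mul (by positivity)]; norm_num
  set n := ⌊M⌋₊ with hn
  have hn3 : (n : ℝ) ^ 3 ≤ C * Y := by
    rw [← hM3]
    gcongr
    exact Nat.floor_le hM0.le
  have sub : (RF A B Y).filter (fun t : ℕ × ℕ × ℕ => ∃ p : ℕ, p.Prime ∧ z < p ∧
      p ^ 2 ∣ t.1 * t.2.1 * t.2.2) ⊆ (Finset.Ioc z n).biUnion (Wp n) := by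
    rintro ⟨d, e, f⟩ ht
    rw [Finset.mem_filter, mem_RF] at ht
    obtain ⟨⟨p1, p2, p3, q1, q2, q3, q4, h⟩, p, hp, hzp, hdv⟩ := ht
    simp only at p1 p2 p3 q1 q2 q3 q4 h hdv
    have hdr : (0 : ℝ) < d := by exact_mod_cast p1
    have her : (0 : ℝ) < e := by exact_mod_cast p2
    have hfr : (0 : ℝ) < f := by exact_mod_cast p3
    obtain ⟨c1, c2, c3⟩ := cube_bound hA hB0 hA hB0 hdr her hfr q1 q2 q3 q4 h
    rw [← hC, ← hM3] at c1 c2 c3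
    have le : ∀ m : ℕ, (m : ℝ) ^ 3 ≤ M ^ 3 → m ≤ n := fun m hm =>
      Nat.le_floor ((pow_le_pow_iff_left₀ (by positivity) hM0.le (by norm_num)).mp hm)
    have d1 := le d c1
    have d2 := le e c2
    have d3 := le f c3
    have hcs := sq_dvd_cases hp hdv
    have sq : ∀ n, p ^ 2 ∣ n → p ∣ n := fun n h => (dvd_pow_self p two_ne_zero).trans h
    have hpn : p ≤ n := by
      rcases hcs with h | h | h | h | h | h
      · exact (Nat.le_of_dvd p1 h.1).trans d1
      · exact (Nat.le_of_dvd p1 h.1).trans d1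
      · exact (Nat.le_of_dvd p2 h.1).trans d2
      · exact (Nat.le_of_dvd p1 (sq _ h)).trans d1
      · exact (Nat.le_of_dvd p2 (sq _ h)).trans d2
      · exact (Nat.le_of_dvd p3 (sq _ h)).trans d3
    rw [Finset.mem_biUnion]
    refine ⟨p, Finset.mem_Ioc.mpr ⟨hzp, hpn⟩, ?_⟩
    simp only [Wp, Mq, Finset.mem_union, Finset.mem_product, Finset.mem_filter, Finset.mem_Ioc,
      one_dvd, p1, p2, p3, d1, d2, d3, true_and, and_true]
    tauto
  calc _ ≤ (((Finset.Ioc z n).biUnion (Wp n)).card : ℝ) := by exact_mod_cast Finset.card_le_card sub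
    _ ≤ ∑ p ∈ Finset.Ioc z n, ((Wp n p).card : ℝ) := by exact_mod_cast Finset.card_biUnion_le
    _ ≤ ∑ p ∈ Finset.Ioc z n, 6 * (n : ℝ) ^ 3 * ((p : ℝ) ^ 2)⁻¹ := Finset.sum_le_sum fun p _ => Wp_card n p
    _ = 6 * (n : ℝ) ^ 3 * ∑ p ∈ Finset.Ioc z n, ((p : ℝ) ^ 2)⁻¹ := by rw [Finset.mul_sum]
    _ ≤ 6 * (C * Y) * (z : ℝ)⁻¹ := by
      have hs : ∑ p ∈ Finset.Ioc z n, ((p : ℝ) ^ 2)⁻¹ ≤ (z : ℝ)⁻¹ := by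
        rcases le_or_gt z n with h | h
        · refine (sum_Ioc_inv_sq_le_sub hz.ne' h).trans ?_
          have : (0 : ℝ) ≤ (n : ℝ)⁻¹ := by positivity
          linarith
        · rw [Finset.Ioc_eq_empty (by omega)]; simp
      gcongr
    _ = _ := by ring

def good (t : ℕ × ℕ × ℕ) : Prop := Odd (t.1 * t.2.1 * t.2.2) ∧ Squarefree (t.1 * t.2.1 * t.2.2)

/-- Primes up to `z`. -/
def pz (z : ℕ) : Finset ℕ := (Finset.range (z + 1)).filter Nat.Prime

lemma fl_cases (p : ℕ) (t : ℕ × ℕ × ℕ) : fl p t = 0 ∨ fl p t = 1 := by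
  unfold fl; split_ifs <;> simp

lemma fl_good {p : ℕ} (hp : p.Prime) {t : ℕ × ℕ × ℕ} (h : good t) : fl p t = 1 := by
  unfold fl
  rw [if_neg]
  obtain ⟨h1, h2⟩ := h
  split_ifs with hp2
  · intro hd; exact (Nat.not_even_iff_odd.mpr h1) (even_iff_two_dvd.mpr hd)
  · intro hd; rw [pow_two] at hd
    exact Nat.squarefree_iff_prime_squarefree.mp h2 p hp hd

open Classical in
lemma prod_le (z : ℕ) (hz : 2 ≤ z) (t : ℕ × ℕ × ℕ) :
    (if good t then (1 : ℝ) else 0) ≤ ∏ p ∈ pz z, fl p t ∧ ∏ p ∈ pz z, fl p t ≤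
      (if good t then 1 else 0) + 
      (if ∃ p : ℕ, p.Prime ∧ z < p ∧ p ^ 2 ∣ t.1 * t.2.1 * t.2.2 then 1 else 0) := by
  by_cases hg : good t
  · have : ∏ p ∈ pz z, fl p t = 1 := Finset.prod_eq_one fun p hp => fl_good (by
      simp only [pz, Finset.mem_filter] at hp; exact hp.2) hg
    rw [this, if_pos hg]
    refine ⟨le_rfl, ?_⟩
    split_ifs <;> norm_num
  · rw [if_neg hg, zero_add]
    by_cases hall : ∀ p ∈ pz z, fl p t = 1
    · rw [Finset.prod_eq_one hall]
      refine ⟨by norm_num, ?_⟩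
      rw [if_pos]
      have hodd : Odd (t.1 * t.2.1 * t.2.2) := by
        have h2 := hall 2 (by simp [pz, Nat.prime_two]; omega)
        rw [← Nat.not_even_iff_odd, even_iff_two_dvd]
        intro h
        simp [fl, h] at h2
      have hns : ¬ Squarefree (t.1 * t.2.1 * t.2.2) := fun h => hg ⟨hodd, h⟩
      rw [Nat.squarefree_iff_prime_squarefree] at hns
      push Not at hns
      obtain ⟨p, hp, hd⟩ := hns
      refine ⟨p, hp, ?_, by rwa [pow_two]⟩
      by_contra! hpz
      have h2 := hall p (by simp [pz, hp]; omega)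
      have hp2 : p ≠ 2 := by
        rintro rfl
        exact (Nat.not_even_iff_odd.mpr hodd) (even_iff_two_dvd.mpr (dvd_of_mul_left_dvd hd))
      rw [← pow_two] at hd
      simp [fl, hp2, hd] at h2
    · push Not at hall
      obtain ⟨p, hp, h1⟩ := hall
      rw [Finset.prod_eq_zero hp ((fl_cases p t).resolve_right h1)]
      refine ⟨le_rfl, ?_⟩
      split_ifs <;> norm_num

open Classical in
lemma good_bound {A B : ℝ} (hA : 0 < A) (hB : A < B) (z : ℕ) (hz : 2 ≤ z) {Y : ℝ} (hY : 0 < Y) :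
    |(((RF A B Y).filter good).card : ℝ) / Y - (∑ t ∈ RF A B Y, ∏ p ∈ pz z, fl p t) / Y| ≤
      6 * (B * B + B / A ^ 2 + B / A ^ 2) / z := by
  have h1 : (((RF A B Y).filter good).card : ℝ) ≤ ∑ t ∈ RF A B Y, ∏ p ∈ pz z, fl p t := by
    rw [← Finset.sum_boole]
    exact Finset.sum_le_sum fun t _ => (prod_le z hz t).1
  have h2 : ∑ t ∈ RF A B Y, ∏ p ∈ pz z, fl p t ≤ (((RF A B Y).filter good).card : ℝ) + 
      6 * (B * B + B / A ^ 2 + B / A ^ 2) * Y / z := by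
    refine le_trans ?_ (add_le_add_right (tail hA hB z (by omega) hY) _)
    rw [← Finset.sum_boole, ← Finset.sum_boole, ← Finset.sum_add_distrib]
    exact Finset.sum_le_sum fun t _ => (prod_le z hz t).2
  rw [← sub_div, abs_div, abs_of_pos hY, abs_of_nonpos (by linarith), div_le_iff₀ hY]
  have : 6 * (B * B + B / A ^ 2 + B / A ^ 2) / z * Y = 6 * (B * B + B / A ^ 2 + B / A ^ 2) * Y / z := by
    ring
  rw [this]; linarith

noncomputable def PP : ℝ := ∏' p : {p : ℕ // p.Prime ∧ Odd p},
              (1 - 6 / (p.1 : ℝ) ^ 2 + 8 / (p.1 : ℝ) ^ 3 - 3 / (p.1 : ℝ) ^ 4)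

lemma PP_mult : Multipliable (fun p : {p : ℕ // p.Prime ∧ Odd p} => 
    (1 - 6 / (p.1 : ℝ) ^ 2 + 8 / (p.1 : ℝ) ^ 3 - 3 / (p.1 : ℝ) ^ 4)) := by
  have hs : Summable (fun p : {p : ℕ // p.Prime ∧ Odd p} =>
      ‖- 6 / (p.1 : ℝ) ^ 2 + 8 / (p.1 : ℝ) ^ 3 - 3 / (p.1 : ℝ) ^ 4‖) := by
    have h0 : Summable (fun n : ℕ => 17 * (1 / (n : ℝ) ^ 2)) :=
      (Real.summable_one_div_nat_pow.mpr (by norm_num)).mul_left _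
    refine Summable.of_nonneg_of_le (fun _ => norm_nonneg _) (fun p => ?_)
      (h0.comp_injective (Subtype.val_injective (p := fun p : ℕ => p.Prime ∧ Odd p)))
    have hp : (1 : ℝ) ≤ p.1 := by exact_mod_cast p.2.1.one_lt.le
    set x : ℝ := (p.1 : ℝ) with hx
    have a3 : 1 / x ^ 3 ≤ 1 / x ^ 2 := by gcongr <;> first | exact hp | norm_num
    have a4 : 1 / x ^ 4 ≤ 1 / x ^ 2 := by gcongr <;> first | exact hp | norm_num
    have b2 : 0 < 1 / x ^ 2 := by positivity
    have b3 : 0 < 1 / x ^ 3 := by positivity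
    have b4 : 0 < 1 / x ^ 4 := by positivity
    simp only [Function.comp, ← hx]
    rw [Real.norm_eq_abs, abs_le, show -6 / x ^ 2 + 8 / x ^ 3 - 3 / x ^ 4 =
      -6 * (1 / x ^ 2) + 8 * (1 / x ^ 3) - 3 * (1 / x ^ 4) by ring]
    constructor <;> linarith
  have := multipliable_one_add_of_summable hs
  refine this.congr fun p => ?_
  ring

lemma dl_tendsto : Tendsto (fun z : ℕ => ∏ p ∈ pz z, dl p) atTop (𝓝 (PP / 8)) := by
  classical
  have h := PP_mult.hasProd
  have hmono : Tendsto (fun z : ℕ => (Finset.subtype (fun p : ℕ => p.Prime ∧ Odd p) (Finset.range (z + 1))))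
      atTop atTop := by
    refine tendsto_atTop_finset_of_monotone ?_ ?_
    · intro a b hab x hx
      simp only [Finset.mem_subtype, Finset.mem_range] at hx ⊢
      omega
    · intro x; exact ⟨x.1, by simp⟩
  have h2 := (Tendsto.comp h hmono).mul_const (1 / 8)
  rw [show PP / 8 = PP * (1 / 8) by ring]
  refine h2.congr' ?_
  filter_upwards [eventually_ge_atTop 2] with z hz
  simp only [Function.comp]
  have h2m : 2 ∈ pz z := by simp [pz, Nat.prime_two]; omega
  rw [← Finset.mul_prod_erase _ _ h2m, mul_comm]
  have e8 : dl 2 = 1 / 8 := by simp [dl]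
  rw [e8]
  congr 1
  rw [Finset.prod_subtype_eq_prod_filter (s := Finset.range (z + 1)) (p := fun p : ℕ => p.Prime ∧ Odd p)
    (f := fun p : ℕ => 1 - 6 / (p : ℝ) ^ 2 + 8 / (p : ℝ) ^ 3 - 3 / (p : ℝ) ^ 4)]
  refine Finset.prod_congr ?_ ?_
  · ext p
    simp only [pz, Finset.mem_filter, Finset.mem_erase]
    constructor
    · rintro ⟨h1, h2, h3⟩
      refine ⟨?_, h1, h2⟩
      rintro rfl
      exact absurd h3 (by decide)
    · rintro ⟨h1, h2, h3⟩
      exact ⟨h2, h3, h3.odd_of_ne_two h1⟩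
  · intro p hp
    rw [dl, if_neg (Finset.ne_of_mem_erase hp)]

open Classical in
theorem good_asym {A B : ℝ} (hA : 0 < A) (hB : A < B) :
    Tendsto (fun Y : ℝ => (((RF A B Y).filter good).card : ℝ) / Y) atTop
      (𝓝 (PP / 8 * ((Real.log B - Real.log A) ^ 2 / 3))) := by
  set V := (Real.log B - Real.log A) ^ 2 / 3 with hV
  set C := 6 * (B * B + B / A ^ 2 + B / A ^ 2) with hC
  rw [Metric.tendsto_atTop]
  intro ε hε
  have t1 : Tendsto (fun z : ℕ => (∏ p ∈ pz z, dl p) * V) atTop (𝓝 (PP / 8 * V)) :=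
    dl_tendsto.mul_const V
  have t2 : Tendsto (fun z : ℕ => C / (z : ℝ)) atTop (𝓝 0) :=
    tendsto_const_div_atTop_nhds_zero_nat C
  have ev1 := (Metric.tendsto_nhds.mp t1 (ε / 3) (by positivity))
  have ev2 := (Metric.tendsto_nhds.mp t2 (ε / 3) (by positivity))
  obtain ⟨z, ⟨hz1, hz2⟩, hz3⟩ := ((ev1.and ev2).and (eventually_ge_atTop 2)).exists
  have t3 := dens_sieve' hA hB (pz z) (fun p hp => (Finset.mem_filter.mp hp).2)
  unfold HasDens at t3
  rw [Metric.tendsto_atTop] at t3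
  obtain ⟨N, hN⟩ := t3 (ε / 3) (by positivity)
  refine ⟨max N 1, fun Y hY => ?_⟩
  have hY0 : 0 < Y := lt_of_lt_of_le one_pos ((le_max_right _ _).trans hY)
  have k1 := good_bound hA hB z hz3 hY0
  have k2 := hN Y ((le_max_left _ _).trans hY)
  rw [← hC] at k1
  rw [Real.dist_eq] at *
  rw [sub_zero] at hz2
  have k3 := (abs_lt.mp hz1)
  have k4 := (abs_lt.mp hz2)
  have k5 := (abs_le.mp k1)
  have k6 := (abs_lt.mp k2)
  simp only [← hV] at k6
  rw [abs_lt]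
  constructor <;> linarith [k3.1, k3.2, k4.1, k4.2, k5.1, k5.2, k6.1, k6.2]

theorem G_asym {A B : ℝ} (hA : 0 < A) (hB : A < B) :
    Tendsto (fun Y : ℝ => ((G A B Y).ncard : ℝ) / Y) atTop
      (𝓝 (PP / 8 * ((Real.log B - Real.log A) ^ 2 / 3))) := by
  classical
  have h := good_asym hA hB
  have hm : Tendsto (fun Y : ℝ => Y - 1) atTop atTop := tendsto_atTop_add_const_right _ (-1) tendsto_id
  have hr : Tendsto (fun Y : ℝ => (Y - 1) / Y) atTop (𝓝 1) := by
    have : Tendsto (fun Y : ℝ => 1 - Y⁻¹) atTop (𝓝 (1 - 0)) :=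
      tendsto_const_nhds.sub tendsto_inv_atTop_zero
    rw [sub_zero] at this
    refine this.congr' ?_
    filter_upwards [eventually_gt_atTop 0] with Y hY
    field_simp
  have hlow := (h.comp hm).mul hr
  rw [mul_one] at hlow
  have e1 : ∀ Y, ((RF A B Y).filter good : Set (ℕ × ℕ × ℕ)) ⊇ G A B Y := by
    intro Y t ht
    have hp := G_pos ht
    obtain ⟨g1, g2, g3, g4, g5, g6, g7⟩ := ht
    rw [Finset.mem_coe, Finset.mem_filter, mem_RF]
    refine ⟨⟨hp.1, hp.2.1, hp.2.2, g4, g5, g6, g7, ?_⟩, g1, g2⟩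
    push_cast at g3
    exact g3.le
  have e2 : ∀ Y, ((RF A B (Y - 1)).filter good : Set (ℕ × ℕ × ℕ)) ⊆ G A B Y := by
    intro Y t ht
    rw [Finset.mem_coe, Finset.mem_filter, mem_RF] at ht
    obtain ⟨⟨-, -, -, g4, g5, g6, g7, g3⟩, g1, g2⟩ := ht
    refine ⟨g1, g2, ?_, g4, g5, g6, g7⟩
    push_cast
    linarith
  refine tendsto_of_tendsto_of_tendsto_of_le_of_le' hlow h ?_ ?_
  · filter_upwards [eventually_gt_atTop 1] with Y hY
    have h1 : 0 < Y - 1 := by linarith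
    have := Set.ncard_le_ncard (e2 Y) (G_finite A B Y)
    rw [Set.ncard_coe_finset] at this
    have hc : (((RF A B (Y - 1)).filter good).card : ℝ) ≤ (G A B Y).ncard := by exact_mod_cast this
    simp only [Function.comp]
    rw [div_mul_div_cancel₀ h1.ne']
    gcongr
  · filter_upwards [eventually_gt_atTop 1] with Y hY
    have := Set.ncard_le_ncard (e1 Y) (Finset.finite_toSet _)
    rw [Set.ncard_coe_finset] at this
    have hc : ((G A B Y).ncard : ℝ) ≤ (((RF A B Y).filter good).card : ℝ) := by exact_mod_cast this
    gcongr

end tail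

open Module

section final
open Filter Topology

lemma Jc_asym {k ν : ℕ} {r r' : ℤ} (H : Cls k ν r r') (hk : 0 < k) (hν : 0 < ν) {R₁ R₂ : ℝ}
    (h0 : 0 < R₁) (h12 : R₁ < R₂) :
    Tendsto (fun X : ℝ => ((Jc R₁ R₂ X k r r').ncard : ℝ) / √X) atTop
      (𝓝 (1 / (4 * k * ν) * (PP / 8 * ((2 * (Real.log R₂ - Real.log R₁)) ^ 2 / 3)))) := by
  have hk' : (0 : ℝ) < k := by exact_mod_cast hk
  have hν' : (0 : ℝ) < ν := by exact_mod_cast hν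
  have hR2 := h0.trans h12
  set A := R₁ ^ 2 * ν ^ 2 / (4 * k) with hA
  set B := R₂ ^ 2 * ν ^ 2 / (4 * k) with hB
  have hA0 : 0 < A := by positivity
  have hAB : A < B := by rw [hA, hB]; gcongr
  have hlog : Real.log B - Real.log A = 2 * (Real.log R₂ - Real.log R₁) := by
    rw [← Real.log_div (hA0.trans hAB).ne' hA0.ne', ← Real.log_div hR2.ne' h0.ne',
      show B / A = (R₂ / R₁) ^ 2 by rw [hA, hB]; field_simp, Real.log_pow]
    norm_num
  have hs : Tendsto (fun X : ℝ => √X / (4 * k * ν)) atTop atTop :=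
    Real.tendsto_sqrt_atTop.atTop_div_const (by positivity)
  have t1 := ((G_asym hA0 hAB).comp hs).const_mul (1 / (4 * k * ν : ℝ))
  rw [hlog] at t1
  have t2 : Tendsto (fun X : ℝ => (⌈B⌉₊ : ℝ) / √X) atTop (𝓝 0) :=
    Real.tendsto_sqrt_atTop.const_div_atTop _
  have t3 := t1.sub t2
  rw [sub_zero] at t3
  have e : ∀ X : ℝ, 1 / (4 * k * ν : ℝ) * (((fun Y : ℝ => ((G A B Y).ncard : ℝ) / Y) ∘
      fun X : ℝ => √X / (4 * k * ν)) X) = ((G A B (√X / (4 * k * ν))).ncard : ℝ) / √X := by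
    intro X
    simp only [Function.comp]
    field_simp
  refine tendsto_of_tendsto_of_tendsto_of_le_of_le' t3 t1 ?_ ?_
  · filter_upwards [eventually_gt_atTop 0] with X hX
    rw [e, ← sub_div]
    have h1 := H.le_card R₁ R₂ X
    have h2 : ((G A B (√X / (4 * k * ν))).ncard : ℝ) ≤ (Jc R₁ R₂ X k r r').ncard + ⌈B⌉₊ := by
      rw [← Nat.cast_add]; exact Nat.cast_le.mpr h1
    gcongr
    linarith
  · filter_upwards [eventually_gt_atTop 0] with X hX
    rw [e]
    have h1 := H.card_le R₁ R₂ X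
    have h2 : ((Jc R₁ R₂ X k r r').ncard : ℝ) ≤ ((G A B (√X / (4 * k * ν))).ncard : ℝ) :=
      Nat.cast_le.mpr h1
    gcongr

lemma Kset_asym {R₁ R₂ : ℝ} (h0 : 0 < R₁) (h12 : R₁ < R₂) :
    Tendsto (fun X : ℝ => (Nat.card (Kset R₁ R₂ X) : ℝ) / √X) atTop
      (𝓝 (5 / 96 * PP * (Real.log R₂ - Real.log R₁) ^ 2)) := by
  have c1 := Jc_asym (show Cls 1 1 3 3 from ⟨by simp⟩) (by norm_num) (by norm_num) h0 h12
  have c2 := Jc_asym (show Cls 2 1 1 1 from ⟨by simp⟩) (by norm_num) (by norm_num) h0 h12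
  have c3 := Jc_asym (show Cls 2 1 3 3 from ⟨by simp⟩) (by norm_num) (by norm_num) h0 h12
  have c4 := Jc_asym (show Cls 2 2 1 3 from ⟨by simp⟩) (by norm_num) (by norm_num) h0 h12
  have c5 := Jc_asym (show Cls 2 2 3 1 from ⟨by simp⟩) (by norm_num) (by norm_num) h0 h12
  have c := (c1.add (c2.add (c3.add (c4.add c5)))).const_mul (1 / 2)
  convert c using 2 with X
  · have h1 := card_J_eq R₁ R₂ X
    rw [card_J] at h1
    have h2 := congrArg (Nat.cast (R := ℝ)) h1
    rw [← add_div, ← add_div, ← add_div, ← add_div]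
    push_cast at h2
    rw [← h2]
    ring
  · push_cast
    ring

end final

/-- For a `V₄`-quartic field `K` with `Δ_K` even, exactly one of the
discriminants of the three quadratic subfields has strictly smaller 2-adic valuation
than the other two; calling it `Δ₃` and the other two `Δ₁, Δ₂` with `|Δ₁| ≤ |Δ₂|`,
the number of such `K` with `Δ_K < X`, `Δ_K` even, `R₁²·|Δ₃| ≤ |Δ₁|` and
`|Δ₂| < R₂²·|Δ₃|` equals `(5/96)·P·X^{1/2}·(log R₂ − log R₁)² + o(X^{1/2})`, where
`P = ∏_{p odd prime} (1 − 6p⁻² + 8p⁻³ − 3p⁻⁴)`. -/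
theorem stmt6 (R₁ R₂ : ℝ) (h0 : 0 < R₁) (h12 : R₁ < R₂) :
    (∀ K : IntermediateField ℚ ℂ, IsV4Quartic K → Even (quartDisc K) →
      ∃! F₃ : IntermediateField ℚ ℂ, IsQuadSubfield K F₃ ∧
        ∀ F : IntermediateField ℚ ℂ, IsQuadSubfield K F → F ≠ F₃ →
          padicValInt 2 (quartDisc F₃) < padicValInt 2 (quartDisc F)) ∧
    (fun X : ℝ =>
        (Nat.card {K : IntermediateField ℚ ℂ //
            IsV4Quartic K ∧ (quartDisc K : ℝ) < X ∧ Even (quartDisc K) ∧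
            ∃ F₁ F₂ F₃ : IntermediateField ℚ ℂ,
              F₁ ≠ F₂ ∧ F₁ ≠ F₃ ∧ F₂ ≠ F₃ ∧
              IsQuadSubfield K F₁ ∧ IsQuadSubfield K F₂ ∧ IsQuadSubfield K F₃ ∧
              padicValInt 2 (quartDisc F₃) < padicValInt 2 (quartDisc F₁) ∧
              padicValInt 2 (quartDisc F₃) < padicValInt 2 (quartDisc F₂) ∧
              |quartDisc F₁| ≤ |quartDisc F₂| ∧
              R₁ ^ 2 * |(quartDisc F₃ : ℝ)| ≤ |(quartDisc F₁ : ℝ)| ∧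
              |(quartDisc F₂ : ℝ)| < R₂ ^ 2 * |(quartDisc F₃ : ℝ)|} : ℝ) -
          5 / 96 *
            (∏' p : {p : ℕ // p.Prime ∧ Odd p},
              (1 - 6 / (p.1 : ℝ) ^ 2 + 8 / (p.1 : ℝ) ^ 3 - 3 / (p.1 : ℝ) ^ 4)) *
            X ^ ((1 : ℝ) / 2) * (Real.log R₂ - Real.log R₁) ^ 2)
      =o[Filter.atTop] fun X : ℝ => X ^ ((1 : ℝ) / 2) := by
  refine ⟨part1, ?_⟩
  have h := Kset_asym h0 h12
  have h1 : (fun X : ℝ => ((Nat.card (Kset R₁ R₂ X) : ℝ) -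
      5 / 96 * PP * X ^ ((1 : ℝ) / 2) * (Real.log R₂ - Real.log R₁) ^ 2))
      =o[Filter.atTop] fun X : ℝ => X ^ ((1 : ℝ) / 2) := by
    simp_rw [← Real.sqrt_eq_rpow]
    rw [Asymptotics.isLittleO_iff_tendsto']
    · have h2 := h.sub_const (5 / 96 * PP * (Real.log R₂ - Real.log R₁) ^ 2)
      rw [sub_self] at h2
      refine h2.congr' ?_
      filter_upwards [Filter.eventually_gt_atTop 0] with X hX
      have : √X ≠ 0 := (Real.sqrt_pos.mpr hX).ne'
      field_simp
    · filter_upwards [Filter.eventually_gt_atTop 0] with X hX h3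
      exact absurd h3 (Real.sqrt_pos.mpr hX).ne'
  exact h1
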